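/- arXiv:2504.07201 — 4 statements merged into one kernel-verified Lean document; each statement's English description precedes it below -/
import Mathlib

section
/- For every nonzero complex number q and every integer n ≥ 2, the Hecke–Clifford algebra G_n(q) is a finite-dimensional ℂ-algebra of dimension 2^n · n!. -/
noncomputable section

/-- Generator index type for the Hecke–Clifford algebra `G_n(q)`:
`Sum.inl i` is the braid-type generator `t_{i+1}` (the paper's 1-indexed `t_1, …, t_{n-1}`),
`Sum.inr j` is the Clifford generator `v_{j+1}` (the paper's 1-indexed `v_1, …, v_n`). -/
abbrev HCgen (n : ℕ) : Type := Fin (n - 1) ⊕ Fin n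

/-- The generator `t_i` in the free algebra (0-indexed). -/
def tF (n : ℕ) (i : Fin (n - 1)) : FreeAlgebra ℂ (HCgen n) :=
  FreeAlgebra.ι ℂ (Sum.inl i)

/-- The generator `v_j` in the free algebra (0-indexed). -/
def vF (n : ℕ) (j : Fin n) : FreeAlgebra ℂ (HCgen n) :=
  FreeAlgebra.ι ℂ (Sum.inr j)

/-- The defining relations of the Hecke–Clifford algebra `G_n(q)`. -/
inductive HCrel (q : ℂ) (n : ℕ) :
    FreeAlgebra ℂ (HCgen n) → FreeAlgebra ℂ (HCgen n) → Prop
  | braid (i j : Fin (n - 1)) (h : (j : ℕ) = (i : ℕ) + 1) :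
      HCrel q n (tF n i * tF n j * tF n i) (tF n j * tF n i * tF n j)
  | tcomm (i j : Fin (n - 1)) (h : (i : ℕ) + 2 ≤ (j : ℕ) ∨ (j : ℕ) + 2 ≤ (i : ℕ)) :
      HCrel q n (tF n i * tF n j) (tF n j * tF n i)
  | quad (i : Fin (n - 1)) :
      HCrel q n (tF n i * tF n i) (1 + (q - q⁻¹) • tF n i)
  | vsq (j : Fin n) :
      HCrel q n (vF n j * vF n j) 1
  | vanti (j k : Fin n) (h : j ≠ k) :
      HCrel q n (vF n j * vF n k) (-(vF n k * vF n j))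
  | tv₁ (i : Fin (n - 1)) (j j' : Fin n) (hj : (j : ℕ) = (i : ℕ))
      (hj' : (j' : ℕ) = (i : ℕ) + 1) :
      HCrel q n (tF n i * vF n j) (vF n j' * tF n i)
  | tv₂ (i : Fin (n - 1)) (j j' : Fin n) (hj : (j : ℕ) = (i : ℕ))
      (hj' : (j' : ℕ) = (i : ℕ) + 1) :
      HCrel q n (tF n i * vF n j') (vF n j * tF n i - (q - q⁻¹) • (vF n j - vF n j'))
  | tvcomm (i : Fin (n - 1)) (l : Fin n) (h : (l : ℕ) ≠ (i : ℕ) ∧ (l : ℕ) ≠ (i : ℕ) + 1) :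
      HCrel q n (tF n i * vF n l) (vF n l * tF n i)

/-- The Hecke–Clifford algebra `G_n(q)`. -/
abbrev HeckeClifford (q : ℂ) (n : ℕ) := RingQuot (HCrel q n)

/-- The generator `t_i` of `G_n(q)` (0-indexed: `i = 0, …, n-2`). -/
def HCt (q : ℂ) (n : ℕ) (i : Fin (n - 1)) : HeckeClifford q n :=
  RingQuot.mkAlgHom ℂ (HCrel q n) (tF n i)

/-- The generator `v_j` of `G_n(q)` (0-indexed: `j = 0, …, n-1`). -/
def HCv (q : ℂ) (n : ℕ) (j : Fin n) : HeckeClifford q n :=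
  RingQuot.mkAlgHom ℂ (HCrel q n) (vF n j)

/-- The element `e_i := v_i v_{i+1}` of `G_n(q)` (0-indexed: `i = 0, …, n-2`). -/
def HCe (q : ℂ) (n : ℕ) (i : Fin (n - 1)) : HeckeClifford q n :=
  HCv q n ⟨(i : ℕ), by have := i.2; omega⟩ * HCv q n ⟨(i : ℕ) + 1, by have := i.2; omega⟩

/-- The even subalgebra `G_n[0]` of `G_n(q)`, generated by the `t_i` and the `e_j`. -/
def HCeven (q : ℂ) (n : ℕ) : Subalgebra ℂ (HeckeClifford q n) :=
  Algebra.adjoin ℂ (Set.range (HCt q n) ∪ Set.range (HCe q n))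

end

section DescWord

variable {A : Type*} [Ring A]

/-- The descending product `t k * t (k - 1) * ⋯` with `l` factors. -/
def descWord (t : ℕ → A) (k : ℕ) : ℕ → A
  | 0 => 1
  | l + 1 => descWord t k l * t (k - l)

theorem descWord_mul_of_lt {t : ℕ → A} (hcomm : ∀ i j, i + 2 ≤ j → t i * t j = t j * t i)
    {k l i : ℕ} (h : i + l < k) : descWord t k l * t i = t i * descWord t k l := by
  induction l with
  | zero => simp [descWord]
  | succ l ih =>
    rw [descWord, mul_assoc, ← hcomm i (k - l) (by omega), ← mul_assoc, ih (by omega), mul_assoc]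

theorem descWord_mul_of_gt {t : ℕ → A} (hcomm : ∀ i j, i + 2 ≤ j → t i * t j = t j * t i)
    (hbraid : ∀ i, t i * t (i + 1) * t i = t (i + 1) * t i * t (i + 1))
    {k l i : ℕ} (hi : i + 1 ≤ k) (hl : l ≤ k + 1) (h : k + 1 ≤ i + l) :
    descWord t k l * t (i + 1) = t i * descWord t k l := by
  induction l with
  | zero => omega
  | succ l ih =>
    rcases eq_or_ne (k + 1) (i + (l + 1)) with he | he
    · cases l with
      | zero => omega
      | succ l =>
        obtain rfl : k = i + l + 1 := by omega
        have e1 : i + l + 1 - l = i + 1 := by omega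
        have e2 : i + l + 1 - (l + 1) = i := by omega
        have hw : descWord t (i + l + 1) l * t i = t i * descWord t (i + l + 1) l :=
          descWord_mul_of_lt hcomm (by omega)
        rw [descWord, descWord, e1, e2, mul_assoc, mul_assoc, ← mul_assoc (t (i + 1)), ← hbraid,
          mul_assoc, ← mul_assoc _ (t i), hw]
        simp only [mul_assoc]
    · rw [descWord, mul_assoc, hcomm (k - l) (i + 1) (by omega), ← mul_assoc,
        ih (by omega) (by omega), mul_assoc]

end DescWord

section Spanning

open Pointwise Submodule

variable {A : Type*} [Ring A] [Algebra ℂ A]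

theorem adjoin_subset_of_mul_right_mem {S : Set A} {P : Submodule ℂ A} (h1 : 1 ∈ P)
    (hP : ∀ x ∈ P, ∀ g ∈ S, x * g ∈ P) {y : A} (hy : y ∈ Algebra.adjoin ℂ S) : y ∈ P := by
  suffices h : ∀ x ∈ P, x * y ∈ P by simpa using h 1 h1
  induction hy using Algebra.adjoin_induction with
  | mem g hg => exact fun x hx => hP x hx g hg
  | algebraMap r =>
    intro x hx
    rw [← Algebra.commutes, ← Algebra.smul_def]
    exact P.smul_mem r hx
  | add a b _ _ ha hb =>
    intro x hx
    rw [mul_add]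
    exact P.add_mem (ha x hx) (hb x hx)
  | mul a b _ _ ha hb =>
    intro x hx
    rw [← mul_assoc]
    exact hb _ (ha x hx)

theorem span_mul_right_mem {s : Set A} {P : Submodule ℂ A} {g : A}
    (h : ∀ x ∈ s, x * g ∈ P) {x : A} (hx : x ∈ span ℂ s) : x * g ∈ P := by
  have : span ℂ s ≤ P.comap (LinearMap.mulRight ℂ g) := span_le.2 fun x hx => h x hx
  exact this hx

theorem mul_mem_span_mul {s u : Set A} {x y : A} (hx : x ∈ span ℂ s) (hy : y ∈ span ℂ u) :
    x * y ∈ span ℂ (s * u) := by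
  rw [← span_mul_span]
  exact mul_mem_mul hx hy

/-- The first `k` of a family of anticommuting involutions generate a space of dimension
at most `2 ^ k`. -/
theorem exists_spanning_of_anticommuting (v : ℕ → A) (m : ℕ)
    (hsq : ∀ j < m, v j * v j = 1) (hanti : ∀ j k, j ≠ k → v j * v k = -(v k * v j)) :
    ∀ k ≤ m, ∃ s : Finset A, s.card ≤ 2 ^ k ∧ (1 : A) ∈ span ℂ (s : Set A) ∧
      ∀ j < k, ∀ x ∈ span ℂ (s : Set A), x * v j ∈ span ℂ (s : Set A) := by
  classical
  intro k
  induction k with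
  | zero => exact fun _ => ⟨{1}, by simp, subset_span (by simp), by simp⟩
  | succ k ih =>
    intro hk
    obtain ⟨s, hs, h1, hc⟩ := ih (by omega)
    have hl : ∀ x ∈ span ℂ (s : Set A), x ∈ span ℂ (↑(s * {1, v k}) : Set A) := by
      intro x hx
      rw [Finset.coe_mul]
      simpa using mul_mem_span_mul hx (subset_span (s := (↑({1, v k} : Finset A) : Set A))
        (a := 1) (by simp))
    have hr : ∀ x ∈ span ℂ (s : Set A), x * v k ∈ span ℂ (↑(s * {1, v k}) : Set A) := by
      intro x hx
      rw [Finset.coe_mul]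
      exact mul_mem_span_mul hx (subset_span (by simp))
    refine ⟨s * {1, v k}, ?_, hl 1 h1, ?_⟩
    · calc (s * {1, v k}).card ≤ s.card * ({1, v k} : Finset A).card := Finset.card_mul_le
        _ ≤ 2 ^ k * 2 := Nat.mul_le_mul hs Finset.card_le_two
        _ = 2 ^ (k + 1) := (pow_succ 2 k).symm
    · intro j hj x hx
      refine span_mul_right_mem ?_ hx
      intro y hy
      obtain ⟨a, ha, b, hb, rfl⟩ := Finset.mem_mul.1 (Finset.mem_coe.1 hy)
      have ha' : a ∈ span ℂ (s : Set A) := subset_span ha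
      rcases (show b = 1 ∨ b = v k by simpa using hb) with rfl | rfl
      · rw [mul_one]
        rcases Nat.lt_succ_iff_lt_or_eq.1 hj with h | rfl
        · exact hl _ (hc j h a ha')
        · exact hr a ha'
      · rcases Nat.lt_succ_iff_lt_or_eq.1 hj with h | rfl
        · rw [mul_assoc, hanti k j (by omega), mul_neg, ← mul_assoc]
          exact neg_mem (hr _ (hc j h a ha'))
        · rw [mul_assoc, hsq j (by omega), mul_one]
          exact hl a ha'

/-- The first `k` generators of a Hecke algebra of type `A` generate a space of dimension
at most `(k + 1)!`. -/
theorem exists_spanning_of_hecke (t : ℕ → A) (m : ℕ) (z : ℂ)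
    (hcomm : ∀ i j, i + 2 ≤ j → t i * t j = t j * t i)
    (hbraid : ∀ i, t i * t (i + 1) * t i = t (i + 1) * t i * t (i + 1))
    (hquad : ∀ i < m, t i * t i = 1 + z • t i) :
    ∀ k ≤ m, ∃ s : Finset A, s.card ≤ (k + 1).factorial ∧ (1 : A) ∈ span ℂ (s : Set A) ∧
      ∀ i < k, ∀ x ∈ span ℂ (s : Set A), x * t i ∈ span ℂ (s : Set A) := by
  classical
  intro k
  induction k with
  | zero => exact fun _ => ⟨{1}, by simp, subset_span (by simp), by simp⟩
  | succ k ih =>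
    intro hk
    obtain ⟨s, hs, h1, hc⟩ := ih (by omega)
    set W : Finset A := (Finset.range (k + 2)).image (descWord t k)
    have hl : ∀ x ∈ span ℂ (s : Set A), ∀ l ≤ k + 1,
        x * descWord t k l ∈ span ℂ (↑(s * W) : Set A) := by
      intro x hx l hl
      rw [Finset.coe_mul]
      refine mul_mem_span_mul hx (subset_span ?_)
      exact Finset.mem_coe.2 (Finset.mem_image_of_mem _ (Finset.mem_range.2 (by omega)))
    refine ⟨s * W, ?_, by simpa [descWord] using hl 1 h1 0 (by omega), ?_⟩
    · calc (s * W).card ≤ s.card * W.card := Finset.card_mul_le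
        _ ≤ (k + 1).factorial * (k + 2) :=
          Nat.mul_le_mul hs (Finset.card_image_le.trans (Finset.card_range _).le)
        _ = (k + 1 + 1).factorial := by rw [Nat.factorial_succ (k + 1), mul_comm]
    · intro i hi x hx
      refine span_mul_right_mem ?_ hx
      intro y hy
      obtain ⟨a, ha, b, hb, rfl⟩ := Finset.mem_mul.1 (Finset.mem_coe.1 hy)
      have ha' : a ∈ span ℂ (s : Set A) := subset_span ha
      obtain ⟨l, hlk, rfl⟩ := Finset.mem_image.1 hb
      rw [Finset.mem_range] at hlk
      rw [mul_assoc]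
      rcases lt_trichotomy (i + l) k with h | h | h
      · rw [descWord_mul_of_lt hcomm (by omega), ← mul_assoc]
        exact hl _ (hc i (by omega) a ha') l (by omega)
      · have e : descWord t k l * t i = descWord t k (l + 1) := by
          rw [descWord, show k - l = i by omega]
        rw [e]
        exact hl a ha' _ (by omega)
      · rcases eq_or_ne (i + l) (k + 1) with h' | h'
        · cases l with
          | zero => omega
          | succ l =>
            have e : descWord t k (l + 1) * t i = descWord t k l + z • descWord t k (l + 1) := by
              rw [descWord, show k - l = i by omega, mul_assoc, hquad i (by omega), mul_add,
                mul_one, mul_smul_comm]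
            rw [e, mul_add, mul_smul_comm]
            exact add_mem (hl a ha' _ (by omega)) (smul_mem _ _ (hl a ha' _ (by omega)))
        · cases i with
          | zero => omega
          | succ i =>
            rw [descWord_mul_of_gt hcomm hbraid (by omega) (by omega) (by omega), ← mul_assoc]
            exact hl _ (hc i (by omega) a ha') l (by omega)

end Spanning

noncomputable section Representation

open Equiv

variable {n : ℕ}

/-- The position `i` on which the `i`-th adjacent transposition acts. -/
def loPos (i : Fin (n - 1)) : Fin n := ⟨i, by have := i.2; omega⟩

/-- The position `i + 1` on which the `i`-th adjacent transposition acts. -/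
def hiPos (i : Fin (n - 1)) : Fin n := ⟨i + 1, by have := i.2; omega⟩

/-- The adjacent transposition exchanging `i` and `i + 1`. -/
def adjSwap (i : Fin (n - 1)) : Perm (Fin n) := swap (loPos i) (hiPos i)

theorem loPos_lt_hiPos (i : Fin (n - 1)) : loPos i < hiPos i := by simp [loPos, hiPos]

@[simp] theorem loPos_ne_hiPos (i : Fin (n - 1)) : loPos i ≠ hiPos i := (loPos_lt_hiPos i).ne

@[simp] theorem adjSwap_loPos (i : Fin (n - 1)) : adjSwap i (loPos i) = hiPos i := by
  simp [adjSwap]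

@[simp] theorem adjSwap_hiPos (i : Fin (n - 1)) : adjSwap i (hiPos i) = loPos i := by
  simp [adjSwap]

theorem adjSwap_of_ne {i : Fin (n - 1)} {l : Fin n} (h : l ≠ loPos i) (h' : l ≠ hiPos i) :
    adjSwap i l = l := swap_apply_of_ne_of_ne h h'

@[simp] theorem adjSwap_adjSwap (i : Fin (n - 1)) (l : Fin n) : adjSwap i (adjSwap i l) = l := by
  simp [adjSwap]

@[simp] theorem adjSwap_mul_self (i : Fin (n - 1)) : adjSwap i * adjSwap i = 1 := by
  simp [adjSwap]

/-- The underlying space of the regular representation: functions on the PBW basis. -/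
abbrev PBWSpace (n : ℕ) : Type := (Fin n → Bool) × Perm (Fin n) → ℂ

/-- Toggle the bit at position `j`. -/
def flipBit (j : Fin n) (b : Fin n → Bool) : Fin n → Bool := Function.update b j (!b j)

theorem flipBit_flipBit (j : Fin n) (b : Fin n → Bool) : flipBit j (flipBit j b) = b := by
  simp [flipBit]

theorem flipBit_comm (j k : Fin n) (b : Fin n → Bool) :
    flipBit j (flipBit k b) = flipBit k (flipBit j b) := by
  ext l
  by_cases hj : l = j <;> by_cases hk : l = k <;> simp_all [flipBit, Function.update_apply]

theorem flipBit_comp (s : Perm (Fin n)) (j : Fin n) (b : Fin n → Bool) :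
    flipBit j (b ∘ s) = flipBit (s j) b ∘ s := by
  ext l
  simp [flipBit, Function.update_apply]

/-- The sign picked up by a Clifford generator at `j` when moved past the generators before it. -/
def cliffordSign (j : Fin n) (b : Fin n → Bool) : ℂ := ∏ l, if l < j ∧ b l then -1 else 1

theorem cliffordSign_mul_self (j : Fin n) (b : Fin n → Bool) :
    cliffordSign j b * cliffordSign j b = 1 := by
  rw [cliffordSign, ← Finset.prod_mul_distrib]
  refine Finset.prod_eq_one fun l _ => ?_
  split_ifs <;> simp

theorem cliffordSign_flipBit_of_le {j k : Fin n} (h : j ≤ k) (b : Fin n → Bool) :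
    cliffordSign j (flipBit k b) = cliffordSign j b := by
  refine Finset.prod_congr rfl fun l _ => ?_
  by_cases hl : l < j
  · simp [flipBit, Function.update_of_ne (hl.trans_le h).ne]
  · simp [hl]

theorem cliffordSign_flipBit_of_lt {j k : Fin n} (h : k < j) (b : Fin n → Bool) :
    cliffordSign j (flipBit k b) = -cliffordSign j b := by
  rw [cliffordSign, cliffordSign, ← Finset.mul_prod_erase _ _ (Finset.mem_univ k),
    ← Finset.mul_prod_erase (Finset.univ) (fun l => if l < j ∧ b l then (-1 : ℂ) else 1)
      (Finset.mem_univ k), ← neg_mul]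
  congr 1
  · cases hb : b k <;> simp [flipBit, h, hb]
  · refine Finset.prod_congr rfl fun l hl => ?_
    simp [flipBit, Function.update_of_ne (Finset.ne_of_mem_erase hl)]

theorem cliffordSign_hiPos (i : Fin (n - 1)) (b : Fin n → Bool) :
    cliffordSign (hiPos i) b = (if b (loPos i) then -1 else 1) * cliffordSign (loPos i) b := by
  rw [cliffordSign, cliffordSign, ← Finset.mul_prod_erase _ _ (Finset.mem_univ (loPos i)),
    ← Finset.mul_prod_erase (Finset.univ) (fun l => if l < loPos i ∧ b l then (-1 : ℂ) else 1)
      (Finset.mem_univ (loPos i))]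
  congr 1
  · simp [loPos_lt_hiPos]
  · simp only [lt_self_iff_false, false_and, if_false, one_mul]
    refine Finset.prod_congr rfl fun l hl => ?_
    have h := Finset.ne_of_mem_erase hl
    have : l < hiPos i ↔ l < loPos i := by
      simp only [Fin.lt_def, hiPos, loPos, ne_eq, Fin.ext_iff] at h ⊢
      omega
    simp [this]

theorem cliffordSign_comp_adjSwap {i : Fin (n - 1)} {j : Fin n} (h : j ≠ hiPos i)
    (b : Fin n → Bool) : cliffordSign j (b ∘ adjSwap i) = cliffordSign j b := by
  rw [cliffordSign, cliffordSign,
    ← Equiv.prod_comp (adjSwap i) (fun l => if l < j ∧ b l then (-1 : ℂ) else 1)]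
  refine Finset.prod_congr rfl fun l _ => ?_
  have : adjSwap i l < j ↔ l < j := by
    by_cases h1 : l = loPos i
    · subst h1
      rw [adjSwap_loPos]
      simp only [Fin.lt_def, hiPos, loPos, ne_eq, Fin.ext_iff] at h ⊢
      omega
    by_cases h2 : l = hiPos i
    · subst h2
      rw [adjSwap_hiPos]
      simp only [Fin.lt_def, hiPos, loPos, ne_eq, Fin.ext_iff] at h ⊢
      omega
    rw [adjSwap_of_ne h1 h2]
  simp [this]

/-- The action of the Clifford generator `v_j`. -/
def cliffordOp (j : Fin n) : Module.End ℂ (PBWSpace n) where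
  toFun φ x := cliffordSign j x.1 * φ (flipBit j x.1, x.2)
  map_add' φ ψ := by ext x; simp [mul_add]
  map_smul' c φ := by ext x; simp [mul_left_comm]

/-- The automorphism of the Clifford part exchanging `v_i` and `v_{i+1}`. -/
def superSwap (i : Fin (n - 1)) : Module.End ℂ (PBWSpace n) where
  toFun φ x := (if x.1 (loPos i) ∧ x.1 (hiPos i) then -1 else 1) * φ (x.1 ∘ adjSwap i, x.2)
  map_add' φ ψ := by ext x; simp [mul_add]
  map_smul' c φ := by ext x; simp [mul_left_comm]

/-- The projection onto the monomials that contain `v_j`. -/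
def containsProj (j : Fin n) : Module.End ℂ (PBWSpace n) where
  toFun φ x := if x.1 j then φ x else 0
  map_add' φ ψ := by ext x; by_cases h : x.1 j <;> simp [h]
  map_smul' c φ := by ext x; by_cases h : x.1 j <;> simp [h]

/-- The action of the Hecke generator on the permutation part. -/
def heckeOp (z : ℂ) (i : Fin (n - 1)) : Module.End ℂ (PBWSpace n) where
  toFun φ x := φ (x.1, x.2 * adjSwap i) + if x.2 (hiPos i) < x.2 (loPos i) then z * φ x else 0
  map_add' φ ψ := by
    ext x
    by_cases h : x.2 (hiPos i) < x.2 (loPos i) <;> simp [h, mul_add, add_add_add_comm]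
  map_smul' c φ := by
    ext x
    by_cases h : x.2 (hiPos i) < x.2 (loPos i) <;> simp [h, mul_add, mul_left_comm]

/-- The action of `t_i`. -/
def braidOp (z : ℂ) (i : Fin (n - 1)) : Module.End ℂ (PBWSpace n) :=
  superSwap i * heckeOp z i
    + z • ((1 - cliffordOp (loPos i) * cliffordOp (hiPos i)) * containsProj (hiPos i))

theorem cliffordOp_cliffordOp_self (j : Fin n) (φ : PBWSpace n) :
    cliffordOp j (cliffordOp j φ) = φ := by
  ext x
  simp [cliffordOp, cliffordSign_flipBit_of_le le_rfl, flipBit_flipBit, ← mul_assoc,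
    cliffordSign_mul_self]

theorem cliffordOp_anticomm {j k : Fin n} (h : j ≠ k) (φ : PBWSpace n) :
    cliffordOp j (cliffordOp k φ) = -cliffordOp k (cliffordOp j φ) := by
  ext x
  rcases lt_or_gt_of_ne h with h | h <;>
    simp [cliffordOp, cliffordSign_flipBit_of_le h.le, cliffordSign_flipBit_of_lt h,
      flipBit_comm j k, mul_left_comm]

theorem superSwap_cliffordOp_loPos (i : Fin (n - 1)) (φ : PBWSpace n) :
    superSwap i (cliffordOp (loPos i) φ) = cliffordOp (hiPos i) (superSwap i φ) := by
  ext ⟨b, f⟩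
  simp only [superSwap, cliffordOp, LinearMap.coe_mk, AddHom.coe_mk,
    cliffordSign_comp_adjSwap (loPos_ne_hiPos i), flipBit_comp, adjSwap_loPos, cliffordSign_hiPos]
  by_cases h1 : b (loPos i) <;> by_cases h2 : b (hiPos i) <;> simp [flipBit, h1, h2]

theorem superSwap_cliffordOp_of_ne {i : Fin (n - 1)} {l : Fin n} (h : l ≠ loPos i)
    (h' : l ≠ hiPos i) (φ : PBWSpace n) :
    superSwap i (cliffordOp l φ) = cliffordOp l (superSwap i φ) := by
  ext ⟨b, f⟩
  simp only [superSwap, cliffordOp, LinearMap.coe_mk, AddHom.coe_mk,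
    cliffordSign_comp_adjSwap h', flipBit_comp, adjSwap_of_ne h h']
  simp [flipBit, Function.update_of_ne h.symm, Function.update_of_ne h'.symm]

theorem superSwap_superSwap (i : Fin (n - 1)) (φ : PBWSpace n) :
    superSwap i (superSwap i φ) = φ := by
  ext ⟨b, f⟩
  have : (b ∘ adjSwap i) ∘ adjSwap i = b := by ext; simp
  simp only [superSwap, LinearMap.coe_mk, AddHom.coe_mk, this]
  by_cases h1 : b (loPos i) <;> by_cases h2 : b (hiPos i) <;> simp [h1, h2]

theorem superSwap_cliffordOp_hiPos (i : Fin (n - 1)) (φ : PBWSpace n) :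
    superSwap i (cliffordOp (hiPos i) φ) = cliffordOp (loPos i) (superSwap i φ) := by
  conv_lhs => rw [← superSwap_superSwap i φ, ← superSwap_cliffordOp_loPos, superSwap_superSwap]

theorem heckeOp_cliffordOp (z : ℂ) (i : Fin (n - 1)) (l : Fin n) (φ : PBWSpace n) :
    heckeOp z i (cliffordOp l φ) = cliffordOp l (heckeOp z i φ) := by
  ext ⟨b, f⟩
  by_cases h : f (hiPos i) < f (loPos i) <;>
    simp [heckeOp, cliffordOp, h, mul_add, mul_left_comm]

theorem containsProj_cliffordOp_of_ne {j l : Fin n} (h : l ≠ j) (φ : PBWSpace n) :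
    containsProj j (cliffordOp l φ) = cliffordOp l (containsProj j φ) := by
  ext ⟨b, f⟩
  cases hb : b j <;> simp [containsProj, cliffordOp, flipBit, Function.update_of_ne h.symm, hb]

theorem containsProj_cliffordOp_self (j : Fin n) (φ : PBWSpace n) :
    containsProj j (cliffordOp j φ) = cliffordOp j (φ - containsProj j φ) := by
  ext ⟨b, f⟩
  cases hb : b j <;> simp [containsProj, cliffordOp, flipBit, hb]

theorem braidOp_apply (z : ℂ) (i : Fin (n - 1)) (φ : PBWSpace n) :
    braidOp z i φ = superSwap i (heckeOp z i φ) + z • (containsProj (hiPos i) φ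
      - cliffordOp (loPos i) (cliffordOp (hiPos i) (containsProj (hiPos i) φ))) := by
  simp [braidOp]

theorem braidOp_cliffordOp_loPos (z : ℂ) (i : Fin (n - 1)) (φ : PBWSpace n) :
    braidOp z i (cliffordOp (loPos i) φ) = cliffordOp (hiPos i) (braidOp z i φ) := by
  simp only [braidOp_apply, heckeOp_cliffordOp, superSwap_cliffordOp_loPos, map_add, map_smul,
    map_sub, containsProj_cliffordOp_of_ne (loPos_ne_hiPos i),
    cliffordOp_anticomm (loPos_ne_hiPos i).symm, cliffordOp_cliffordOp_self, map_neg]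
  module

theorem braidOp_cliffordOp_hiPos (z : ℂ) (i : Fin (n - 1)) (φ : PBWSpace n) :
    braidOp z i (cliffordOp (hiPos i) φ) = cliffordOp (loPos i) (braidOp z i φ)
      - z • (cliffordOp (loPos i) φ - cliffordOp (hiPos i) φ) := by
  simp only [braidOp_apply, heckeOp_cliffordOp, superSwap_cliffordOp_hiPos, map_add, map_smul,
    map_sub, containsProj_cliffordOp_self, cliffordOp_cliffordOp_self]
  module

theorem braidOp_cliffordOp_of_ne (z : ℂ) {i : Fin (n - 1)} {l : Fin n} (h : l ≠ loPos i)
    (h' : l ≠ hiPos i) (φ : PBWSpace n) :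
    braidOp z i (cliffordOp l φ) = cliffordOp l (braidOp z i φ) := by
  simp only [braidOp_apply, heckeOp_cliffordOp, superSwap_cliffordOp_of_ne h h', map_add,
    map_smul, map_sub, containsProj_cliffordOp_of_ne h', cliffordOp_anticomm h,
    cliffordOp_anticomm h', map_neg, neg_neg]

/-- The basis vector with trivial Clifford part. -/
def permVec (f : Perm (Fin n)) : PBWSpace n := Pi.single (fun _ => false, f) 1

theorem braidOp_permVec (z : ℂ) (i : Fin (n - 1)) (f : Perm (Fin n)) :
    braidOp z i (permVec f) = permVec (f * adjSwap i)
      + (if f (hiPos i) < f (loPos i) then z else 0) • permVec f := by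
  have h0 : containsProj (hiPos i) (permVec f) = 0 := by
    ext ⟨b, g⟩
    by_cases hb : b = fun _ => false <;> simp [containsProj, permVec, hb]
  have hg : ∀ g : Perm (Fin n), g * adjSwap i = f ↔ g = f * adjSwap i := fun g => by
    constructor <;> rintro rfl <;> simp [mul_assoc]
  have hb' : ∀ b : Fin n → Bool, b ∘ adjSwap i = (fun _ => false) ↔ b = fun _ => false :=
    fun b => by
      constructor
      · intro h
        ext l
        simpa using congrFun h (adjSwap i l)
      · rintro rfl
        rfl
  rw [braidOp_apply, h0]
  ext ⟨b, g⟩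
  by_cases hb : b = fun _ => false
  · subst hb
    by_cases hgf : g = f
    · subst hgf
      by_cases h : g (hiPos i) < g (loPos i) <;>
        simp [superSwap, heckeOp, permVec, Pi.single_apply, hg, hb', h]
    · by_cases h : f (hiPos i) < f (loPos i) <;>
        simp [superSwap, heckeOp, permVec, Pi.single_apply, hg, hb', hgf, h]
  · by_cases h : f (hiPos i) < f (loPos i) <;>
      simp [superSwap, heckeOp, permVec, Pi.single_apply, hb', hb, h]

theorem cliffordOp_single (j : Fin n) (b : Fin n → Bool) (f : Perm (Fin n)) :
    cliffordOp j (Pi.single (b, f) 1) =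
      cliffordSign j b • (Pi.single (flipBit j b, f) 1 : PBWSpace n) := by
  have hb : ∀ c, flipBit j c = b ↔ c = flipBit j b := fun c => by
    constructor <;> rintro rfl <;> simp [flipBit_flipBit]
  ext ⟨c, g⟩
  by_cases hc : c = flipBit j b
  · subst hc
    simp [cliffordOp, Pi.single_apply, flipBit_flipBit, cliffordSign_flipBit_of_le le_rfl]
  · simp [cliffordOp, hb, hc]

theorem eq_top_of_cliffordOp_mem {K : Submodule ℂ (PBWSpace n)}
    (hperm : ∀ f, permVec f ∈ K) (hK : ∀ j, ∀ φ ∈ K, cliffordOp j φ ∈ K) : K = ⊤ := by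
  have hflip : ∀ j b f, (Pi.single (b, f) 1 : PBWSpace n) ∈ K →
      (Pi.single (flipBit j b, f) 1 : PBWSpace n) ∈ K := by
    intro j b f h
    have := K.smul_mem (cliffordSign j b) (hK j _ h)
    rwa [cliffordOp_single, smul_smul, cliffordSign_mul_self, one_smul] at this
  have hbits : ∀ (s : Finset (Fin n)) f,
      (Pi.single (fun l => decide (l ∈ s), f) 1 : PBWSpace n) ∈ K := by
    intro s f
    induction s using Finset.induction_on with
    | empty => simpa [permVec] using hperm f
    | insert j s hj ih =>
      convert hflip j _ f ih using 3
      ext l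
      by_cases hl : l = j
      · subst hl
        simp [flipBit, hj]
      · simp [flipBit, hl]
  rw [eq_top_iff, ← (Pi.basisFun ℂ _).span_eq, Submodule.span_le]
  rintro _ ⟨⟨b, f⟩, rfl⟩
  simpa using hbits (Finset.univ.filter fun l => b l) f

theorem eqOn_of_cliffordOp {X Y : Module.End ℂ (PBWSpace n)}
    (hperm : ∀ f, X (permVec f) = Y (permVec f))
    (h : ∀ j φ, X φ = Y φ → X (cliffordOp j φ) = Y (cliffordOp j φ)) : X = Y := by
  have : LinearMap.eqLocus X Y = ⊤ := eq_top_of_cliffordOp_mem hperm h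
  exact LinearMap.eqLocus_eq_top.1 this

theorem braidOp_mul_self (z : ℂ) (i : Fin (n - 1)) :
    braidOp z i * braidOp z i = 1 + z • braidOp z i := by
  refine eqOn_of_cliffordOp (fun f => ?_) fun j φ h => ?_
  · rcases lt_or_gt_of_ne (f.injective.ne (loPos_ne_hiPos i)) with h | h <;>
      simp [braidOp_permVec, h, h.not_gt, mul_assoc]
  · simp only [Module.End.mul_apply, LinearMap.add_apply, Module.End.one_apply,
      LinearMap.smul_apply] at h ⊢
    by_cases h1 : j = loPos i
    · subst h1
      simp only [braidOp_cliffordOp_loPos, braidOp_cliffordOp_hiPos, h, map_add, map_smul]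
      module
    by_cases h2 : j = hiPos i
    · subst h2
      simp only [braidOp_cliffordOp_loPos, braidOp_cliffordOp_hiPos, h, map_add, map_smul, map_sub]
      module
    · simp only [braidOp_cliffordOp_of_ne z h1 h2, h, map_add, map_smul]

theorem braidOp_comm (z : ℂ) {i j : Fin (n - 1)} (hij : (i : ℕ) + 2 ≤ j) :
    braidOp z i * braidOp z j = braidOp z j * braidOp z i := by
  have e1 : loPos i ≠ loPos j := by simp only [loPos, ne_eq, Fin.ext_iff]; omega
  have e2 : loPos i ≠ hiPos j := by simp only [loPos, hiPos, ne_eq, Fin.ext_iff]; omega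
  have e3 : hiPos i ≠ loPos j := by simp only [loPos, hiPos, ne_eq, Fin.ext_iff]; omega
  have e4 : hiPos i ≠ hiPos j := by simp only [hiPos, ne_eq, Fin.ext_iff]; omega
  refine eqOn_of_cliffordOp (fun f => ?_) fun l φ h => ?_
  · have hs : adjSwap i * adjSwap j = adjSwap j * adjSwap i := by
      ext l
      simp only [Perm.mul_apply]
      by_cases l1 : l = loPos i
      · subst l1; simp [adjSwap_of_ne, *]
      by_cases l2 : l = hiPos i
      · subst l2; simp [adjSwap_of_ne, *]
      by_cases l3 : l = loPos j
      · subst l3; simp [adjSwap_of_ne, e1.symm, e2.symm, e3.symm, e4.symm]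
      by_cases l4 : l = hiPos j
      · subst l4; simp [adjSwap_of_ne, e1.symm, e2.symm, e3.symm, e4.symm]
      · simp [adjSwap_of_ne, *]
    simp only [Module.End.mul_apply, braidOp_permVec, map_add, map_smul, Perm.mul_apply, mul_assoc,
      hs, adjSwap_of_ne e1 e2, adjSwap_of_ne e3 e4, adjSwap_of_ne e1.symm e3.symm,
      adjSwap_of_ne e2.symm e4.symm]
    module
  · simp only [Module.End.mul_apply] at h ⊢
    by_cases l1 : l = loPos i
    · subst l1
      simp only [braidOp_cliffordOp_loPos, braidOp_cliffordOp_of_ne z e1 e2,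
        braidOp_cliffordOp_of_ne z e3 e4, h]
    by_cases l2 : l = hiPos i
    · subst l2
      simp only [braidOp_cliffordOp_hiPos, braidOp_cliffordOp_of_ne z e1 e2,
        braidOp_cliffordOp_of_ne z e3 e4, h, map_sub, map_smul]
    by_cases l3 : l = loPos j
    · subst l3
      simp only [braidOp_cliffordOp_loPos, braidOp_cliffordOp_of_ne z l1 l2,
        braidOp_cliffordOp_of_ne z e2.symm e4.symm, h]
    by_cases l4 : l = hiPos j
    · subst l4
      simp only [braidOp_cliffordOp_hiPos, braidOp_cliffordOp_of_ne z e1.symm e3.symm,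
        braidOp_cliffordOp_of_ne z l1 l2, h, map_sub, map_smul]
    · simp only [braidOp_cliffordOp_of_ne z l1 l2, braidOp_cliffordOp_of_ne z l3 l4, h]

theorem braidOp_braid (z : ℂ) {i j : Fin (n - 1)} (hij : (j : ℕ) = i + 1) :
    braidOp z i * braidOp z j * braidOp z i = braidOp z j * braidOp z i * braidOp z j := by
  have e : loPos j = hiPos i := by simp [loPos, hiPos, hij]
  have e1 : loPos i ≠ hiPos i := loPos_ne_hiPos i
  have e2 : loPos i ≠ hiPos j := by simp only [loPos, hiPos, ne_eq, Fin.ext_iff]; omega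
  have e3 : hiPos i ≠ hiPos j := by simp only [hiPos, ne_eq, Fin.ext_iff]; omega
  have j1 : adjSwap j (loPos i) = loPos i := adjSwap_of_ne (e ▸ e1) e2
  have j2 : adjSwap j (hiPos i) = hiPos j := e ▸ adjSwap_loPos j
  have j3 : adjSwap j (hiPos j) = hiPos i := e ▸ adjSwap_hiPos j
  have i3 : adjSwap i (hiPos j) = hiPos j := adjSwap_of_ne e2.symm e3.symm
  refine eqOn_of_cliffordOp (fun f => ?_) fun l φ h => ?_
  · have hs : adjSwap i * (adjSwap j * adjSwap i) = adjSwap j * (adjSwap i * adjSwap j) := by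
      ext l
      simp only [Perm.mul_apply]
      by_cases l1 : l = loPos i
      · subst l1; simp [j1, j2, i3]
      by_cases l2 : l = hiPos i
      · subst l2; simp [j1, j2, j3, i3]
      by_cases l3 : l = hiPos j
      · subst l3; simp [j1, j3, i3]
      · rw [adjSwap_of_ne l1 l2, adjSwap_of_ne (e ▸ l2) l3, adjSwap_of_ne l1 l2,
          adjSwap_of_ne (e ▸ l2) l3]
    simp only [Module.End.mul_apply, braidOp_permVec, map_add, map_smul, Perm.mul_apply, mul_assoc,
      adjSwap_mul_self, mul_one, hs, e, j1, j2, j3, i3, adjSwap_loPos, adjSwap_hiPos]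
    rcases lt_or_gt_of_ne (f.injective.ne e1) with h1 | h1 <;>
    rcases lt_or_gt_of_ne (f.injective.ne e2) with h2 | h2 <;>
    rcases lt_or_gt_of_ne (f.injective.ne e3) with h3 | h3 <;>
    first
    | (exfalso; order)
    | (simp only [h1, h2, h3, h1.not_gt, h2.not_gt, h3.not_gt, if_true, if_false]; module)
  · have qi := fun ψ => LinearMap.congr_fun (braidOp_mul_self z i) ψ
    have qj := fun ψ => LinearMap.congr_fun (braidOp_mul_self z j) ψ
    have jl : ∀ ψ, braidOp z j (cliffordOp (hiPos i) ψ) = cliffordOp (hiPos j) (braidOp z j ψ) :=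
      fun ψ => e ▸ braidOp_cliffordOp_loPos z j ψ
    have jh : ∀ ψ, braidOp z j (cliffordOp (hiPos j) ψ) = cliffordOp (hiPos i) (braidOp z j ψ)
        - z • (cliffordOp (hiPos i) ψ - cliffordOp (hiPos j) ψ) :=
      fun ψ => by simpa only [e] using braidOp_cliffordOp_hiPos z j ψ
    have jn : ∀ ψ, braidOp z j (cliffordOp (loPos i) ψ) = cliffordOp (loPos i) (braidOp z j ψ) :=
      braidOp_cliffordOp_of_ne z (e ▸ e1) e2
    have hin : ∀ ψ, braidOp z i (cliffordOp (hiPos j) ψ) = cliffordOp (hiPos j) (braidOp z i ψ) :=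
      braidOp_cliffordOp_of_ne z e2.symm e3.symm
    simp only [Module.End.mul_apply, LinearMap.add_apply, Module.End.one_apply,
      LinearMap.smul_apply] at h qi qj ⊢
    by_cases l1 : l = loPos i
    · subst l1
      simp only [braidOp_cliffordOp_loPos, jl, jn, hin, h]
    by_cases l2 : l = hiPos i
    · subst l2
      simp only [braidOp_cliffordOp_loPos, braidOp_cliffordOp_hiPos, jl, jh, jn, hin, h,
        map_sub, map_smul]
    by_cases l3 : l = hiPos j
    · subst l3
      simp only [braidOp_cliffordOp_hiPos, jl, jh, jn, hin, h, qi, qj,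
        map_add, map_sub, map_smul]
      module
    · simp only [braidOp_cliffordOp_of_ne z l1 l2,
        braidOp_cliffordOp_of_ne z (e ▸ l2 : l ≠ loPos j) l3, h]

/-- The left regular representation of `G_n(q)` in PBW coordinates. -/
def pbwRep (q : ℂ) (n : ℕ) : HeckeClifford q n →ₐ[ℂ] Module.End ℂ (PBWSpace n) :=
  RingQuot.liftAlgHom ℂ ⟨FreeAlgebra.lift ℂ (Sum.elim (braidOp (q - q⁻¹)) cliffordOp), by
    intro x y h
    have hlo : ∀ (i : Fin (n - 1)) (j : Fin n), (j : ℕ) = i → j = loPos i :=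
      fun i j h => Fin.ext h
    have hhi : ∀ (i : Fin (n - 1)) (j : Fin n), (j : ℕ) = i + 1 → j = hiPos i :=
      fun i j h => Fin.ext h
    cases h with
    | braid i j h => simpa [tF] using braidOp_braid _ h
    | tcomm i j h =>
      rcases h with h | h
      · simpa [tF] using braidOp_comm _ h
      · simpa [tF] using (braidOp_comm _ h).symm
    | quad i => simpa [tF] using braidOp_mul_self _ i
    | vsq j => simpa [vF] using LinearMap.ext (cliffordOp_cliffordOp_self j)
    | vanti j k h => simpa [vF] using LinearMap.ext (cliffordOp_anticomm h)
    | tv₁ i j j' hj hj' =>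
      obtain rfl := hlo i j hj
      obtain rfl := hhi i j' hj'
      simpa [tF, vF] using LinearMap.ext (braidOp_cliffordOp_loPos _ i)
    | tv₂ i j j' hj hj' =>
      obtain rfl := hlo i j hj
      obtain rfl := hhi i j' hj'
      simpa [tF, vF] using LinearMap.ext (braidOp_cliffordOp_hiPos (q - q⁻¹) i)
    | tvcomm i l h =>
      have h1 : l ≠ loPos i := fun e => h.1 (by simp [e, loPos])
      have h2 : l ≠ hiPos i := fun e => h.2 (by simp [e, hiPos])
      simpa [tF, vF] using LinearMap.ext (braidOp_cliffordOp_of_ne _ h1 h2)⟩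

theorem pbwRep_HCt (q : ℂ) (n : ℕ) (i : Fin (n - 1)) :
    pbwRep q n (HCt q n i) = braidOp (q - q⁻¹) i := by
  simp [pbwRep, HCt, tF]

theorem pbwRep_HCv (q : ℂ) (n : ℕ) (j : Fin n) : pbwRep q n (HCv q n j) = cliffordOp j := by
  simp [pbwRep, HCv, vF]

theorem closure_range_adjSwap (n : ℕ) :
    Submonoid.closure (Set.range (adjSwap : Fin (n - 1) → Perm (Fin n))) = ⊤ := by
  cases n with
  | zero => exact Subsingleton.elim _ _
  | succ n => exact Perm.mclosure_swap_castSucc_succ n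

/-- The regular representation is cyclic, generated by the vector of the unit. -/
theorem pbwRep_surjective (q : ℂ) (n : ℕ) :
    Function.Surjective ((pbwRep q n).toLinearMap.flip (permVec 1)) := by
  set K := LinearMap.range ((pbwRep q n).toLinearMap.flip (permVec 1))
  have hact : ∀ g, ∀ φ ∈ K, pbwRep q n g φ ∈ K := by
    rintro g _ ⟨x, rfl⟩
    exact ⟨g * x, by simp⟩
  refine LinearMap.range_eq_top.1 (eq_top_of_cliffordOp_mem (fun f => ?_) fun j φ hφ => ?_)
  · have hf : f ∈ Submonoid.closure (Set.range (adjSwap : Fin (n - 1) → Perm (Fin n))) := by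
      simp [closure_range_adjSwap]
    induction hf using Submonoid.closure_induction_right with
    | one => exact ⟨1, by simp⟩
    | mul_right f _ s hs ih =>
      obtain ⟨i, rfl⟩ := hs
      have := hact (HCt q n i) _ ih
      rw [pbwRep_HCt, braidOp_permVec] at this
      exact (K.add_mem_iff_left (K.smul_mem _ ih)).1 this
  · rw [← pbwRep_HCv q n j]
    exact hact _ φ hφ

end Representation

section PBW

open Pointwise Submodule

theorem HCt_mul_self (q : ℂ) (n : ℕ) (i : Fin (n - 1)) :
    HCt q n i * HCt q n i = 1 + (q - q⁻¹) • HCt q n i := by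
  simpa [HCt] using RingQuot.mkAlgHom_rel ℂ (HCrel.quad (q := q) i)

theorem HCt_braid (q : ℂ) (n : ℕ) {i j : Fin (n - 1)} (h : (j : ℕ) = i + 1) :
    HCt q n i * HCt q n j * HCt q n i = HCt q n j * HCt q n i * HCt q n j := by
  simpa [HCt] using RingQuot.mkAlgHom_rel ℂ (HCrel.braid (q := q) i j h)

theorem HCt_comm (q : ℂ) (n : ℕ) {i j : Fin (n - 1)} (h : (i : ℕ) + 2 ≤ j) :
    HCt q n i * HCt q n j = HCt q n j * HCt q n i := by
  simpa [HCt] using RingQuot.mkAlgHom_rel ℂ (HCrel.tcomm (q := q) i j (Or.inl h))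

theorem HCv_mul_self (q : ℂ) (n : ℕ) (j : Fin n) : HCv q n j * HCv q n j = 1 := by
  simpa [HCv] using RingQuot.mkAlgHom_rel ℂ (HCrel.vsq (q := q) j)

theorem HCv_anticomm (q : ℂ) (n : ℕ) {j k : Fin n} (h : j ≠ k) :
    HCv q n j * HCv q n k = -(HCv q n k * HCv q n j) := by
  simpa [HCv] using RingQuot.mkAlgHom_rel ℂ (HCrel.vanti (q := q) j k h)

theorem HCt_mul_HCv_loPos (q : ℂ) (n : ℕ) (i : Fin (n - 1)) :
    HCt q n i * HCv q n (loPos i) = HCv q n (hiPos i) * HCt q n i := by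
  simpa [HCt, HCv] using
    RingQuot.mkAlgHom_rel ℂ (HCrel.tv₁ (q := q) i (loPos i) (hiPos i) rfl rfl)

theorem HCt_mul_HCv_hiPos (q : ℂ) (n : ℕ) (i : Fin (n - 1)) :
    HCt q n i * HCv q n (hiPos i) = HCv q n (loPos i) * HCt q n i
      - (q - q⁻¹) • (HCv q n (loPos i) - HCv q n (hiPos i)) := by
  simpa [HCt, HCv] using
    RingQuot.mkAlgHom_rel ℂ (HCrel.tv₂ (q := q) i (loPos i) (hiPos i) rfl rfl)

theorem HCt_mul_HCv_of_ne (q : ℂ) (n : ℕ) {i : Fin (n - 1)} {l : Fin n} (h : l ≠ loPos i)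
    (h' : l ≠ hiPos i) : HCt q n i * HCv q n l = HCv q n l * HCt q n i := by
  simpa [HCt, HCv] using RingQuot.mkAlgHom_rel ℂ
    (HCrel.tvcomm (q := q) i l ⟨fun e => h (Fin.ext e), fun e => h' (Fin.ext e)⟩)

theorem adjoin_generators_eq_top (q : ℂ) (n : ℕ) :
    Algebra.adjoin ℂ (Set.range (HCt q n) ∪ Set.range (HCv q n)) = ⊤ := by
  have h : Set.range (HCt q n) ∪ Set.range (HCv q n) =
      RingQuot.mkAlgHom ℂ (HCrel q n) '' Set.range (FreeAlgebra.ι ℂ) := by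
    rw [← Set.range_comp, Sum.range_eq]
    rfl
  rw [h, ← AlgHom.map_adjoin, FreeAlgebra.adjoin_range_ι, Algebra.map_top,
    AlgHom.range_eq_top]
  exact RingQuot.mkAlgHom_surjective ℂ _

/-- Elements of the Clifford subalgebra move past `t_i`, up to an error in the subalgebra. -/
theorem exists_mul_HCt_eq (q : ℂ) (n : ℕ) (i : Fin (n - 1)) {c : HeckeClifford q n}
    (hc : c ∈ Algebra.adjoin ℂ (Set.range (HCv q n))) :
    ∃ a ∈ Algebra.adjoin ℂ (Set.range (HCv q n)), ∃ b ∈ Algebra.adjoin ℂ (Set.range (HCv q n)),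
      c * HCt q n i = HCt q n i * a + b := by
  have hv : ∀ j, HCv q n j ∈ Algebra.adjoin ℂ (Set.range (HCv q n)) :=
    fun j => Algebra.subset_adjoin ⟨j, rfl⟩
  induction hc using Algebra.adjoin_induction with
  | mem c hc =>
    obtain ⟨l, rfl⟩ := hc
    by_cases h1 : l = loPos i
    · subst h1
      refine ⟨_, hv (hiPos i), _, Subalgebra.smul_mem _ (sub_mem (hv (loPos i)) (hv (hiPos i)))
        (q - q⁻¹), ?_⟩
      rw [HCt_mul_HCv_hiPos, sub_add_cancel]
    by_cases h2 : l = hiPos i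
    · subst h2
      exact ⟨_, hv (loPos i), 0, zero_mem _, by rw [HCt_mul_HCv_loPos, add_zero]⟩
    · exact ⟨_, hv l, 0, zero_mem _, by rw [HCt_mul_HCv_of_ne q n h1 h2, add_zero]⟩
  | algebraMap r =>
    exact ⟨_, Subalgebra.algebraMap_mem _ r, 0, zero_mem _, by rw [Algebra.commutes, add_zero]⟩
  | add c d _ _ hc hd =>
    obtain ⟨a, ha, b, hb, e⟩ := hc
    obtain ⟨a', ha', b', hb', e'⟩ := hd
    exact ⟨_, add_mem ha ha', _, add_mem hb hb', by rw [add_mul, e, e']; noncomm_ring⟩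
  | mul c d hcmem _ hc hd =>
    obtain ⟨a, ha, b, hb, e⟩ := hc
    obtain ⟨a', ha', b', hb', e'⟩ := hd
    refine ⟨_, mul_mem ha ha', _, add_mem (mul_mem hb ha') (mul_mem hcmem hb'), ?_⟩
    rw [mul_assoc, e', mul_add, ← mul_assoc, e]
    noncomm_ring

theorem exists_spanning_clifford (q : ℂ) (n : ℕ) :
    ∃ s : Finset (HeckeClifford q n), s.card ≤ 2 ^ n ∧
      ∀ c ∈ Algebra.adjoin ℂ (Set.range (HCv q n)), c ∈ span ℂ (s : Set (HeckeClifford q n)) := by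
  obtain ⟨s, hs, h1, hc⟩ := exists_spanning_of_anticommuting
    (fun j => if h : j < n then HCv q n ⟨j, h⟩ else 0) n
    (fun j hj => by simp [hj, HCv_mul_self])
    (fun j k hjk => by
      by_cases hj : j < n <;> by_cases hk : k < n <;> simp [hj, hk]
      exact HCv_anticomm q n (by simpa using hjk)) n le_rfl
  refine ⟨s, hs, fun c hcm => adjoin_subset_of_mul_right_mem h1 ?_ hcm⟩
  rintro x hx _ ⟨j, rfl⟩
  simpa using hc j j.2 x hx

theorem exists_spanning_hecke (q : ℂ) {n : ℕ} (hn : 1 ≤ n) :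
    ∃ s : Finset (HeckeClifford q n), s.card ≤ n.factorial ∧
      ∀ c ∈ Algebra.adjoin ℂ (Set.range (HCt q n)), c ∈ span ℂ (s : Set (HeckeClifford q n)) := by
  obtain ⟨s, hs, h1, hc⟩ := exists_spanning_of_hecke
    (fun i => if h : i < n - 1 then HCt q n ⟨i, h⟩ else 0) (n - 1) (q - q⁻¹)
    (fun i j hij => by
      by_cases hi : i < n - 1 <;> by_cases hj : j < n - 1 <;> simp [hi, hj]
      exact HCt_comm q n (by simpa using hij))
    (fun i => by
      by_cases hi : i < n - 1 <;> by_cases hj : i + 1 < n - 1 <;> simp [hi, hj]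
      exact HCt_braid q n (by simp))
    (fun i hi => by simp [hi, HCt_mul_self]) (n - 1) le_rfl
  refine ⟨s, by rwa [Nat.sub_add_cancel hn] at hs,
    fun c hcm => adjoin_subset_of_mul_right_mem h1 ?_ hcm⟩
  rintro x hx _ ⟨j, rfl⟩
  simpa using hc j j.2 x hx

theorem adjoin_HCt_mul_adjoin_HCv (q : ℂ) (n : ℕ) :
    Subalgebra.toSubmodule (Algebra.adjoin ℂ (Set.range (HCt q n))) *
      Subalgebra.toSubmodule (Algebra.adjoin ℂ (Set.range (HCv q n))) = ⊤ := by
  set H := Algebra.adjoin ℂ (Set.range (HCt q n))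
  set C := Algebra.adjoin ℂ (Set.range (HCv q n))
  have hmem : ∀ a ∈ H, ∀ c ∈ C, a * c ∈ Subalgebra.toSubmodule H * Subalgebra.toSubmodule C :=
    fun a ha c hc => mul_mem_mul ha hc
  refine eq_top_iff'.2 fun y => adjoin_subset_of_mul_right_mem
    (S := Set.range (HCt q n) ∪ Set.range (HCv q n)) ?_ ?_
    (by rw [adjoin_generators_eq_top]; trivial)
  · simpa using hmem 1 (one_mem _) 1 (one_mem _)
  · intro x hx g hg
    induction hx using Submodule.mul_induction_on' with
    | mem_mul_mem a ha c hc =>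
      rw [mul_assoc]
      rcases hg with ⟨i, rfl⟩ | ⟨j, rfl⟩
      · obtain ⟨c', hc', c'', hc'', e⟩ := exists_mul_HCt_eq q n i hc
        rw [e, mul_add, ← mul_assoc]
        exact add_mem (hmem _ (mul_mem ha (Algebra.subset_adjoin ⟨i, rfl⟩)) _ hc')
          (hmem _ ha _ hc'')
      · exact hmem _ ha _ (mul_mem hc (Algebra.subset_adjoin ⟨j, rfl⟩))
    | add x _ y _ hx hy =>
      rw [add_mul]
      exact add_mem hx hy

theorem exists_spanning_heckeClifford (q : ℂ) {n : ℕ} (hn : 1 ≤ n) :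
    ∃ s : Finset (HeckeClifford q n), s.card ≤ 2 ^ n * n.factorial ∧
      span ℂ (s : Set (HeckeClifford q n)) = ⊤ := by
  classical
  obtain ⟨s, hs, hsC⟩ := exists_spanning_clifford q n
  obtain ⟨u, hu, huH⟩ := exists_spanning_hecke q hn
  refine ⟨u * s, ?_, ?_⟩
  · rw [mul_comm (2 ^ n)]
    exact Finset.card_mul_le.trans (Nat.mul_le_mul hu hs)
  · rw [Finset.coe_mul, ← span_mul_span, eq_top_iff, ← adjoin_HCt_mul_adjoin_HCv]
    exact mul_le_mul' huH hsC

theorem finrank_PBWSpace (n : ℕ) : Module.finrank ℂ (PBWSpace n) = 2 ^ n * n.factorial := by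
  simp [Fintype.card_perm]

end PBW

/-- for every nonzero `q : ℂ` and every `n ≥ 2`, the Hecke–Clifford algebra
`G_n(q)` is a finite-dimensional `ℂ`-algebra of dimension `2^n * n!`. -/
theorem heckeClifford_finiteDimensional_and_finrank
    (q : ℂ) (hq : q ≠ 0) (n : ℕ) (hn : 2 ≤ n) :
    FiniteDimensional ℂ (HeckeClifford q n) ∧
      Module.finrank ℂ (HeckeClifford q n) = 2 ^ n * n.factorial := by
  obtain ⟨s, hs, htop⟩ := exists_spanning_heckeClifford q (by omega : 1 ≤ n)
  have hfin : FiniteDimensional ℂ (HeckeClifford q n) := ⟨⟨s, htop⟩⟩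
  refine ⟨hfin, le_antisymm ?_ ?_⟩
  · rw [← finrank_top ℂ (HeckeClifford q n), ← htop]
    exact (finrank_span_finset_le_card s).trans hs
  · rw [← finrank_PBWSpace n]
    exact LinearMap.finrank_le_finrank_of_surjective (pbwRep_surjective q n)
end

section
/- There is a ℂ-algebra automorphism α of the Hecke–Clifford algebra G_n(q) determined by α(t_i) = t_i for all i and α(v_j) = −v_j for all j; it satisfies α ∘ α = id, its fixed-point subalgebra equals the subalgebra G_n[0] generated by t_1,…,t_{n−1} and e_1 = v_1v_2,…,e_{n−1} = v_{n−1}v_n, and this subalgebra has ℂ-dimension 2^{n−1} · n!. -/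
noncomputable section

namespace HeckeCliffordPBW

open Equiv
open scoped Pointwise

/-! ### The Clifford algebra of the standard quadratic form -/

/-- The standard quadratic form `∑ xᵢ²` on `ℂⁿ`. -/
abbrev sumSq (n : ℕ) : QuadraticForm ℂ (Fin n → ℂ) :=
  QuadraticMap.weightedSumSquares ℂ (fun _ : Fin n => (1 : ℂ))

/-- The complex Clifford algebra on `n` anticommuting generators of square one. -/
abbrev Cl (n : ℕ) : Type := CliffordAlgebra (sumSq n)

/-- The standard generators of `Cl n`. -/
def gen {n : ℕ} (j : Fin n) : Cl n := CliffordAlgebra.ι (sumSq n) (Pi.single j 1)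

lemma sumSq_polar_single {n : ℕ} (j k : Fin n) :
    QuadraticMap.polar (sumSq n) (Pi.single j 1) (Pi.single k 1) = if j = k then 2 else 0 := by
  have h : ∀ l : Fin n, (sumSq n) (Pi.single l 1) = 1 := fun l => by
    simp [sumSq, Pi.single_apply]
  rw [QuadraticMap.polar, h, h]
  split_ifs with hjk
  · subst hjk
    rw [← two_smul ℂ (Pi.single j (1 : ℂ) : Fin n → ℂ), QuadraticMap.map_smul, h]
    norm_num
  · have : ∀ i : Fin n, ((Pi.single j 1 + Pi.single k 1 : Fin n → ℂ) i) *
        ((Pi.single j 1 + Pi.single k 1 : Fin n → ℂ) i) =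
        (if i = j then 1 else 0) + (if i = k then 1 else 0) := fun i => by
      by_cases h1 : i = j <;> by_cases h2 : i = k <;> simp_all [Pi.single_apply]
    rw [QuadraticMap.weightedSumSquares_apply]
    simp only [this, one_smul, Finset.sum_add_distrib]
    simp

lemma gen_mul_self {n : ℕ} (j : Fin n) : (gen j : Cl n) * gen j = 1 := by
  simp [gen, CliffordAlgebra.ι_sq_scalar, sumSq, Pi.single_apply]

lemma gen_anticomm {n : ℕ} {j k : Fin n} (h : j ≠ k) :
    (gen j : Cl n) * gen k = -(gen k * gen j) := by
  rw [eq_neg_iff_add_eq_zero, gen, gen, CliffordAlgebra.ι_mul_ι_add_swap, sumSq_polar_single,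
    if_neg h, map_zero]

lemma ι_eq_sum_gen {n : ℕ} (m : Fin n → ℂ) :
    CliffordAlgebra.ι (sumSq n) m = ∑ j, m j • gen j := by
  conv_lhs => rw [pi_eq_sum_univ' m]
  simp only [map_sum, map_smul, gen]

/-- The universal property of `Cl n` in terms of generators. -/
def cliffordLift {n : ℕ} {A : Type*} [Ring A] [Algebra ℂ A] (v : Fin n → A)
    (hsq : ∀ j, v j * v j = 1) (hanti : ∀ j k, j ≠ k → v j * v k = -(v k * v j)) :
    Cl n →ₐ[ℂ] A :=
  CliffordAlgebra.lift (sumSq n) ⟨Fintype.linearCombination ℂ v, by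
    have h2 : IsUnit (2 : A) := by
      have : IsUnit (algebraMap ℂ A 2) := (IsUnit.mk0 (2 : ℂ) two_ne_zero).map _
      rwa [map_ofNat] at this
    rw [CliffordAlgebra.forall_mul_self_eq_iff h2]
    ext j k
    suffices v j * v k + v k * v j = algebraMap ℂ A (if j = k then 2 else 0) by
      rw [← sumSq_polar_single] at this
      simpa [Fintype.linearCombination_apply_single] using this
    split_ifs with h
    · subst h; rw [hsq, map_ofNat, one_add_one_eq_two]
    · rw [hanti j k h]; simp⟩

@[simp] lemma cliffordLift_gen {n : ℕ} {A : Type*} [Ring A] [Algebra ℂ A] (v : Fin n → A)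
    (hsq : ∀ j, v j * v j = 1) (hanti : ∀ j k, j ≠ k → v j * v k = -(v k * v j)) (j : Fin n) :
    cliffordLift v hsq hanti (gen j) = v j := by
  simp [cliffordLift, gen, Fintype.linearCombination_apply_single]

lemma clifford_induction {n : ℕ} {P : Cl n → Prop} (one : P 1)
    (add : ∀ x y, P x → P y → P (x + y)) (smul : ∀ (r : ℂ) x, P x → P (r • x))
    (gen_mul : ∀ j x, P x → P (gen j * x)) (x : Cl n) : P x := by
  have zero : P 0 := by simpa using smul 0 1 one
  induction x using CliffordAlgebra.left_induction with
  | algebraMap r => rw [Algebra.algebraMap_eq_smul_one]; exact smul _ _ one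
  | add x y hx hy => exact add _ _ hx hy
  | ι_mul x m hx =>
    rw [ι_eq_sum_gen, Finset.sum_mul]
    refine Finset.sum_induction _ P add zero fun j _ => ?_
    rw [smul_mul_assoc]
    exact smul _ _ (gen_mul _ _ hx)

/-- A basis of `Cl n` indexed by subsets of the generators. -/
def cliffordBasis (n : ℕ) : Module.Basis (Finset (Fin n)) ℂ (Cl n) :=
  letI : Invertible (2 : ℂ) := invertibleOfNonzero two_ne_zero
  ((Pi.basisFun ℂ (Fin n)).ExteriorAlgebra).map (CliffordAlgebra.equivExterior (sumSq n)).symm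

instance (n : ℕ) : Module.Finite ℂ (Cl n) := .of_basis (cliffordBasis n)

lemma finrank_clifford (n : ℕ) : Module.finrank ℂ (Cl n) = 2 ^ n := by
  rw [Module.finrank_eq_card_basis (cliffordBasis n)]
  simp

/-- The automorphism of `Cl n` exchanging two generators. -/
def swapHom {n : ℕ} (a b : Fin n) : Cl n →ₐ[ℂ] Cl n :=
  cliffordLift (fun j => gen (swap a b j)) (fun _ => gen_mul_self _)
    (fun _ _ h => gen_anticomm ((swap a b).injective.ne h))

@[simp] lemma swapHom_gen {n : ℕ} (a b j : Fin n) :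
    swapHom a b (gen j) = gen (swap a b j) := by
  simp [swapHom]

/-- The Demazure-type twisted derivation of `Cl n` attached to a pair of generators. -/
def demazure {n : ℕ} (a b : Fin n) : Cl n →ₗ[ℂ] Cl n :=
  (1 / 2 : ℂ) • (LinearMap.mulLeft ℂ (1 - gen a * gen b) -
    LinearMap.mulRight ℂ (1 - gen a * gen b) ∘ₗ (swapHom a b).toLinearMap)

lemma demazure_apply {n : ℕ} (a b : Fin n) (x : Cl n) :
    demazure a b x =
      (1 / 2 : ℂ) • ((1 - gen a * gen b) * x - swapHom a b x * (1 - gen a * gen b)) := rfl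

@[simp] lemma demazure_algebraMap {n : ℕ} (a b : Fin n) (r : ℂ) :
    demazure a b (algebraMap ℂ (Cl n) r) = 0 := by
  rw [demazure_apply, AlgHom.commutes, ← Algebra.commutes, sub_self, smul_zero]

lemma demazure_gen_left {n : ℕ} {a b : Fin n} (h : a ≠ b) (x : Cl n) :
    demazure a b (gen a * x) = gen b * demazure a b x := by
  have e : (1 - gen a * gen b) * gen a = (gen b * (1 - gen a * gen b) : Cl n) := by
    have e' : (gen b * (gen a * gen b) : Cl n) = -gen a := by
      rw [← mul_assoc, gen_anticomm h.symm, neg_mul, mul_assoc, gen_mul_self, mul_one]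
    rw [mul_sub, e', sub_mul, mul_assoc, gen_anticomm h.symm, mul_neg, ← mul_assoc, gen_mul_self]
    simp [add_comm]
  simp only [demazure_apply, map_mul, swapHom_gen, swap_apply_left, mul_smul_comm]
  rw [← mul_assoc, e, mul_sub (gen _) (_ * x)]
  simp only [mul_assoc]

lemma demazure_gen_right {n : ℕ} (a b : Fin n) (x : Cl n) :
    demazure a b (gen b * x) = gen a * demazure a b x + (gen b - gen a) * x := by
  have e1 : (1 - gen a * gen b) * gen b = (gen b - gen a : Cl n) := by
    rw [sub_mul, mul_assoc, gen_mul_self]; simp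
  have e2 : gen a * (1 - gen a * gen b) = (gen a - gen b : Cl n) := by
    rw [mul_sub, ← mul_assoc, gen_mul_self]; simp
  simp only [demazure_apply, map_mul, swapHom_gen, swap_apply_right, mul_smul_comm]
  rw [← mul_assoc, e1, mul_sub (gen a) (_ * x), ← mul_assoc (gen a), e2]
  simp only [mul_assoc, sub_mul]
  module

lemma demazure_gen_of_ne {n : ℕ} {a b l : Fin n} (ha : l ≠ a) (hb : l ≠ b) (x : Cl n) :
    demazure a b (gen l * x) = gen l * demazure a b x := by
  have e : (1 - gen a * gen b) * gen l = (gen l * (1 - gen a * gen b) : Cl n) := by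
    rw [sub_mul, mul_sub, mul_assoc, gen_anticomm hb.symm, mul_neg, ← mul_assoc,
      gen_anticomm ha.symm]
    simp [mul_assoc]
  simp only [demazure_apply, map_mul, swapHom_gen, swap_apply_of_ne_of_ne ha hb, mul_smul_comm]
  rw [← mul_assoc, e, mul_sub (gen _) (_ * x)]
  simp only [mul_assoc]

/-! ### Twisted commutation of the Hecke relations with the Clifford generators -/

/-- The cross relations between a Hecke generator `T` and the two Clifford generators it
exchanges. -/
structure Crosses {A : Type*} [Ring A] [Algebra ℂ A] (c : ℂ) (T va vb : A) : Prop where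
  left : T * va = vb * T
  right : T * vb = va * T - c • (va - vb)

namespace Crosses

variable {A : Type*} [Ring A] [Algebra ℂ A] {c : ℂ} {T U va vb vd : A}

lemma left_assoc (h : Crosses c T va vb) (x : A) : T * (va * x) = vb * (T * x) := by
  rw [← mul_assoc, h.left, mul_assoc]

lemma right_assoc (h : Crosses c T va vb) (x : A) :
    T * (vb * x) = va * (T * x) - c • (va * x - vb * x) := by
  rw [← mul_assoc, h.right]
  simp only [sub_mul, smul_mul_assoc, mul_assoc]

lemma quadratic_left (h : Crosses c T va vb) :
    (T * T - (1 + c • T)) * va = va * (T * T - (1 + c • T)) := by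
  simp only [mul_sub, sub_mul, add_mul, mul_add, mul_assoc, smul_mul_assoc, mul_smul_comm,
    h.left, h.right_assoc, one_mul, mul_one]
  module

lemma quadratic_right (h : Crosses c T va vb) :
    (T * T - (1 + c • T)) * vb = vb * (T * T - (1 + c • T)) := by
  simp only [mul_sub, sub_mul, add_mul, mul_add, mul_assoc, smul_mul_assoc, mul_smul_comm,
    h.left, h.right, h.left_assoc, one_mul, mul_one]
  module

lemma commutator_left (h : Crosses c T va vb) (ha : U * va = va * U) (hb : U * vb = vb * U) :
    (T * U - U * T) * va = vb * (T * U - U * T) := by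
  have hb' : ∀ x, U * (vb * x) = vb * (U * x) := fun x => by rw [← mul_assoc, hb, mul_assoc]
  simp only [mul_sub, sub_mul, mul_assoc, h.left, h.left_assoc, ha, hb']

lemma commutator_right (h : Crosses c T va vb) (ha : U * va = va * U) (hb : U * vb = vb * U) :
    (T * U - U * T) * vb = va * (T * U - U * T) := by
  have ha' : ∀ x, U * (va * x) = va * (U * x) := fun x => by rw [← mul_assoc, ha, mul_assoc]
  simp only [mul_sub, sub_mul, mul_assoc, h.right, h.right_assoc, ha, hb, ha', mul_smul_comm]
  module

lemma braid_left (hT : Crosses c T va vb) (hU : Crosses c U vb vd)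
    (hTd : T * vd = vd * T) (hUa : U * va = va * U) :
    (T * U * T - U * T * U) * va = vd * (T * U * T - U * T * U) := by
  have hTd' : ∀ x, T * (vd * x) = vd * (T * x) := fun x => by rw [← mul_assoc, hTd, mul_assoc]
  simp only [mul_sub, sub_mul, mul_assoc, hT.left, hT.left_assoc, hU.left_assoc, hUa, hTd']

lemma braid_mid (hT : Crosses c T va vb) (hU : Crosses c U vb vd)
    (hTd : T * vd = vd * T) (hUa : U * va = va * U) :
    (T * U * T - U * T * U) * vb = vb * (T * U * T - U * T * U) := by
  have hTd' : ∀ x, T * (vd * x) = vd * (T * x) := fun x => by rw [← mul_assoc, hTd, mul_assoc]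
  have hUa' : ∀ x, U * (va * x) = va * (U * x) := fun x => by rw [← mul_assoc, hUa, mul_assoc]
  simp only [mul_sub, sub_mul, mul_assoc, hT.right, hT.left_assoc, hU.left,
    hU.right_assoc, hUa, hTd', hUa', mul_smul_comm]
  module

lemma braid_right (hT : Crosses c T va vb) (hU : Crosses c U vb vd)
    (hTd : T * vd = vd * T) (hUa : U * va = va * U)
    (hTT : T * T = 1 + c • T) (hUU : U * U = 1 + c • U) :
    (T * U * T - U * T * U) * vd = va * (T * U * T - U * T * U) := by
  have hTd' : ∀ x, T * (vd * x) = vd * (T * x) := fun x => by rw [← mul_assoc, hTd, mul_assoc]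
  have hUa' : ∀ x, U * (va * x) = va * (U * x) := fun x => by rw [← mul_assoc, hUa, mul_assoc]
  simp only [mul_sub, sub_mul, mul_assoc, hT.right, hT.right_assoc,
    hU.right, hU.left, hU.left_assoc, hU.right_assoc, hUa, hTd, hTd', hUa', mul_smul_comm,
    hTT, hUU, mul_add, mul_one]
  module

end Crosses

/-! ### The action of Hecke generators on functions on the symmetric group -/

/-- The action of the Hecke generator attached to the positions `a`, `b`. -/
def heckeAct {n : ℕ} (c : ℂ) (a b : Fin n) (f : Perm (Fin n) → ℂ) : Perm (Fin n) → ℂ :=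
  fun σ => f (σ * swap a b) + (if σ b < σ a then c else 0) * f σ

lemma heckeAct_quadratic {n : ℕ} (c : ℂ) {a b : Fin n} (h : a ≠ b) (f : Perm (Fin n) → ℂ) :
    heckeAct c a b (heckeAct c a b f) = f + c • heckeAct c a b f := by
  ext σ
  have hne : σ a ≠ σ b := σ.injective.ne h
  simp only [heckeAct, Pi.add_apply, Pi.smul_apply, smul_eq_mul, mul_assoc, swap_mul_self,
    Perm.mul_apply, swap_apply_left, swap_apply_right, mul_one]
  rcases hne.lt_or_gt with h1 | h1 <;> simp [h1, h1.not_gt]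

lemma heckeAct_comm {n : ℕ} (c : ℂ) {a b d e : Fin n} (had : a ≠ d) (hae : a ≠ e) (hbd : b ≠ d)
    (hbe : b ≠ e) (f : Perm (Fin n) → ℂ) :
    heckeAct c a b (heckeAct c d e f) = heckeAct c d e (heckeAct c a b f) := by
  ext σ
  have hs : swap a b * swap d e = swap d e * swap a b := by
    ext x : 1
    simp only [Perm.mul_apply, swap_apply_def]
    grind
  simp only [heckeAct, Perm.mul_apply, swap_apply_of_ne_of_ne had.symm hbd.symm,
    swap_apply_of_ne_of_ne hae.symm hbe.symm, swap_apply_of_ne_of_ne had hae,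
    swap_apply_of_ne_of_ne hbd hbe, mul_assoc, hs]
  ring

lemma heckeAct_braid {n : ℕ} (c : ℂ) {a b d : Fin n} (hab : a ≠ b) (had : a ≠ d) (hbd : b ≠ d)
    (f : Perm (Fin n) → ℂ) :
    heckeAct c a b (heckeAct c b d (heckeAct c a b f)) =
      heckeAct c b d (heckeAct c a b (heckeAct c b d f)) := by
  ext σ
  have hs : swap a b * (swap b d * swap a b) = swap b d * (swap a b * swap b d) := by
    ext x : 1
    simp only [Perm.mul_apply, swap_apply_def]
    grind
  have h1 : σ a ≠ σ b := σ.injective.ne hab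
  have h2 : σ a ≠ σ d := σ.injective.ne had
  have h3 : σ b ≠ σ d := σ.injective.ne hbd
  simp only [heckeAct, Perm.mul_apply, mul_assoc, hs, swap_apply_left, swap_apply_right,
    swap_mul_self, mul_one, swap_apply_of_ne_of_ne hab had,
    swap_apply_of_ne_of_ne had.symm hbd.symm]
  rcases h1.lt_or_gt with h1 | h1 <;> rcases h2.lt_or_gt with h2 | h2 <;>
    rcases h3.lt_or_gt with h3 | h3 <;>
    first
    | exact absurd (h1.trans h3) h2.not_gt
    | exact absurd (h3.trans h1) h2.not_gt
    | (simp only [h1, h2, h3, h1.not_gt, h2.not_gt, h3.not_gt, if_true, if_false]; ring)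

/-! ### The induced module -/

/-- The module induced from the regular-type representation on functions on the symmetric group. -/
abbrev Induced (n : ℕ) : Type := Perm (Fin n) → Cl n

/-- Left multiplication by a Clifford generator on the induced module. -/
def opV {n : ℕ} (j : Fin n) : Module.End ℂ (Induced n) :=
  LinearMap.pi fun σ => LinearMap.mulLeft ℂ (gen j) ∘ₗ LinearMap.proj σ

/-- The Hecke generator attached to the positions `a`, `b` acting on the induced module. -/
def opT {n : ℕ} (c : ℂ) (a b : Fin n) : Module.End ℂ (Induced n) :=
  LinearMap.pi fun σ =>
    (swapHom a b).toLinearMap ∘ₗ LinearMap.proj (σ * swap a b) +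
      (if σ b < σ a then c else 0) • (swapHom a b).toLinearMap ∘ₗ LinearMap.proj σ +
      c • demazure a b ∘ₗ LinearMap.proj σ

/-- The inclusion of scalar functions in the induced module. -/
def scalarFun {n : ℕ} (f : Perm (Fin n) → ℂ) : Induced n := fun σ => algebraMap ℂ (Cl n) (f σ)

lemma opV_apply {n : ℕ} (j : Fin n) (f : Induced n) (σ : Perm (Fin n)) :
    opV j f σ = gen j * f σ := rfl

lemma opT_apply {n : ℕ} (c : ℂ) (a b : Fin n) (f : Induced n) (σ : Perm (Fin n)) :
    opT c a b f σ = swapHom a b (f (σ * swap a b)) +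
      (if σ b < σ a then c else 0) • swapHom a b (f σ) + c • demazure a b (f σ) := rfl

lemma opT_scalarFun {n : ℕ} (c : ℂ) (a b : Fin n) (f : Perm (Fin n) → ℂ) :
    opT c a b (scalarFun f) = scalarFun (heckeAct c a b f) := by
  ext σ
  simp only [opT_apply, scalarFun, heckeAct, AlgHom.commutes, demazure_algebraMap,
    mul_zero, add_zero, map_add, map_mul, Algebra.smul_def]

lemma opV_mul_self {n : ℕ} (j : Fin n) : opV j * opV j = 1 := by
  refine LinearMap.ext fun f => funext fun σ => ?_
  simp [opV_apply, ← mul_assoc, gen_mul_self]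

lemma opV_anticomm {n : ℕ} {j k : Fin n} (h : j ≠ k) : opV j * opV k = -(opV k * opV j) := by
  refine LinearMap.ext fun f => funext fun σ => ?_
  simp [opV_apply, ← mul_assoc, gen_anticomm h]

lemma crosses_opT {n : ℕ} (c : ℂ) {a b : Fin n} (h : a ≠ b) :
    Crosses c (opT c a b) (opV a) (opV b) where
  left := by
    refine LinearMap.ext fun f => funext fun σ => ?_
    simp [opV_apply, opT_apply, demazure_gen_left h, mul_add]
  right := by
    refine LinearMap.ext fun f => funext fun σ => ?_
    simp [opV_apply, opT_apply, demazure_gen_right, mul_add, sub_mul]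
    module

lemma opT_mul_opV_of_ne {n : ℕ} (c : ℂ) {a b l : Fin n} (ha : l ≠ a) (hb : l ≠ b) :
    opT c a b * opV l = opV l * opT c a b := by
  refine LinearMap.ext fun f => funext fun σ => ?_
  simp [opV_apply, opT_apply, demazure_gen_of_ne ha hb, swap_apply_of_ne_of_ne ha hb, mul_add]

lemma Induced.induction {n : ℕ} {P : Induced n → Prop}
    (scalar : ∀ f, P (scalarFun f)) (add : ∀ x y, P x → P y → P (x + y))
    (smul : ∀ (r : ℂ) x, P x → P (r • x)) (opV : ∀ j x, P x → P (opV j x)) (x : Induced n) :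
    P x := by
  have hsingle : ∀ (σ : Perm (Fin n)) (y : Cl n), P (Pi.single σ y) := by
    intro σ y
    induction y using clifford_induction with
    | one =>
      convert scalar (Pi.single σ 1)
      ext τ
      by_cases h : τ = σ <;> simp [scalarFun, h]
    | add x y hx hy => rw [Pi.single_add]; exact add _ _ hx hy
    | smul r x hx => rw [Pi.single_smul]; exact smul _ _ hx
    | gen_mul j x hx =>
      convert opV j _ hx
      ext τ
      by_cases h : τ = σ <;> simp [opV_apply, h]
  rw [← Finset.univ_sum_single x]
  exact Finset.sum_induction _ P add (by simpa using hsingle 1 0) fun σ _ => hsingle σ _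

lemma eq_zero_of_twisted {n : ℕ} {X : Module.End ℂ (Induced n)}
    (htwist : ∀ j, ∃ k, X * opV j = opV k * X) (hscalar : ∀ f, X (scalarFun f) = 0) : X = 0 := by
  refine LinearMap.ext fun x => ?_
  induction x using Induced.induction with
  | scalar f => exact hscalar f
  | add x y hx hy => simp_all
  | smul r x hx => simp_all
  | opV j x hx =>
    obtain ⟨k, hk⟩ := htwist j
    rw [← Module.End.mul_apply, hk, Module.End.mul_apply, hx]
    simp

lemma scalarFun_add {n : ℕ} (f g : Perm (Fin n) → ℂ) :
    scalarFun (f + g) = scalarFun f + scalarFun g := by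
  ext σ; simp [scalarFun]

lemma scalarFun_smul {n : ℕ} (c : ℂ) (f : Perm (Fin n) → ℂ) :
    scalarFun (c • f) = c • scalarFun f := by
  ext σ; simp [scalarFun, Algebra.smul_def]

lemma opT_quadratic {n : ℕ} (c : ℂ) {a b : Fin n} (h : a ≠ b) :
    opT c a b * opT c a b = 1 + c • opT c a b := by
  rw [← sub_eq_zero]
  refine eq_zero_of_twisted (fun j => ⟨j, ?_⟩) fun f => ?_
  · by_cases ha : j = a
    · subst ha; exact (crosses_opT c h).quadratic_left
    by_cases hb : j = b
    · subst hb; exact (crosses_opT c h).quadratic_right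
    have hj := opT_mul_opV_of_ne c ha hb
    simp only [sub_mul, mul_sub, add_mul, mul_add, one_mul, mul_one, smul_mul_assoc,
      mul_smul_comm, hj, mul_assoc]
    rw [← mul_assoc (opT c a b) (opV j), hj, mul_assoc]
  · simp only [LinearMap.sub_apply, Module.End.mul_apply, LinearMap.add_apply, Module.End.one_apply,
      LinearMap.smul_apply, opT_scalarFun]
    rw [heckeAct_quadratic c h, scalarFun_add, scalarFun_smul, sub_self]

lemma twisted_neg_sub {A : Type*} [Ring A] {x y v w : A} (h : (x - y) * v = w * (x - y)) :
    (y - x) * v = w * (y - x) := by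
  rw [← neg_sub x y, neg_mul, h, mul_neg]

lemma opT_comm {n : ℕ} (c : ℂ) {a b d e : Fin n} (hab : a ≠ b) (hde : d ≠ e) (had : a ≠ d)
    (hae : a ≠ e) (hbd : b ≠ d) (hbe : b ≠ e) :
    opT c a b * opT c d e = opT c d e * opT c a b := by
  have ha := opT_mul_opV_of_ne c had hae
  have hb := opT_mul_opV_of_ne c hbd hbe
  have hd := opT_mul_opV_of_ne c had.symm hbd.symm
  have he := opT_mul_opV_of_ne c hae.symm hbe.symm
  rw [← sub_eq_zero]
  refine eq_zero_of_twisted (fun j => ?_) fun f => ?_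
  · by_cases hja : j = a
    · subst hja; exact ⟨_, (crosses_opT c hab).commutator_left ha hb⟩
    by_cases hjb : j = b
    · subst hjb; exact ⟨_, (crosses_opT c hab).commutator_right ha hb⟩
    have hj := opT_mul_opV_of_ne c hja hjb
    by_cases hjd : j = d
    · subst hjd
      refine ⟨e, ?_⟩
      exact twisted_neg_sub ((crosses_opT c hde).commutator_left hd he)
    by_cases hje : j = e
    · subst hje
      refine ⟨d, ?_⟩
      exact twisted_neg_sub ((crosses_opT c hde).commutator_right hd he)
    have hj' := opT_mul_opV_of_ne c hjd hje
    refine ⟨j, ?_⟩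
    rw [sub_mul, mul_sub, mul_assoc, hj', mul_assoc, hj, ← mul_assoc, hj, ← mul_assoc, hj',
      mul_assoc, mul_assoc]
  · simp only [LinearMap.sub_apply, Module.End.mul_apply, opT_scalarFun]
    rw [heckeAct_comm c had hae hbd hbe, sub_self]

lemma opT_braid {n : ℕ} (c : ℂ) {a b d : Fin n} (hab : a ≠ b) (had : a ≠ d) (hbd : b ≠ d) :
    opT c a b * opT c b d * opT c a b = opT c b d * opT c a b * opT c b d := by
  have hT := crosses_opT c hab
  have hU := crosses_opT c hbd
  have hTd := opT_mul_opV_of_ne c had.symm hbd.symm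
  have hUa := opT_mul_opV_of_ne c hab had
  rw [← sub_eq_zero]
  refine eq_zero_of_twisted (fun j => ?_) fun f => ?_
  · by_cases hja : j = a
    · subst hja; exact ⟨_, hT.braid_left hU hTd hUa⟩
    by_cases hjb : j = b
    · subst hjb; exact ⟨_, hT.braid_mid hU hTd hUa⟩
    by_cases hjd : j = d
    · subst hjd
      exact ⟨_, hT.braid_right hU hTd hUa (opT_quadratic c hab) (opT_quadratic c hbd)⟩
    have hj : Commute (opT c a b) (opV j) := opT_mul_opV_of_ne c hja hjb
    have hj' : Commute (opT c b d) (opV j) := opT_mul_opV_of_ne c hjb hjd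
    exact ⟨j, (((hj.mul_left hj').mul_left hj).sub_left ((hj'.mul_left hj).mul_left hj')).eq⟩
  · simp only [LinearMap.sub_apply, Module.End.mul_apply, opT_scalarFun]
    rw [heckeAct_braid c hab had hbd, sub_self]

/-! ### Spanning sets for Hecke-type subalgebras -/

/-- The descending product `t k * t (k - 1) * ⋯` with `d` factors. -/
def descProd {A : Type*} [Monoid A] (t : ℕ → A) (k : ℕ) : ℕ → A
  | 0 => 1
  | d + 1 => descProd t k d * t (k - d)

lemma descProd_comm {A : Type*} [Monoid A] {t : ℕ → A} {m : ℕ}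
    (hcomm : ∀ i j, i + 2 ≤ j → j < m → t i * t j = t j * t i) {k d i : ℕ} (hk : k < m)
    (h : i + d < k) : descProd t k d * t i = t i * descProd t k d := by
  induction d with
  | zero => simp [descProd]
  | succ d ih =>
    rw [descProd, mul_assoc, ← hcomm i (k - d) (by omega) (by omega), ← mul_assoc,
      ih (by omega), mul_assoc]

lemma descProd_shift {A : Type*} [Monoid A] {t : ℕ → A} {m : ℕ}
    (hbraid : ∀ i, i + 1 < m → t i * t (i + 1) * t i = t (i + 1) * t i * t (i + 1))
    (hcomm : ∀ i j, i + 2 ≤ j → j < m → t i * t j = t j * t i) {k d i : ℕ} (hk : k < m)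
    (hd : d ≤ k + 1) (hi : i < k) (h : k + 1 < i + 1 + d) :
    descProd t k d * t (i + 1) = t i * descProd t k d := by
  induction d with
  | zero => omega
  | succ d ih =>
    obtain h' | h' := Nat.lt_or_ge (k + 1) (i + 1 + d)
    · rw [descProd, mul_assoc, hcomm (k - d) (i + 1) (by omega) (by omega), ← mul_assoc,
        ih (by omega) h', mul_assoc]
    · obtain rfl : k = i + d := by omega
      obtain ⟨d, rfl⟩ : ∃ e, d = e + 1 := ⟨d - 1, by omega⟩
      have e1 : i + (d + 1) - d = i + 1 := by omega
      have e2 : i + (d + 1) - (d + 1) = i := by omega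
      rw [descProd, descProd, e1, e2, mul_assoc, mul_assoc, ← mul_assoc (t (i + 1)),
        ← hbraid i (by omega), mul_assoc, ← mul_assoc, descProd_comm hcomm hk (by omega)]
      simp only [mul_assoc]

lemma exists_finset_card_le_factorial {A : Type*} [Ring A] [Algebra ℂ A] {t : ℕ → A} {m : ℕ}
    (c : ℂ)
    (hbraid : ∀ i, i + 1 < m → t i * t (i + 1) * t i = t (i + 1) * t i * t (i + 1))
    (hcomm : ∀ i j, i + 2 ≤ j → j < m → t i * t j = t j * t i)
    (hquad : ∀ i < m, t i * t i = 1 + c • t i) (k : ℕ) (hk : k ≤ m) :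
    ∃ s : Finset A, s.card ≤ (k + 1).factorial ∧
      Subalgebra.toSubmodule (Algebra.adjoin ℂ (t '' {i | i < k})) ≤ Submodule.span ℂ s := by
  classical
  induction k with
  | zero =>
    refine ⟨{1}, by simp, ?_⟩
    simp [Algebra.toSubmodule_bot, Submodule.one_eq_span]
  | succ k ih =>
    obtain ⟨s, hs, hspan⟩ := ih (by omega)
    set S := Algebra.adjoin ℂ (t '' {i | i < k}) with hS
    have htS : ∀ i < k, t i ∈ S := fun i hi => Algebra.subset_adjoin ⟨i, hi, rfl⟩
    set X : Finset A := (Finset.range (k + 2)).image (descProd t k) with hX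
    have hXmem : ∀ d ≤ k + 1, descProd t k d ∈ Submodule.span ℂ (X : Set A) := fun d hd =>
      Submodule.subset_span (by
        simp only [hX, Finset.coe_image, Set.mem_image, Finset.coe_range, Set.mem_Iio]
        exact ⟨d, by omega, rfl⟩)
    set P : Submodule ℂ A := Subalgebra.toSubmodule S * Submodule.span ℂ (X : Set A) with hP
    have hSP : ∀ x ∈ S, ∀ d ≤ k + 1, x * descProd t k d ∈ P := fun x hx d hd =>
      Submodule.mul_mem_mul hx (hXmem d hd)
    have hstable : ∀ i ≤ k, ∀ p ∈ P, p * t i ∈ P := by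
      intro i hi p hp
      induction hp using Submodule.mul_induction_on' with
      | add x _ y _ hx hy => rw [add_mul]; exact add_mem hx hy
      | mem_mul_mem x hx y hy =>
        rw [Subalgebra.mem_toSubmodule] at hx
        induction hy using Submodule.span_induction with
        | zero => simp
        | add y z _ _ hy hz => rw [mul_add, add_mul]; exact add_mem hy hz
        | smul r y _ hy => rw [mul_smul_comm, smul_mul_assoc]; exact P.smul_mem r hy
        | mem y hy =>
          simp only [hX, Finset.coe_image, Set.mem_image, Finset.coe_range, Set.mem_Iio] at hy
          obtain ⟨d, hd, rfl⟩ := hy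
          rw [mul_assoc]
          rcases lt_trichotomy (i + d) (k + 1) with h | h | h
          · obtain h | h := Nat.lt_or_ge (i + d) k
            · rw [descProd_comm hcomm hk (by omega), ← mul_assoc]
              exact hSP _ (S.mul_mem hx (htS i (by omega))) d (by omega)
            · obtain rfl : i = k - d := by omega
              exact hSP x hx (d + 1) (by omega)
          · obtain ⟨d, rfl⟩ | rfl : (∃ e, d = e + 1) ∨ d = 0 := by
              cases d <;> simp
            · obtain rfl : i = k - d := by omega
              rw [descProd, mul_assoc, hquad _ (by omega), mul_add, mul_smul_comm, mul_one,
                mul_add, mul_smul_comm]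
              exact add_mem (hSP x hx d (by omega)) (P.smul_mem c (hSP x hx (d + 1) (by omega)))
            · omega
          · obtain ⟨i, rfl⟩ : ∃ e, i = e + 1 := ⟨i - 1, by omega⟩
            rw [descProd_shift hbraid hcomm hk (by omega) (by omega) (by omega), ← mul_assoc]
            exact hSP _ (S.mul_mem hx (htS i (by omega))) d (by omega)
    have hone : (1 : A) ∈ P := by simpa [descProd] using hSP 1 S.one_mem 0 (by omega)
    have hle : ∀ x ∈ Algebra.adjoin ℂ (t '' {i | i < k + 1}), ∀ p ∈ P, p * x ∈ P := by
      intro x hx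
      induction hx using Algebra.adjoin_induction with
      | mem x hx =>
        obtain ⟨i, hi, rfl⟩ := hx
        exact hstable i (Nat.lt_succ_iff.mp hi)
      | algebraMap r =>
        intro p hp
        rw [← Algebra.commutes, ← Algebra.smul_def]
        exact P.smul_mem r hp
      | add x y _ _ hx hy => intro p hp; rw [mul_add]; exact add_mem (hx p hp) (hy p hp)
      | mul x y _ _ hx hy => intro p hp; rw [← mul_assoc]; exact hy _ (hx p hp)
    refine ⟨s * X, ?_, fun x hx => ?_⟩
    · calc (s * X).card ≤ s.card * X.card := Finset.card_mul_le
        _ ≤ (k + 1).factorial * (k + 2) :=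
          Nat.mul_le_mul hs (Finset.card_image_le.trans (by simp))
        _ = (k + 1 + 1).factorial := by rw [Nat.factorial_succ (k + 1), mul_comm]
    · have hxP : x ∈ P := by simpa using hle x hx 1 hone
      rw [Finset.coe_mul, ← Submodule.span_mul_span]
      exact mul_le_mul_left hspan _ hxP

/-! ### The Hecke–Clifford algebra -/

/-- The left position affected by a Hecke generator. -/
def lo {n : ℕ} (i : Fin (n - 1)) : Fin n := ⟨i, by have := i.2; omega⟩

/-- The right position affected by a Hecke generator. -/
def hi {n : ℕ} (i : Fin (n - 1)) : Fin n := ⟨i + 1, by have := i.2; omega⟩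

lemma lo_ne_hi {n : ℕ} (i : Fin (n - 1)) : lo i ≠ hi i := by simp [lo, hi]

section Relations

variable (q : ℂ) {n : ℕ}

lemma HCt_braid (i j : Fin (n - 1)) (h : (j : ℕ) = i + 1) :
    HCt q n i * HCt q n j * HCt q n i = HCt q n j * HCt q n i * HCt q n j := by
  simpa [HCt] using RingQuot.mkAlgHom_rel ℂ (HCrel.braid (q := q) i j h)

lemma HCt_comm (i j : Fin (n - 1)) (h : (i : ℕ) + 2 ≤ j ∨ (j : ℕ) + 2 ≤ i) :
    HCt q n i * HCt q n j = HCt q n j * HCt q n i := by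
  simpa [HCt] using RingQuot.mkAlgHom_rel ℂ (HCrel.tcomm (q := q) i j h)

lemma HCt_mul_self (i : Fin (n - 1)) :
    HCt q n i * HCt q n i = 1 + (q - q⁻¹) • HCt q n i := by
  simpa only [HCt, map_mul, map_add, map_smul, map_one] using
    RingQuot.mkAlgHom_rel ℂ (HCrel.quad (q := q) i)

lemma HCv_mul_self (j : Fin n) : HCv q n j * HCv q n j = 1 := by
  simpa [HCv] using RingQuot.mkAlgHom_rel ℂ (HCrel.vsq (q := q) j)

lemma HCv_anticomm (j k : Fin n) (h : j ≠ k) :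
    HCv q n j * HCv q n k = -(HCv q n k * HCv q n j) := by
  simpa [HCv] using RingQuot.mkAlgHom_rel ℂ (HCrel.vanti (q := q) j k h)

lemma crosses_HCt (i : Fin (n - 1)) :
    Crosses (q - q⁻¹) (HCt q n i) (HCv q n (lo i)) (HCv q n (hi i)) where
  left := by
    simpa [HCt, HCv] using
      RingQuot.mkAlgHom_rel ℂ (HCrel.tv₁ (q := q) i (lo i) (hi i) rfl rfl)
  right := by
    simpa only [HCt, HCv, map_mul, map_sub, map_smul] using
      RingQuot.mkAlgHom_rel ℂ (HCrel.tv₂ (q := q) i (lo i) (hi i) rfl rfl)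

lemma HCt_mul_HCv_of_ne (i : Fin (n - 1)) (l : Fin n) (hl : l ≠ lo i) (hh : l ≠ hi i) :
    HCt q n i * HCv q n l = HCv q n l * HCt q n i := by
  simpa [HCt, HCv] using RingQuot.mkAlgHom_rel ℂ (HCrel.tvcomm (q := q) i l
    ⟨fun h => hl (Fin.ext h), fun h => hh (Fin.ext h)⟩)

end Relations

/-- The universal property of the Hecke–Clifford algebra. -/
lemma exists_lift (q : ℂ) {n : ℕ} {A : Type*} [Ring A] [Algebra ℂ A] (T : Fin (n - 1) → A)
    (V : Fin n → A)
    (hbraid : ∀ i j : Fin (n - 1), (j : ℕ) = i + 1 → T i * T j * T i = T j * T i * T j)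
    (hcomm : ∀ i j : Fin (n - 1), (i : ℕ) + 2 ≤ j ∨ (j : ℕ) + 2 ≤ i → T i * T j = T j * T i)
    (hquad : ∀ i, T i * T i = 1 + (q - q⁻¹) • T i)
    (hsq : ∀ j, V j * V j = 1) (hanti : ∀ j k, j ≠ k → V j * V k = -(V k * V j))
    (hcross : ∀ i, Crosses (q - q⁻¹) (T i) (V (lo i)) (V (hi i)))
    (hne : ∀ i l, l ≠ lo i → l ≠ hi i → T i * V l = V l * T i) :
    ∃ φ : HeckeClifford q n →ₐ[ℂ] A, (∀ i, φ (HCt q n i) = T i) ∧ ∀ j, φ (HCv q n j) = V j := by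
  refine ⟨RingQuot.liftAlgHom ℂ ⟨FreeAlgebra.lift ℂ (Sum.elim T V), ?_⟩, ?_, ?_⟩
  · intro x y h
    induction h with
    | braid i j h => simpa [tF] using hbraid i j h
    | tcomm i j h => simpa [tF] using hcomm i j h
    | quad i => simpa [tF] using hquad i
    | vsq j => simpa [vF] using hsq j
    | vanti j k h => simpa [vF] using hanti j k h
    | tv₁ i j j' hj hj' =>
      obtain rfl : j = lo i := Fin.ext hj
      obtain rfl : j' = hi i := Fin.ext hj'
      simpa [tF, vF] using (hcross i).left
    | tv₂ i j j' hj hj' =>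
      obtain rfl : j = lo i := Fin.ext hj
      obtain rfl : j' = hi i := Fin.ext hj'
      simpa only [tF, vF, map_mul, map_sub, map_smul, FreeAlgebra.lift_ι_apply, Sum.elim_inl,
        Sum.elim_inr] using (hcross i).right
    | tvcomm i l h =>
      simpa [tF, vF] using hne i l (fun e => h.1 (by rw [e]; rfl)) (fun e => h.2 (by rw [e]; rfl))
  · intro i
    simp [HCt, tF]
  · intro j
    simp [HCv, vF]

lemma HeckeClifford.algHom_ext {q : ℂ} {n : ℕ} {A : Type*} [Ring A] [Algebra ℂ A]
    {φ ψ : HeckeClifford q n →ₐ[ℂ] A} (ht : ∀ i, φ (HCt q n i) = ψ (HCt q n i))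
    (hv : ∀ j, φ (HCv q n j) = ψ (HCv q n j)) : φ = ψ := by
  refine RingQuot.ringQuot_ext' ℂ φ ψ (FreeAlgebra.hom_ext (funext fun x => ?_))
  rcases x with i | j
  · exact ht i
  · exact hv j

lemma HeckeClifford.mul_mem_of_stable {q : ℂ} {n : ℕ} {P : Submodule ℂ (HeckeClifford q n)}
    (ht : ∀ i, ∀ p ∈ P, HCt q n i * p ∈ P) (hv : ∀ j, ∀ p ∈ P, HCv q n j * p ∈ P)
    (x : HeckeClifford q n) : ∀ p ∈ P, x * p ∈ P := by
  obtain ⟨x, rfl⟩ := RingQuot.mkAlgHom_surjective ℂ (HCrel q n) x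
  induction x using FreeAlgebra.induction with
  | grade0 r =>
    intro p hp
    rw [AlgHom.commutes, ← Algebra.smul_def]
    exact P.smul_mem r hp
  | grade1 x =>
    rcases x with i | j
    · exact ht i
    · exact hv j
  | mul x y hx hy => intro p hp; rw [map_mul, mul_assoc]; exact hx _ (hy _ hp)
  | add x y hx hy => intro p hp; rw [map_add, add_mul]; exact add_mem (hx _ hp) (hy _ hp)

lemma HeckeClifford.eq_top_of_stable {q : ℂ} {n : ℕ} {P : Submodule ℂ (HeckeClifford q n)}
    (one : 1 ∈ P) (ht : ∀ i, ∀ p ∈ P, HCt q n i * p ∈ P) (hv : ∀ j, ∀ p ∈ P, HCv q n j * p ∈ P) :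
    P = ⊤ :=
  Submodule.eq_top_iff'.2 fun x => by
    simpa using HeckeClifford.mul_mem_of_stable ht hv x 1 one

/-! ### The dimension of the Hecke–Clifford algebra -/

lemma exists_spanning_finset (q : ℂ) {n : ℕ} (hn : 1 ≤ n) :
    ∃ s : Finset (HeckeClifford q n), s.card ≤ 2 ^ n * n.factorial ∧
      Submodule.span ℂ (s : Set (HeckeClifford q n)) = ⊤ := by
  classical
  set t : ℕ → HeckeClifford q n := fun k => if h : k < n - 1 then HCt q n ⟨k, h⟩ else 0 with htdef
  have ht : ∀ i : Fin (n - 1), t i = HCt q n i := fun i => by simp [htdef]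
  obtain ⟨s, hs, hspan⟩ := exists_finset_card_le_factorial (t := t) (m := n - 1) (q - q⁻¹)
    (fun i hi => by
      simpa only [← ht] using HCt_braid q ⟨i, by omega⟩ ⟨i + 1, hi⟩ rfl)
    (fun i j hij hj => by
      simpa only [← ht] using HCt_comm q ⟨i, by omega⟩ ⟨j, hj⟩ (Or.inl hij))
    (fun i hi => by simpa only [← ht] using HCt_mul_self q ⟨i, hi⟩) (n - 1) le_rfl
  rw [Nat.sub_add_cancel hn] at hs
  set H := Algebra.adjoin ℂ (t '' {i | i < n - 1}) with hH
  have htH : ∀ i, HCt q n i ∈ H := fun i => Algebra.subset_adjoin ⟨i, i.2, ht i⟩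
  set φ : Cl n →ₐ[ℂ] HeckeClifford q n :=
    cliffordLift (HCv q n) (HCv_mul_self q) (HCv_anticomm q) with hφ
  have hφgen : ∀ j, φ (gen j) = HCv q n j := cliffordLift_gen _ _ _
  set P : Submodule ℂ (HeckeClifford q n) :=
    LinearMap.range φ.toLinearMap * Subalgebra.toSubmodule H with hP
  have hmem : ∀ (x : Cl n), ∀ h ∈ H, φ x * h ∈ P := fun x h hh =>
    Submodule.mul_mem_mul ⟨x, rfl⟩ hh
  have hvP : ∀ j, ∀ p ∈ P, HCv q n j * p ∈ P := by
    intro j p hp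
    induction hp using Submodule.mul_induction_on' with
    | add x _ y _ hx hy => rw [mul_add]; exact add_mem hx hy
    | mem_mul_mem x hx h hh =>
      obtain ⟨x, rfl⟩ := hx
      rw [← hφgen, ← mul_assoc, AlgHom.toLinearMap_apply, ← map_mul]
      exact hmem _ h hh
  have htP : ∀ i, ∀ p ∈ P, HCt q n i * p ∈ P := by
    intro i p hp
    induction hp using Submodule.mul_induction_on' with
    | add x _ y _ hx hy => rw [mul_add]; exact add_mem hx hy
    | mem_mul_mem x hx h hh =>
      obtain ⟨x, rfl⟩ := hx
      rw [AlgHom.toLinearMap_apply]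
      induction x using clifford_induction with
      | one =>
        rw [map_one, one_mul, ← one_mul (HCt q n i * h), ← map_one φ]
        exact hmem 1 _ (H.mul_mem (htH i) hh)
      | add x y hx hy => rw [map_add, add_mul, mul_add]; exact add_mem hx hy
      | smul r x hx =>
        rw [map_smul, smul_mul_assoc, mul_smul_comm]
        exact P.smul_mem r hx
      | gen_mul j x hx =>
        rw [map_mul, hφgen, mul_assoc]
        by_cases hl : j = lo i
        · subst hl
          rw [(crosses_HCt q i).left_assoc]
          exact hvP _ _ hx
        by_cases hh' : j = hi i
        · subst hh'
          rw [(crosses_HCt q i).right_assoc]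
          exact sub_mem (hvP _ _ hx) (P.smul_mem _
            (sub_mem (hvP _ _ (hmem x h hh)) (hvP _ _ (hmem x h hh))))
        · rw [← mul_assoc, HCt_mul_HCv_of_ne q i j hl hh', mul_assoc]
          exact hvP _ _ hx
  have hPtop : P = ⊤ := HeckeClifford.eq_top_of_stable
    (by simpa using hmem 1 1 H.one_mem) htP hvP
  set B : Finset (HeckeClifford q n) := Finset.univ.image fun I => φ (cliffordBasis n I) with hB
  have hrange : LinearMap.range φ.toLinearMap ≤ Submodule.span ℂ (B : Set (HeckeClifford q n)) := by
    rw [LinearMap.range_eq_map, ← (cliffordBasis n).span_eq, Submodule.map_span,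
      ← Set.range_comp, hB, Finset.coe_image, Finset.coe_univ, Set.image_univ]
    exact le_rfl
  refine ⟨B * s, ?_, ?_⟩
  · refine Finset.card_mul_le.trans (Nat.mul_le_mul ?_ hs)
    exact Finset.card_image_le.trans (by simp)
  · rw [eq_top_iff, ← hPtop, Finset.coe_mul, ← Submodule.span_mul_span]
    exact mul_le_mul' hrange hspan

lemma mclosure_range_swap_lo_hi {n : ℕ} (hn : 1 ≤ n) :
    Submonoid.closure (Set.range fun i : Fin (n - 1) => swap (lo i) (hi i)) = ⊤ := by
  obtain ⟨n, rfl⟩ : ∃ m, n = m + 1 := ⟨n - 1, by omega⟩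
  exact Equiv.Perm.mclosure_swap_castSucc_succ n

lemma finrank_induced (n : ℕ) : Module.finrank ℂ (Induced n) = 2 ^ n * n.factorial := by
  rw [Module.finrank_pi_fintype]
  simp [finrank_clifford, Fintype.card_perm, mul_comm]

lemma le_finrank_heckeClifford (q : ℂ) {n : ℕ} (hn : 1 ≤ n)
    [Module.Finite ℂ (HeckeClifford q n)] :
    2 ^ n * n.factorial ≤ Module.finrank ℂ (HeckeClifford q n) := by
  have hlohi : ∀ i j : Fin (n - 1), (j : ℕ) = i + 1 → lo j = hi i := fun i j h => Fin.ext h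
  obtain ⟨ρ, hρt, hρv⟩ := exists_lift q (fun i : Fin (n - 1) => opT (q - q⁻¹) (lo i) (hi i)) opV
    (fun i j h => by
      rw [hlohi i j h]
      exact opT_braid _ (lo_ne_hi i) (by simp [lo, hi, h, Fin.ext_iff]; omega)
        (by simp [hi, h, Fin.ext_iff]))
    (fun i j h => by
      refine opT_comm _ (lo_ne_hi i) (lo_ne_hi j) ?_ ?_ ?_ ?_ <;>
        simp only [lo, hi, ne_eq, Fin.ext_iff] <;> omega)
    (fun i => opT_quadratic _ (lo_ne_hi i)) opV_mul_self (fun _ _ h => opV_anticomm h)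
    (fun i => crosses_opT _ (lo_ne_hi i)) (fun i l hl hh => opT_mul_opV_of_ne _ hl hh)
  let base : Induced n := scalarFun (Pi.single 1 1)
  let orbit : HeckeClifford q n →ₗ[ℂ] Induced n := LinearMap.applyₗ base ∘ₗ ρ.toLinearMap
  have horbit : ∀ x, orbit x = ρ x base := fun _ => rfl
  have hT : ∀ i, ∀ y ∈ LinearMap.range orbit,
      opT (q - q⁻¹) (lo i) (hi i) y ∈ LinearMap.range orbit := by
    rintro i _ ⟨x, rfl⟩
    exact ⟨HCt q n i * x, by simp [horbit, hρt]⟩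
  have hV : ∀ j, ∀ y ∈ LinearMap.range orbit, opV j y ∈ LinearMap.range orbit := by
    rintro j _ ⟨x, rfl⟩
    exact ⟨HCv q n j * x, by simp [horbit, hρv]⟩
  have hdelta : ∀ σ : Perm (Fin n),
      (scalarFun (Pi.single σ 1) : Induced n) ∈ LinearMap.range orbit := by
    intro σ
    induction σ using Submonoid.induction_of_closure_eq_top_right
      (mclosure_range_swap_lo_hi hn) with
    | one => exact ⟨1, by simp [horbit, base]⟩
    | mul_right σ y hy hσ =>
      obtain ⟨i, rfl⟩ := hy
      have h := hT i _ hσ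
      have key : heckeAct (q - q⁻¹) (lo i) (hi i) (Pi.single σ 1) =
          Pi.single (σ * swap (lo i) (hi i)) 1 +
            (if σ (hi i) < σ (lo i) then q - q⁻¹ else 0) • Pi.single σ 1 := by
        ext τ
        have e : τ * swap (lo i) (hi i) = σ ↔ τ = σ * swap (lo i) (hi i) := by
          rw [← eq_mul_inv_iff_mul_eq, swap_inv]
        by_cases hτ : τ = σ
        · subst hτ; split_ifs with hlt <;> simp [heckeAct, Pi.single_apply, e, hlt]
        · split_ifs <;> simp [heckeAct, Pi.single_apply, e, hτ]
      rw [opT_scalarFun, key, scalarFun_add, scalarFun_smul] at h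
      exact (Submodule.add_mem_iff_left _ (Submodule.smul_mem _ _ hσ)).1 h
  have hsurj : LinearMap.range orbit = ⊤ := by
    refine Submodule.eq_top_iff'.2 fun y => ?_
    induction y using Induced.induction with
    | scalar f =>
      have hf : (scalarFun f : Induced n) = ∑ σ, f σ • scalarFun (Pi.single σ 1) := by
        ext τ
        simp [scalarFun, Pi.single_apply, Algebra.smul_def, apply_ite (algebraMap ℂ (Cl n))]
      rw [hf]
      exact sum_mem fun σ _ => Submodule.smul_mem _ _ (hdelta σ)
    | add x y hx hy => exact add_mem hx hy
    | smul r x hx => exact Submodule.smul_mem _ _ hx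
    | opV j x hx => exact hV j x hx
  rw [← finrank_induced, ← finrank_top ℂ (Induced n), ← hsurj]
  exact LinearMap.finrank_range_le orbit

lemma finite_and_finrank_heckeClifford (q : ℂ) {n : ℕ} (hn : 1 ≤ n) :
    Module.Finite ℂ (HeckeClifford q n) ∧
      Module.finrank ℂ (HeckeClifford q n) = 2 ^ n * n.factorial := by
  obtain ⟨s, hs, hspan⟩ := exists_spanning_finset q hn
  have hfin : Module.Finite ℂ (HeckeClifford q n) := ⟨⟨s, hspan⟩⟩
  refine ⟨hfin, le_antisymm ?_ (le_finrank_heckeClifford q hn)⟩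
  rw [← finrank_top, ← hspan]
  exact (finrank_span_finset_le_card s).trans hs

/-! ### The even subalgebra -/

lemma HCv_mul_HCv_mem_even (q : ℂ) {n : ℕ} (j k : Fin n) :
    HCv q n j * HCv q n k ∈ HCeven q n := by
  have hv : ∀ (l : Fin n) (x : HeckeClifford q n), HCv q n l * (HCv q n l * x) = x :=
    fun l x => by rw [← mul_assoc, HCv_mul_self, one_mul]
  have hle : ∀ (d : ℕ) (j k : Fin n), (k : ℕ) = j + d → HCv q n j * HCv q n k ∈ HCeven q n := by
    intro d
    induction d with
    | zero =>
      intro j k h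
      obtain rfl : k = j := Fin.ext h
      rw [HCv_mul_self]
      exact one_mem _
    | succ d ih =>
      intro j k h
      have hk := k.2
      let l : Fin n := ⟨j + d, by omega⟩
      have h1 := ih j l rfl
      have h2 : HCv q n l * HCv q n k ∈ HCeven q n := by
        have hk' : k = ⟨j + d + 1, by omega⟩ := Fin.ext (by simp [h, add_assoc])
        rw [hk']
        exact Algebra.subset_adjoin (Or.inr ⟨⟨j + d, by omega⟩, rfl⟩)
      have := mul_mem h1 h2
      rwa [mul_assoc, hv] at this
  obtain h | h := le_total (j : ℕ) k
  · exact hle (k - j) j k (by omega)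
  · by_cases hjk : j = k
    · exact hle 0 j k (by simp [hjk])
    · rw [HCv_anticomm q j k hjk]
      exact neg_mem (hle (j - k) k j (by omega))

lemma HCt_mem_even (q : ℂ) {n : ℕ} (i : Fin (n - 1)) : HCt q n i ∈ HCeven q n :=
  Algebra.subset_adjoin (Or.inl ⟨i, rfl⟩)

lemma exists_even_add_mul_even (q : ℂ) {n : ℕ} (o : Fin n) (ho : (o : ℕ) = 0)
    (x : HeckeClifford q n) :
    ∃ a ∈ HCeven q n, ∃ b ∈ HCeven q n, x = a + HCv q n o * b := by
  set E := Subalgebra.toSubmodule (HCeven q n) with hE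
  set P : Submodule ℂ (HeckeClifford q n) :=
    E ⊔ E.map (LinearMap.mulLeft ℂ (HCv q n o)) with hP
  have hl : ∀ a ∈ HCeven q n, a ∈ P := fun a ha => Submodule.mem_sup_left ha
  have hr : ∀ b ∈ HCeven q n, HCv q n o * b ∈ P := fun b hb =>
    Submodule.mem_sup_right ⟨b, hb, rfl⟩
  have hv : ∀ (j : Fin n) (x : HeckeClifford q n), HCv q n j * (HCv q n j * x) = x :=
    fun j x => by rw [← mul_assoc, HCv_mul_self, one_mul]
  have htop : P = ⊤ := by
    refine HeckeClifford.eq_top_of_stable (hl 1 (one_mem _)) ?_ ?_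
    · intro i p hp
      obtain ⟨a, ha, _, ⟨b, hb, rfl⟩, rfl⟩ := Submodule.mem_sup.1 hp
      rw [mul_add, LinearMap.mulLeft_apply]
      refine add_mem (hl _ (mul_mem (HCt_mem_even q i) ha)) ?_
      by_cases hoi : o = lo i
      · have e : HCt q n i * (HCv q n o * b) =
            HCv q n o * (HCv q n o * HCv q n (hi i) * (HCt q n i * b)) := by
          rw [hoi, (crosses_HCt q i).left_assoc, mul_assoc, hv]
        rw [e]
        exact hr _ (mul_mem (HCv_mul_HCv_mem_even q _ _) (mul_mem (HCt_mem_even q i) hb))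
      · rw [← mul_assoc, HCt_mul_HCv_of_ne q i o hoi (by simp [hi, Fin.ext_iff, ho]), mul_assoc]
        exact hr _ (mul_mem (HCt_mem_even q i) hb)
    · intro j p hp
      obtain ⟨a, ha, _, ⟨b, hb, rfl⟩, rfl⟩ := Submodule.mem_sup.1 hp
      rw [mul_add, LinearMap.mulLeft_apply, ← mul_assoc (HCv q n j) (HCv q n o)]
      refine add_mem ?_ (hl _ (mul_mem (HCv_mul_HCv_mem_even q j o) hb))
      have e : HCv q n j * a = HCv q n o * (HCv q n o * HCv q n j * a) := by
        rw [mul_assoc (HCv q n o) (HCv q n j), hv]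
      rw [e]
      exact hr _ (mul_mem (HCv_mul_HCv_mem_even q o j) ha)
  obtain ⟨a, ha, _, ⟨b, hb, rfl⟩, h⟩ := Submodule.mem_sup.1 (htop ▸ Submodule.mem_top : x ∈ P)
  exact ⟨a, ha, b, hb, h.symm⟩

lemma HeckeClifford.neg_mul {q : ℂ} {n : ℕ} (x y : HeckeClifford q n) : -x * y = -(x * y) :=
  _root_.neg_mul x y

lemma HeckeClifford.mul_neg {q : ℂ} {n : ℕ} (x y : HeckeClifford q n) : x * -y = -(x * y) :=
  _root_.mul_neg x y

lemma HeckeClifford.neg_mul_neg {q : ℂ} {n : ℕ} (x y : HeckeClifford q n) : -x * -y = x * y :=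
  _root_.neg_mul_neg x y

lemma exists_parity (q : ℂ) (n : ℕ) :
    ∃ α : HeckeClifford q n ≃ₐ[ℂ] HeckeClifford q n,
      (∀ i, α (HCt q n i) = HCt q n i) ∧ (∀ j, α (HCv q n j) = -HCv q n j) ∧
        ∀ x, α (α x) = x := by
  obtain ⟨φ, hφt, hφv⟩ := exists_lift q (HCt q n) (fun j => -HCv q n j)
    (HCt_braid q) (HCt_comm q) (HCt_mul_self q)
    (fun j => by rw [HeckeClifford.neg_mul_neg, HCv_mul_self])
    (fun j k h => by
      rw [HeckeClifford.neg_mul_neg, HeckeClifford.neg_mul_neg, HCv_anticomm q j k h])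
    (fun i => ⟨by rw [HeckeClifford.mul_neg, HeckeClifford.neg_mul, (crosses_HCt q i).left],
      by rw [HeckeClifford.mul_neg, HeckeClifford.neg_mul, (crosses_HCt q i).right]; module⟩)
    (fun i l hl hh => by
      rw [HeckeClifford.mul_neg, HeckeClifford.neg_mul, HCt_mul_HCv_of_ne q i l hl hh])
  have hφ : φ.comp φ = AlgHom.id ℂ _ :=
    HeckeClifford.algHom_ext (fun i => by simp [hφt]) (fun j => by simp [hφv])
  exact ⟨AlgEquiv.ofAlgHom φ φ hφ hφ, hφt, hφv, fun x => DFunLike.congr_fun hφ x⟩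

lemma apply_eq_of_mem_even {q : ℂ} {n : ℕ} {φ : HeckeClifford q n →ₐ[ℂ] HeckeClifford q n}
    (ht : ∀ i, φ (HCt q n i) = HCt q n i) (hv : ∀ j, φ (HCv q n j) = -HCv q n j)
    {x : HeckeClifford q n} (hx : x ∈ HCeven q n) : φ x = x := by
  have hle : HCeven q n ≤ AlgHom.equalizer φ (AlgHom.id ℂ _) := by
    refine Algebra.adjoin_le ?_
    rintro _ (⟨i, rfl⟩ | ⟨i, rfl⟩)
    · exact ht i
    · simp [HCe, hv, HeckeClifford.neg_mul_neg]
  exact hle hx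

end HeckeCliffordPBW

end

/-- there is a (unique) `ℂ`-algebra automorphism `α` of `G_n(q)` with
`α(t_i) = t_i` and `α(v_j) = -v_j`; it is an involution, its fixed-point subalgebra is
`G_n[0]` (the subalgebra generated by the `t_i` and `e_j = v_j v_{j+1}`), and `G_n[0]`
has `ℂ`-dimension `2^(n-1) * n!`. -/
theorem heckeClifford_parityAutomorphism (q : ℂ) (hq : q ≠ 0) (n : ℕ) (hn : 2 ≤ n) :
    ∃ α : HeckeClifford q n ≃ₐ[ℂ] HeckeClifford q n,
      (∀ i : Fin (n - 1), α (HCt q n i) = HCt q n i) ∧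
      (∀ j : Fin n, α (HCv q n j) = -(HCv q n j)) ∧
      (∀ β : HeckeClifford q n ≃ₐ[ℂ] HeckeClifford q n,
        (∀ i : Fin (n - 1), β (HCt q n i) = HCt q n i) →
        (∀ j : Fin n, β (HCv q n j) = -(HCv q n j)) → β = α) ∧
      (∀ x : HeckeClifford q n, α (α x) = x) ∧
      (∀ x : HeckeClifford q n, α x = x ↔ x ∈ HCeven q n) ∧
      Module.finrank ℂ (HCeven q n) = 2 ^ (n - 1) * n.factorial := by
  obtain ⟨α, ht, hv, hα⟩ := HeckeCliffordPBW.exists_parity q n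
  obtain ⟨hfin, hrank⟩ := HeckeCliffordPBW.finite_and_finrank_heckeClifford q
    (one_le_two.trans hn)
  have hinv : ∀ x ∈ HCeven q n, α x = x := fun x hx =>
    HeckeCliffordPBW.apply_eq_of_mem_even (φ := α.toAlgHom) ht hv hx
  let o : Fin n := ⟨0, by omega⟩
  have hdec := HeckeCliffordPBW.exists_even_add_mul_even q o rfl
  have ho : ∀ x : HeckeClifford q n, HCv q n o * (HCv q n o * x) = x := fun x => by
    rw [← mul_assoc, HeckeCliffordPBW.HCv_mul_self, one_mul]
  have hαdec : ∀ a ∈ HCeven q n, ∀ b ∈ HCeven q n,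
      α (a + HCv q n o * b) = a - HCv q n o * b := fun a ha b hb => by
    rw [map_add, map_mul, hinv a ha, hinv b hb, hv,
      HeckeCliffordPBW.HeckeClifford.neg_mul, sub_eq_add_neg]
  have hzero : ∀ a ∈ HCeven q n, ∀ b ∈ HCeven q n,
      α (a + HCv q n o * b) = a + HCv q n o * b → b = 0 := fun a ha b hb h => by
    rw [hαdec a ha b hb, sub_eq_add_neg, add_right_inj, neg_eq_iff_add_eq_zero, ← two_smul ℂ,
      smul_eq_zero_iff_right two_ne_zero] at h
    rw [← ho b, h, mul_zero]
  refine ⟨α, ht, hv, fun β hβt hβv => ?_, hα, fun x => ⟨fun hx => ?_, hinv x⟩, ?_⟩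
  · have : (β : HeckeClifford q n →ₐ[ℂ] HeckeClifford q n) = α :=
      HeckeCliffordPBW.HeckeClifford.algHom_ext (fun i => (hβt i).trans (ht i).symm)
        (fun j => (hβv j).trans (hv j).symm)
    exact AlgEquiv.ext fun x => DFunLike.congr_fun this x
  · obtain ⟨a, ha, b, hb, rfl⟩ := hdec x
    rw [hzero a ha b hb hx, mul_zero, add_zero]
    exact ha
  · let f : HCeven q n × HCeven q n →ₗ[ℂ] HeckeClifford q n :=
      (HCeven q n).val.toLinearMap.coprod
        (LinearMap.mulLeft ℂ (HCv q n o) ∘ₗ (HCeven q n).val.toLinearMap)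
    have hf : ∀ a b : HCeven q n, f (a, b) = a + HCv q n o * b := fun _ _ => rfl
    have hinj : Function.Injective f := by
      rw [injective_iff_map_eq_zero]
      rintro ⟨a, b⟩ h
      rw [hf] at h
      have hb : (b : HeckeClifford q n) = 0 :=
        hzero a a.2 b b.2 (by rw [h, map_zero])
      have ha : (a : HeckeClifford q n) = 0 := by simpa [hb] using h
      exact Prod.ext (Subtype.ext ha) (Subtype.ext hb)
    have hsurj : Function.Surjective f := fun x => by
      obtain ⟨a, ha, b, hb, rfl⟩ := hdec x
      exact ⟨(⟨a, ha⟩, ⟨b, hb⟩), rfl⟩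
    have h := (LinearEquiv.ofBijective f ⟨hinj, hsurj⟩).finrank_eq
    have : Module.Free ℂ (HCeven q n) :=
      @Module.Free.of_divisionRing ℂ (HCeven q n) _ (HCeven q n).toRing.toAddCommGroup _
    rw [Module.finrank_prod, hrank] at h
    obtain ⟨m, rfl⟩ : ∃ m, n = m + 1 := ⟨n - 1, by omega⟩
    rw [Nat.add_sub_cancel]
    rw [pow_succ, mul_right_comm] at h
    omega
end

section
/- Let A ⊆ G_{n+1}(q) be the subalgebra generated by t_1,…,t_{n−1} and v_1,…,v_n (a copy of G_n(q)). Then G_{n+1}(q) is spanned as a ℂ-vector space by the elements a·χ·b with a, b ∈ A and χ ∈ {1, t_n, v_{n+1}, v_{n+1} t_n}. Similarly, if A_0 ⊆ G_{n+1}[0] is the subalgebra generated by t_1,…,t_{n−1} and e_1,…,e_{n−1} (a copy of G_n[0]), then G_{n+1}[0] is spanned by the elements a·χ·b with a, b ∈ A_0 and χ ∈ {1, t_n, e_n, e_n t_n}. -/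
noncomputable section

/-- The canonical copy of `G_n(q)` inside `G_{n+1}(q)`: the subalgebra generated by
`t_0, …, t_{n-2}` and `v_0, …, v_{n-1}` (0-indexed). -/
def HCsub (q : ℂ) (n : ℕ) : Subalgebra ℂ (HeckeClifford q (n + 1)) :=
  Algebra.adjoin ℂ
    ({x | ∃ i : Fin ((n + 1) - 1), (i : ℕ) < n - 1 ∧ x = HCt q (n + 1) i} ∪
     {x | ∃ j : Fin (n + 1), (j : ℕ) < n ∧ x = HCv q (n + 1) j})

/-- The canonical copy of `G_n[0]` inside `G_{n+1}[0]`: the subalgebra generated by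
`t_0, …, t_{n-2}` and `e_0, …, e_{n-2}` (0-indexed). -/
def HCsub₀ (q : ℂ) (n : ℕ) : Subalgebra ℂ (HeckeClifford q (n + 1)) :=
  Algebra.adjoin ℂ
    ({x | ∃ i : Fin ((n + 1) - 1), (i : ℕ) < n - 1 ∧ x = HCt q (n + 1) i} ∪
     {x | ∃ i : Fin ((n + 1) - 1), (i : ℕ) < n - 1 ∧ x = HCe q (n + 1) i})

end

section Sandwich

variable {R : Type*} [Ring R] [Algebra ℂ R]

/-- The span of the products `a * χ * b` with `a, b ∈ A` and `χ ∈ {1, T, D, D * T}`. -/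
def sandwichSpan (A : Subalgebra ℂ R) (T D : R) : Submodule ℂ R :=
  Submodule.span ℂ
    {x : R | ∃ a ∈ A, ∃ b ∈ A, ∃ χ ∈ ({1, T, D, D * T} : Set R), x = a * χ * b}

variable {A B : Subalgebra ℂ R} {T D : R}

theorem mul_mul_mem_sandwichSpan {a b χ : R} (ha : a ∈ A) (hb : b ∈ A)
    (hχ : χ ∈ ({1, T, D, D * T} : Set R)) : a * χ * b ∈ sandwichSpan A T D :=
  Submodule.subset_span ⟨a, ha, b, hb, χ, hχ, rfl⟩

theorem sandwichSpan_induction {p : (x : R) → x ∈ sandwichSpan A T D → Prop}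
    (zero : p 0 (zero_mem _))
    (add : ∀ x y hx hy, p x hx → p y hy → p (x + y) (add_mem hx hy))
    (smul : ∀ (c : ℂ) x hx, p x hx → p (c • x) (Submodule.smul_mem _ c hx))
    (mul : ∀ a b χ (ha : a ∈ A) (hb : b ∈ A) (hχ : χ ∈ ({1, T, D, D * T} : Set R)),
      p (a * χ * b) (mul_mul_mem_sandwichSpan ha hb hχ))
    {x : R} (hx : x ∈ sandwichSpan A T D) : p x hx := by
  refine Submodule.span_induction ?_ zero add smul hx
  rintro _ ⟨a, ha, b, hb, χ, hχ, rfl⟩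
  exact mul a b χ ha hb hχ

theorem sandwichSpan_mono (h : B ≤ A) : sandwichSpan B T D ≤ sandwichSpan A T D :=
  Submodule.span_mono fun _ ⟨a, ha, b, hb, χ, hχ, e⟩ => ⟨a, h ha, b, h hb, χ, hχ, e⟩

theorem sandwichSpan_le {C : Subalgebra ℂ R} (hA : A ≤ C) (hT : T ∈ C) (hD : D ∈ C) :
    sandwichSpan A T D ≤ Subalgebra.toSubmodule C := by
  refine Submodule.span_le.2 ?_
  rintro _ ⟨a, ha, b, hb, χ, hχ, rfl⟩
  refine C.mul_mem (C.mul_mem (hA ha) ?_) (hA hb)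
  rcases hχ with rfl | rfl | rfl | rfl
  exacts [C.one_mem, hT, hD, C.mul_mem hD hT]

theorem mem_sandwichSpan_of_mem {χ : R} (hχ : χ ∈ ({1, T, D, D * T} : Set R)) :
    χ ∈ sandwichSpan A T D := by
  simpa using mul_mul_mem_sandwichSpan A.one_mem A.one_mem hχ

theorem le_sandwichSpan {a : R} (ha : a ∈ A) : a ∈ sandwichSpan A T D := by
  simpa using mul_mul_mem_sandwichSpan (T := T) (D := D) ha A.one_mem (χ := 1) (by simp)

theorem left_mem_sandwichSpan : T ∈ sandwichSpan A T D := mem_sandwichSpan_of_mem (by simp)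

theorem right_mem_sandwichSpan : D ∈ sandwichSpan A T D := mem_sandwichSpan_of_mem (by simp)

theorem mul_mem_sandwichSpan : D * T ∈ sandwichSpan A T D := mem_sandwichSpan_of_mem (by simp)

theorem mul_left_mem_sandwichSpan {a x : R} (ha : a ∈ A) (hx : x ∈ sandwichSpan A T D) :
    a * x ∈ sandwichSpan A T D := by
  induction hx using sandwichSpan_induction with
  | zero => simp
  | add x y _ _ hx hy => rw [mul_add]; exact add_mem hx hy
  | smul c x _ hx => rw [mul_smul_comm]; exact Submodule.smul_mem _ _ hx
  | mul a' b χ ha' hb hχ =>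
    rw [← mul_assoc, ← mul_assoc]
    exact mul_mul_mem_sandwichSpan (A.mul_mem ha ha') hb hχ

theorem mul_right_mem_sandwichSpan {b x : R} (hb : b ∈ A) (hx : x ∈ sandwichSpan A T D) :
    x * b ∈ sandwichSpan A T D := by
  induction hx using sandwichSpan_induction with
  | zero => simp
  | add x y _ _ hx hy => rw [add_mul]; exact add_mem hx hy
  | smul c x _ hx => rw [smul_mul_assoc]; exact Submodule.smul_mem _ _ hx
  | mul a b' χ ha hb' hχ =>
    rw [mul_assoc]
    exact mul_mul_mem_sandwichSpan ha (A.mul_mem hb' hb) hχ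

/-- If `D * D ∈ A` and `D * A ⊆ A * D`, then the sandwich span is stable under left
multiplication by `D`. -/
theorem right_mul_mem_sandwichSpan (hDD : D * D ∈ A)
    (hDA : ∀ a ∈ A, ∃ a' ∈ A, D * a = a' * D) {x : R} (hx : x ∈ sandwichSpan A T D) :
    D * x ∈ sandwichSpan A T D := by
  induction hx using sandwichSpan_induction with
  | zero => simp
  | add x y _ _ hx hy => rw [mul_add]; exact add_mem hx hy
  | smul c x _ hx => rw [mul_smul_comm]; exact Submodule.smul_mem _ _ hx
  | mul a b χ ha hb hχ =>
    obtain ⟨a', ha', h⟩ := hDA a ha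
    have e : D * (a * χ * b) = a' * (D * χ) * b := by
      rw [← mul_assoc, ← mul_assoc, h, mul_assoc a']
    rw [e]
    refine mul_right_mem_sandwichSpan hb (mul_left_mem_sandwichSpan ha' ?_)
    rcases hχ with rfl | rfl | rfl | rfl
    · simpa using right_mem_sandwichSpan
    · exact mul_mem_sandwichSpan
    · exact le_sandwichSpan hDD
    · rw [← mul_assoc]
      exact mul_left_mem_sandwichSpan hDD left_mem_sandwichSpan

/-- If `A` is itself a sandwich span over a subalgebra `B` with `b * T = T * b` for
`b ∈ B` and `B * D ⊆ D * B`, then the sandwich span of `A` is stable under left multiplication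
by `T`, provided finitely many products lie in it. -/
theorem left_mul_mem_sandwichSpan {t d x₀ : R} (hBA : B ≤ A) (ht : t ∈ A)
    (hA : ∀ a ∈ A, a ∈ sandwichSpan B t d) (hDD : D * D ∈ A)
    (hDA : ∀ a ∈ A, ∃ a' ∈ A, D * a = a' * D) (hBT : ∀ b ∈ B, b * T = T * b)
    (hBD : ∀ b ∈ B, ∃ b' ∈ B, b * D = D * b') (hx₀ : x₀ ∈ A) (hTd : T * d = x₀ * D * T)
    (hTT : T * T ∈ sandwichSpan A T D) (hTD : T * D ∈ sandwichSpan A T D)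
    (hTDT : T * (D * T) ∈ sandwichSpan A T D) (hTtT : T * t * T ∈ sandwichSpan A T D)
    (hTtD : T * t * D ∈ sandwichSpan A T D) (hTtDT : T * t * (D * T) ∈ sandwichSpan A T D)
    {x : R} (hx : x ∈ sandwichSpan A T D) : T * x ∈ sandwichSpan A T D := by
  have hmid : ∀ χ' ∈ ({1, t, d, d * t} : Set R), ∀ χ ∈ ({1, T, D, D * T} : Set R),
      T * χ' * χ ∈ sandwichSpan A T D := by
    have h1 : ∀ χ ∈ ({1, T, D, D * T} : Set R), T * χ ∈ sandwichSpan A T D := by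
      rintro χ (rfl | rfl | rfl | rfl)
      · simpa using left_mem_sandwichSpan
      all_goals assumption
    have h2 : ∀ χ ∈ ({1, T, D, D * T} : Set R), T * t * χ ∈ sandwichSpan A T D := by
      rintro χ (rfl | rfl | rfl | rfl)
      · rw [mul_one]
        exact mul_right_mem_sandwichSpan ht left_mem_sandwichSpan
      all_goals assumption
    have h3 : ∀ y ∈ sandwichSpan A T D, x₀ * (D * y) ∈ sandwichSpan A T D := fun y hy =>
      mul_left_mem_sandwichSpan hx₀ (right_mul_mem_sandwichSpan hDD hDA hy)
    rintro χ' (rfl | rfl | rfl | rfl) χ hχ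
    · simpa using h1 χ hχ
    · exact h2 χ hχ
    · rw [hTd]
      simpa only [mul_assoc] using h3 _ (h1 χ hχ)
    · rw [← mul_assoc T, hTd]
      simpa only [mul_assoc] using h3 _ (h2 χ hχ)
  have hcomm : ∀ b ∈ B, ∀ χ ∈ ({1, T, D, D * T} : Set R), ∃ b' ∈ B, b * χ = χ * b' := by
    rintro b hb χ (rfl | rfl | rfl | rfl)
    · exact ⟨b, hb, by simp⟩
    · exact ⟨b, hb, hBT b hb⟩
    · exact hBD b hb
    · obtain ⟨b', hb', h⟩ := hBD b hb
      exact ⟨b', hb', by rw [← mul_assoc, h, mul_assoc, hBT b' hb', mul_assoc]⟩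
  induction hx using sandwichSpan_induction with
  | zero => simp
  | add x y _ _ hx hy => rw [mul_add]; exact add_mem hx hy
  | smul c x _ hx => rw [mul_smul_comm]; exact Submodule.smul_mem _ _ hx
  | mul a b χ ha hb hχ =>
    rw [← mul_assoc]
    refine mul_right_mem_sandwichSpan hb ?_
    have ha' := hA a ha
    clear ha
    induction ha' using sandwichSpan_induction with
    | zero => simp
    | add x y _ _ hx hy => rw [add_mul, mul_add]; exact add_mem hx hy
    | smul c x _ hx =>
      rw [smul_mul_assoc, mul_smul_comm]; exact Submodule.smul_mem _ _ hx
    | mul b₁ b₂ χ' hb₁ hb₂ hχ' =>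
      obtain ⟨b₃, hb₃, h⟩ := hcomm b₂ hb₂ χ hχ
      have e : T * (b₁ * χ' * b₂ * χ) = b₁ * (T * χ' * χ) * b₃ := by
        rw [mul_assoc (b₁ * χ'), h, ← mul_assoc T, ← mul_assoc T, ← hBT b₁ hb₁]
        simp only [mul_assoc]
      rw [e]
      exact mul_right_mem_sandwichSpan (hBA hb₃)
        (mul_left_mem_sandwichSpan (hBA hb₁) (hmid χ' hχ' χ hχ))

theorem adjoin_le_sandwichSpan {s : Set R}
    (hs : ∀ x ∈ s, ∀ y ∈ sandwichSpan A T D, x * y ∈ sandwichSpan A T D) {x : R}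
    (hx : x ∈ Algebra.adjoin ℂ s) : x ∈ sandwichSpan A T D := by
  suffices h : ∀ y ∈ sandwichSpan A T D, x * y ∈ sandwichSpan A T D by
    simpa using h 1 (le_sandwichSpan A.one_mem)
  induction hx using Algebra.adjoin_induction with
  | mem x hx => exact hs x hx
  | algebraMap c =>
    intro y hy
    rw [← Algebra.smul_def]
    exact Submodule.smul_mem _ _ hy
  | add x x' _ _ hx hx' =>
    intro y hy
    rw [add_mul]
    exact add_mem (hx y hy) (hx' y hy)
  | mul x x' _ _ hx hx' =>
    intro y hy
    rw [mul_assoc]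
    exact hx _ (hx' y hy)

theorem exists_mul_eq_mul_of_mem_adjoin {s : Set R}
    (h : ∀ x ∈ s, ∃ y ∈ Algebra.adjoin ℂ s, D * x = y * D) {x : R}
    (hx : x ∈ Algebra.adjoin ℂ s) : ∃ y ∈ Algebra.adjoin ℂ s, D * x = y * D := by
  induction hx using Algebra.adjoin_induction with
  | mem x hx => exact h x hx
  | algebraMap c => exact ⟨_, Subalgebra.algebraMap_mem _ c, (Algebra.commutes c D).symm⟩
  | add x x' _ _ hx hx' =>
    obtain ⟨y, hy, e⟩ := hx
    obtain ⟨y', hy', e'⟩ := hx'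
    exact ⟨y + y', add_mem hy hy', by rw [mul_add, e, e', add_mul]⟩
  | mul x x' _ _ hx hx' =>
    obtain ⟨y, hy, e⟩ := hx
    obtain ⟨y', hy', e'⟩ := hx'
    exact ⟨y * y', mul_mem hy hy', by rw [← mul_assoc, e, mul_assoc, e', mul_assoc]⟩

theorem exists_mul_eq_mul_of_mem_adjoin' {s : Set R}
    (h : ∀ x ∈ s, ∃ y ∈ Algebra.adjoin ℂ s, x * D = D * y) {x : R}
    (hx : x ∈ Algebra.adjoin ℂ s) : ∃ y ∈ Algebra.adjoin ℂ s, x * D = D * y := by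
  induction hx using Algebra.adjoin_induction with
  | mem x hx => exact h x hx
  | algebraMap c => exact ⟨_, Subalgebra.algebraMap_mem _ c, Algebra.commutes c D⟩
  | add x x' _ _ hx hx' =>
    obtain ⟨y, hy, e⟩ := hx
    obtain ⟨y', hy', e'⟩ := hx'
    exact ⟨y + y', add_mem hy hy', by rw [mul_add, add_mul, e, e']⟩
  | mul x x' _ _ hx hx' =>
    obtain ⟨y, hy, e⟩ := hx
    obtain ⟨y', hy', e'⟩ := hx'
    exact ⟨y * y', mul_mem hy hy', by rw [mul_assoc, e', ← mul_assoc, e, mul_assoc]⟩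

theorem mul_comm_of_mem_adjoin {s : Set R} {z : R} (h : ∀ x ∈ s, x * z = z * x) {x : R}
    (hx : x ∈ Algebra.adjoin ℂ s) : x * z = z * x := by
  induction hx using Algebra.adjoin_induction with
  | mem x hx => exact h x hx
  | algebraMap c => exact Algebra.commutes c z
  | add x x' _ _ hx hx' => rw [add_mul, mul_add, hx, hx']
  | mul x x' _ _ hx hx' => rw [mul_assoc, hx', ← mul_assoc, hx, mul_assoc]

end Sandwich

section Relations

variable {R : Type*} [Ring R] [Algebra ℂ R]

/-- Sequences `t`, `v` in an algebra satisfying the Hecke–Clifford relations up to index `N`,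
where `t k` relates `v (k - 1)` and `v k`, and `t 0 = 0`. -/
structure HeckeCliffordSeq (c : ℂ) (N : ℕ) (t v : ℕ → R) : Prop where
  t_zero : t 0 = 0
  braid (i : ℕ) : t i * t (i + 1) * t i = t (i + 1) * t i * t (i + 1)
  tcomm (i j : ℕ) (h : i + 2 ≤ j) : t i * t j = t j * t i
  quad (i : ℕ) (h : i + 1 < N) : t (i + 1) * t (i + 1) = 1 + c • t (i + 1)
  vsq (j : ℕ) (h : j < N) : v j * v j = 1
  vanti (j k : ℕ) (h : j ≠ k) : v j * v k = -(v k * v j)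
  tv_left (i : ℕ) : t (i + 1) * v i = v (i + 1) * t (i + 1)
  tv_right (i : ℕ) (h : i + 1 < N) :
    t (i + 1) * v (i + 1) = v i * t (i + 1) - c • (v i - v (i + 1))
  tvcomm (i l : ℕ) (h : l ≠ i) (h' : l + 1 ≠ i) : t i * v l = v l * t i

/-- The sequence `e (k + 1) = v k * v (k + 1)`, with `e 0 = 0`. -/
def evenSeq (v : ℕ → R) : ℕ → R
  | 0 => 0
  | k + 1 => v k * v (k + 1)

/-- The subalgebra generated by the first `k` terms of two sequences. -/
def seqSubalgebra (t d : ℕ → R) (k : ℕ) : Subalgebra ℂ R :=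
  Algebra.adjoin ℂ (t '' Set.Iio k ∪ d '' Set.Iio k)

theorem fst_mem_seqSubalgebra {t d : ℕ → R} {i k : ℕ} (h : i < k) : t i ∈ seqSubalgebra t d k :=
  Algebra.subset_adjoin (Or.inl ⟨i, h, rfl⟩)

theorem snd_mem_seqSubalgebra {t d : ℕ → R} {i k : ℕ} (h : i < k) : d i ∈ seqSubalgebra t d k :=
  Algebra.subset_adjoin (Or.inr ⟨i, h, rfl⟩)

theorem seqSubalgebra_le_succ (t d : ℕ → R) (k : ℕ) :
    seqSubalgebra t d k ≤ seqSubalgebra t d (k + 1) :=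
  Algebra.adjoin_mono (Set.union_subset_union (Set.image_mono (Set.Iio_subset_Iio k.le_succ))
    (Set.image_mono (Set.Iio_subset_Iio k.le_succ)))

theorem seqSubalgebra_succ_le_sandwichSpan {t d : ℕ → R} {k : ℕ}
    (ht : ∀ y ∈ sandwichSpan (seqSubalgebra t d k) (t k) (d k),
      t k * y ∈ sandwichSpan (seqSubalgebra t d k) (t k) (d k))
    (hd : ∀ y ∈ sandwichSpan (seqSubalgebra t d k) (t k) (d k),
      d k * y ∈ sandwichSpan (seqSubalgebra t d k) (t k) (d k)) {x : R}
    (hx : x ∈ seqSubalgebra t d (k + 1)) :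
    x ∈ sandwichSpan (seqSubalgebra t d k) (t k) (d k) := by
  refine adjoin_le_sandwichSpan ?_ hx
  rintro _ (⟨i, hi, rfl⟩ | ⟨i, hi, rfl⟩) y hy
  · rcases Nat.lt_succ_iff_lt_or_eq.1 hi with h | rfl
    · exact mul_left_mem_sandwichSpan (fst_mem_seqSubalgebra h) hy
    · exact ht y hy
  · rcases Nat.lt_succ_iff_lt_or_eq.1 hi with h | rfl
    · exact mul_left_mem_sandwichSpan (snd_mem_seqSubalgebra h) hy
    · exact hd y hy

namespace HeckeCliffordSeq

variable {c : ℂ} {N : ℕ} {t v : ℕ → R}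

theorem v_mul_mem (H : HeckeCliffordSeq c N t v) {k : ℕ} {x : R}
    (hx : x ∈ seqSubalgebra t v k) : ∃ y ∈ seqSubalgebra t v k, v k * x = y * v k := by
  refine exists_mul_eq_mul_of_mem_adjoin ?_ hx
  rintro _ (⟨i, hi, rfl⟩ | ⟨i, hi, rfl⟩) <;> rw [Set.mem_Iio] at hi
  · exact ⟨t i, fst_mem_seqSubalgebra hi, (H.tvcomm i k (by lia) (by lia)).symm⟩
  · exact ⟨-v i, neg_mem (snd_mem_seqSubalgebra hi), by rw [H.vanti k i (by lia), neg_mul]⟩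

theorem mem_mul_v (H : HeckeCliffordSeq c N t v) {k l : ℕ} (hkl : k ≤ l) {x : R}
    (hx : x ∈ seqSubalgebra t v k) : ∃ y ∈ seqSubalgebra t v k, x * v l = v l * y := by
  refine exists_mul_eq_mul_of_mem_adjoin' ?_ hx
  rintro _ (⟨i, hi, rfl⟩ | ⟨i, hi, rfl⟩) <;> rw [Set.mem_Iio] at hi
  · exact ⟨t i, fst_mem_seqSubalgebra hi, H.tvcomm i l (by lia) (by lia)⟩
  · exact ⟨-v i, neg_mem (snd_mem_seqSubalgebra hi), by rw [H.vanti i l (by lia), mul_neg]⟩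

theorem mem_mul_t (H : HeckeCliffordSeq c N t v) {k : ℕ} {x : R}
    (hx : x ∈ seqSubalgebra t v k) : x * t (k + 1) = t (k + 1) * x := by
  refine mul_comm_of_mem_adjoin ?_ hx
  rintro _ (⟨i, hi, rfl⟩ | ⟨i, hi, rfl⟩) <;> rw [Set.mem_Iio] at hi
  · exact H.tcomm i (k + 1) (by lia)
  · exact (H.tvcomm (k + 1) i (by lia) (by lia)).symm

theorem seqSubalgebra_succ_le (H : HeckeCliffordSeq c N t v) {k : ℕ} (hk : k < N) {x : R}
    (hx : x ∈ seqSubalgebra t v (k + 1)) :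
    x ∈ sandwichSpan (seqSubalgebra t v k) (t k) (v k) := by
  have hvv (j : ℕ) (hj : j < N) (A : Subalgebra ℂ R) : v j * v j ∈ A := by
    rw [H.vsq j hj]; exact A.one_mem
  induction k generalizing x with
  | zero =>
    refine seqSubalgebra_succ_le_sandwichSpan (fun y _ => by simp [H.t_zero])
      (fun y => right_mul_mem_sandwichSpan (hvv 0 hk _) fun a => H.v_mul_mem) hx
  | succ m ih =>
    set S := sandwichSpan (seqSubalgebra t v (m + 1)) (t (m + 1)) (v (m + 1))
    have hT : t (m + 1) ∈ S := left_mem_sandwichSpan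
    have hV : v (m + 1) ∈ S := right_mem_sandwichSpan
    have hVT : v (m + 1) * t (m + 1) ∈ S := mul_mem_sandwichSpan
    have ht : t m ∈ seqSubalgebra t v (m + 1) := fst_mem_seqSubalgebra m.lt_succ_self
    have hv : v m ∈ seqSubalgebra t v (m + 1) := snd_mem_seqSubalgebra m.lt_succ_self
    have hvS : v m ∈ S := le_sandwichSpan hv
    have htV : t m * v (m + 1) = v (m + 1) * t m := H.tvcomm m (m + 1) (by lia) (by lia)
    have hTT : t (m + 1) * t (m + 1) ∈ S := by
      rw [H.quad m hk]
      exact add_mem (le_sandwichSpan (one_mem _)) (S.smul_mem _ hT)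
    have hTV : t (m + 1) * v (m + 1) ∈ S := by
      rw [H.tv_right m hk]
      exact sub_mem (mul_left_mem_sandwichSpan hv hT) (S.smul_mem _ (sub_mem hvS hV))
    have hTtT : t (m + 1) * t m * t (m + 1) ∈ S := by
      rw [← H.braid m]
      exact mul_right_mem_sandwichSpan ht (mul_left_mem_sandwichSpan ht hT)
    refine seqSubalgebra_succ_le_sandwichSpan (fun y => left_mul_mem_sandwichSpan
      (x₀ := 1) (seqSubalgebra_le_succ t v m) ht (fun a => ih (by lia)) (hvv _ hk _)
      (fun a => H.v_mul_mem) (fun a => H.mem_mul_t) (fun a => H.mem_mul_v m.le_succ) (one_mem _)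
      (by rw [one_mul, H.tv_left]) hTT hTV ?_ hTtT ?_ ?_)
      (fun y => right_mul_mem_sandwichSpan (hvv _ hk _) fun a => H.v_mul_mem) hx
    · rw [← mul_assoc, H.tv_right m hk, sub_mul, smul_mul_assoc, sub_mul, mul_assoc]
      exact sub_mem (mul_left_mem_sandwichSpan hv hTT)
        (S.smul_mem _ (sub_mem (mul_left_mem_sandwichSpan hv hT) hVT))
    · rw [mul_assoc, htV, ← mul_assoc]
      exact mul_right_mem_sandwichSpan ht hTV
    · have e : t (m + 1) * t m * (v (m + 1) * t (m + 1)) =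
          v m * (t (m + 1) * t m * t (m + 1)) -
            c • (v m * (t m * t (m + 1)) - t m * (v (m + 1) * t (m + 1))) := by
        rw [mul_assoc, ← mul_assoc (t m), htV, ← mul_assoc, ← mul_assoc, H.tv_right m hk]
        simp only [sub_mul, smul_mul_assoc, mul_assoc]
      rw [e]
      exact sub_mem (mul_left_mem_sandwichSpan hv hTtT)
        (S.smul_mem _ (sub_mem (mul_left_mem_sandwichSpan hv (mul_left_mem_sandwichSpan ht hT))
          (mul_left_mem_sandwichSpan ht hVT)))

theorem t_mul_v_mul_v (H : HeckeCliffordSeq c N t v) {i j k : ℕ} (hj : j ≠ i) (hj' : j + 1 ≠ i)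
    (hk : k ≠ i) (hk' : k + 1 ≠ i) : t i * (v j * v k) = v j * v k * t i := by
  rw [← mul_assoc, H.tvcomm i j hj hj', mul_assoc, H.tvcomm i k hk hk', mul_assoc]

theorem v_mul_v_mul_v_mul_v (H : HeckeCliffordSeq c N t v) {i j k l : ℕ} (hik : i ≠ k)
    (hil : i ≠ l) (hjk : j ≠ k) (hjl : j ≠ l) :
    v i * v j * (v k * v l) = v k * v l * (v i * v j) := by
  have h (a b c : ℕ) (hb : a ≠ b) (hc : a ≠ c) : v a * (v b * v c) = v b * v c * v a := by
    rw [← mul_assoc, H.vanti a b hb, neg_mul, mul_assoc, H.vanti a c hc, mul_neg, neg_neg,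
      mul_assoc]
  rw [mul_assoc, h j k l hjk hjl, ← mul_assoc, h i k l hik hil, mul_assoc]

theorem evenSeq_mul_self (H : HeckeCliffordSeq c N t v) {k : ℕ} (hk : k + 1 < N) :
    evenSeq v (k + 1) * evenSeq v (k + 1) = -1 := by
  change v k * v (k + 1) * (v k * v (k + 1)) = -1
  rw [mul_assoc, ← mul_assoc (v (k + 1)), H.vanti (k + 1) k (by lia), neg_mul, mul_assoc,
    H.vsq _ hk, mul_one, mul_neg, H.vsq _ (by lia)]

theorem evenSeq_mul_t (H : HeckeCliffordSeq c N t v) {k : ℕ} (hk : k + 2 < N) :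
    evenSeq v (k + 2) * t (k + 1) =
      t (k + 1) * evenSeq v (k + 1) * evenSeq v (k + 2) := by
  change v (k + 1) * v (k + 2) * t (k + 1) =
    t (k + 1) * (v k * v (k + 1)) * (v (k + 1) * v (k + 2))
  rw [mul_assoc, ← H.tvcomm (k + 1) (k + 2) (by lia) (by lia), ← mul_assoc, ← H.tv_left]
  simp only [mul_assoc]
  rw [← mul_assoc (v (k + 1)), H.vsq _ (by lia), one_mul]

theorem evenSeq_anti (H : HeckeCliffordSeq c N t v) {k : ℕ} :
    evenSeq v (k + 2) * evenSeq v (k + 1) = -evenSeq v (k + 1) * evenSeq v (k + 2) := by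
  change v (k + 1) * v (k + 2) * (v k * v (k + 1)) = -(v k * v (k + 1)) * (v (k + 1) * v (k + 2))
  rw [mul_assoc, ← mul_assoc (v (k + 2)), H.vanti (k + 2) k (by lia), neg_mul, mul_neg,
    mul_assoc, H.vanti (k + 2) (k + 1) (by lia), mul_neg, mul_neg, neg_neg, ← mul_assoc,
    H.vanti (k + 1) k (by lia), neg_mul, mul_assoc]

theorem mem_mul_evenSeq (H : HeckeCliffordSeq c N t v) {k : ℕ} {x : R}
    (hx : x ∈ seqSubalgebra t (evenSeq v) k) :
    x * evenSeq v (k + 1) = evenSeq v (k + 1) * x := by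
  refine mul_comm_of_mem_adjoin ?_ hx
  rintro _ (⟨i, hi, rfl⟩ | ⟨i, hi, rfl⟩) <;> rw [Set.mem_Iio] at hi
  · exact H.t_mul_v_mul_v (by lia) (by lia) (by lia) (by lia)
  · cases i with
    | zero => simp [evenSeq]
    | succ i => exact H.v_mul_v_mul_v_mul_v (by lia) (by lia) (by lia) (by lia)

theorem even_mem_mul_t (H : HeckeCliffordSeq c N t v) {k : ℕ} {x : R}
    (hx : x ∈ seqSubalgebra t (evenSeq v) k) : x * t (k + 1) = t (k + 1) * x := by
  refine mul_comm_of_mem_adjoin ?_ hx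
  rintro _ (⟨i, hi, rfl⟩ | ⟨i, hi, rfl⟩) <;> rw [Set.mem_Iio] at hi
  · exact H.tcomm i (k + 1) (by lia)
  · cases i with
    | zero => simp [evenSeq]
    | succ i => exact (H.t_mul_v_mul_v (by lia) (by lia) (by lia) (by lia)).symm

theorem evenSeq_mul_mem (H : HeckeCliffordSeq c N t v) {k : ℕ} (hk : k < N) {x : R}
    (hx : x ∈ seqSubalgebra t (evenSeq v) k) :
    ∃ y ∈ seqSubalgebra t (evenSeq v) k, evenSeq v k * x = y * evenSeq v k := by
  obtain _ | k := k
  · exact ⟨x, hx, by simp [evenSeq]⟩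
  refine exists_mul_eq_mul_of_mem_adjoin ?_ hx
  rintro _ (⟨i, hi, rfl⟩ | ⟨i, hi, rfl⟩)
  · rcases Nat.lt_succ_iff_lt_or_eq.1 hi with h | rfl
    · exact ⟨t i, fst_mem_seqSubalgebra hi, (H.mem_mul_evenSeq (fst_mem_seqSubalgebra h)).symm⟩
    · cases i with
      | zero => exact ⟨0, zero_mem _, by simp [H.t_zero]⟩
      | succ i =>
        exact ⟨_, mul_mem (fst_mem_seqSubalgebra hi) (snd_mem_seqSubalgebra hi),
          H.evenSeq_mul_t hk⟩
  · rcases Nat.lt_succ_iff_lt_or_eq.1 hi with h | rfl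
    · exact ⟨evenSeq v i, snd_mem_seqSubalgebra hi,
        (H.mem_mul_evenSeq (snd_mem_seqSubalgebra h)).symm⟩
    · cases i with
      | zero => exact ⟨0, zero_mem _, by simp [evenSeq]⟩
      | succ i => exact ⟨_, neg_mem (snd_mem_seqSubalgebra hi), H.evenSeq_anti⟩

theorem t_mul_evenSeq (H : HeckeCliffordSeq c N t v) {k : ℕ} (hk : k + 1 < N) :
    t (k + 1) * evenSeq v (k + 1) =
      c • 1 + c • evenSeq v (k + 1) - evenSeq v (k + 1) * t (k + 1) := by
  change t (k + 1) * (v k * v (k + 1)) =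
    c • 1 + c • (v k * v (k + 1)) - v k * v (k + 1) * t (k + 1)
  rw [← mul_assoc, H.tv_left, mul_assoc, H.tv_right k hk, mul_sub, mul_smul_comm, mul_sub,
    H.vsq _ hk, ← mul_assoc, H.vanti (k + 1) k (by lia), neg_mul, smul_sub, smul_neg]
  abel

theorem t_mul_evenSeq_succ (H : HeckeCliffordSeq c N t v) {k : ℕ} (hk : k + 2 < N) :
    t (k + 1) * evenSeq v (k + 2) =
      evenSeq v (k + 1) * evenSeq v (k + 2) * t (k + 1)
        - c • (evenSeq v (k + 1) * evenSeq v (k + 2)) + c • evenSeq v (k + 2) := by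
  have h : evenSeq v (k + 1) * evenSeq v (k + 2) = v k * v (k + 2) := by
    change v k * v (k + 1) * (v (k + 1) * v (k + 2)) = _
    rw [mul_assoc, ← mul_assoc (v (k + 1)), H.vsq _ (by lia), one_mul]
  rw [h]
  change t (k + 1) * (v (k + 1) * v (k + 2)) = v k * v (k + 2) * t (k + 1)
        - c • (v k * v (k + 2)) + c • (v (k + 1) * v (k + 2))
  rw [← mul_assoc, H.tv_right k (by lia), sub_mul, mul_assoc,
    H.tvcomm (k + 1) (k + 2) (by lia) (by lia), smul_mul_assoc, sub_mul, smul_sub, mul_assoc]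
  abel

theorem t_succ_mul_evenSeq (H : HeckeCliffordSeq c N t v) {k : ℕ} (hk : k + 2 < N) :
    t (k + 2) * evenSeq v (k + 1) = evenSeq v (k + 1) * evenSeq v (k + 2) * t (k + 2) := by
  change t (k + 2) * (v k * v (k + 1)) = v k * v (k + 1) * (v (k + 1) * v (k + 2)) * t (k + 2)
  rw [← mul_assoc, H.tvcomm (k + 2) k (by lia) (by lia), mul_assoc, H.tv_left]
  simp only [mul_assoc]
  rw [← mul_assoc (v (k + 1)) (v (k + 1)), H.vsq _ (by lia), one_mul]

theorem even_seqSubalgebra_succ_le (H : HeckeCliffordSeq c N t v) {k : ℕ} (hk : k < N) {x : R}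
    (hx : x ∈ seqSubalgebra t (evenSeq v) (k + 1)) :
    x ∈ sandwichSpan (seqSubalgebra t (evenSeq v) k) (t k) (evenSeq v k) := by
  have hEE (j : ℕ) (hj : j < N) (A : Subalgebra ℂ R) : evenSeq v j * evenSeq v j ∈ A := by
    cases j with
    | zero => simp [evenSeq]
    | succ j => rw [H.evenSeq_mul_self hj]; exact neg_mem A.one_mem
  induction k generalizing x with
  | zero =>
    exact seqSubalgebra_succ_le_sandwichSpan (fun y _ => by simp [H.t_zero])
      (fun y _ => by simp [evenSeq]) hx
  | succ m ih =>
    set S := sandwichSpan (seqSubalgebra t (evenSeq v) (m + 1)) (t (m + 1)) (evenSeq v (m + 1))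
     
    have hT : t (m + 1) ∈ S := left_mem_sandwichSpan
    have hE : evenSeq v (m + 1) ∈ S := right_mem_sandwichSpan
    have hET : evenSeq v (m + 1) * t (m + 1) ∈ S := mul_mem_sandwichSpan
    have ht : t m ∈ seqSubalgebra t (evenSeq v) (m + 1) := fst_mem_seqSubalgebra m.lt_succ_self
    have he : evenSeq v m ∈ seqSubalgebra t (evenSeq v) (m + 1) :=
      snd_mem_seqSubalgebra m.lt_succ_self
    have hl {a y : R} (ha : a ∈ seqSubalgebra t (evenSeq v) (m + 1)) (hy : y ∈ S) : a * y ∈ S :=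
      mul_left_mem_sandwichSpan ha hy
    have hr {b y : R} (hb : b ∈ seqSubalgebra t (evenSeq v) (m + 1)) (hy : y ∈ S) : y * b ∈ S :=
      mul_right_mem_sandwichSpan hb hy
    have hEl {y : R} (hy : y ∈ S) : evenSeq v (m + 1) * y ∈ S :=
      right_mul_mem_sandwichSpan (hEE _ hk _) (fun a => H.evenSeq_mul_mem hk) hy
    have h1 : (1 : R) ∈ S := le_sandwichSpan (one_mem _)
    have hTT : t (m + 1) * t (m + 1) ∈ S := by
      rw [H.quad m hk]
      exact add_mem h1 (S.smul_mem _ hT)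
    have hTE : t (m + 1) * evenSeq v (m + 1) ∈ S := by
      rw [H.t_mul_evenSeq hk]
      exact sub_mem (add_mem (S.smul_mem _ h1) (S.smul_mem _ hE)) hET
    have hTET : t (m + 1) * (evenSeq v (m + 1) * t (m + 1)) ∈ S := by
      rw [← mul_assoc, H.t_mul_evenSeq hk, sub_mul, add_mul, smul_mul_assoc, smul_mul_assoc,
        one_mul, mul_assoc]
      exact sub_mem (add_mem (S.smul_mem _ hT) (S.smul_mem _ hET)) (hEl hTT)
    have hTtT : t (m + 1) * t m * t (m + 1) ∈ S := by
      rw [← H.braid m]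
      exact hr ht (hl ht hT)
    refine seqSubalgebra_succ_le_sandwichSpan (fun y => left_mul_mem_sandwichSpan
      (x₀ := evenSeq v m) (seqSubalgebra_le_succ t _ m) ht (fun a => ih (by lia)) (hEE _ hk _)
      (fun a => H.evenSeq_mul_mem hk) (fun a => H.even_mem_mul_t)
      (fun a ha => ⟨a, ha, H.mem_mul_evenSeq ha⟩) he ?_ hTT hTE hTET hTtT ?_ ?_)
      (fun y => hEl) hx
    · cases m with
      | zero =>
        simp [evenSeq]
      | succ m => exact H.t_succ_mul_evenSeq hk
    · cases m with
      | zero => simp [H.t_zero]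
      | succ m =>
        rw [mul_assoc, H.t_mul_evenSeq_succ hk, mul_add, mul_sub, mul_smul_comm, mul_smul_comm,
          ← mul_assoc]
        have h : t (m + 2) * (evenSeq v (m + 1) * evenSeq v (m + 2)) ∈ S := by
          rw [← mul_assoc, H.t_succ_mul_evenSeq hk, mul_assoc, mul_assoc]
          exact hl he (hEl hTE)
        exact add_mem (sub_mem (hr ht h) (S.smul_mem _ h)) (S.smul_mem _ hTE)
    · cases m with
      | zero => simp [H.t_zero]
      | succ m =>
        have h {y : R} (hy : t (m + 2) * evenSeq v (m + 2) * y ∈ S) :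
            t (m + 2) * (evenSeq v (m + 1) * evenSeq v (m + 2)) * y ∈ S := by
          rw [← mul_assoc, H.t_succ_mul_evenSeq hk, mul_assoc, mul_assoc, mul_assoc,
            ← mul_assoc (t (m + 2))]
          exact hl he (hEl hy)
        have h' : t (m + 2) * evenSeq v (m + 2) * (t (m + 1) * t (m + 2)) ∈ S := by
          rw [H.t_mul_evenSeq hk, sub_mul, add_mul, smul_mul_assoc, smul_mul_assoc, one_mul,
            mul_assoc, ← mul_assoc (t (m + 2))]
          exact sub_mem (add_mem (S.smul_mem _ (hl ht hT)) (S.smul_mem _ (hEl (hl ht hT))))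
            (hEl hTtT)
        have e : t (m + 2) * t (m + 1) * (evenSeq v (m + 2) * t (m + 2)) =
            t (m + 2) * (evenSeq v (m + 1) * evenSeq v (m + 2)) * (t (m + 1) * t (m + 2)) -
              c • (t (m + 2) * (evenSeq v (m + 1) * evenSeq v (m + 2)) * t (m + 2)) +
              c • (t (m + 2) * (evenSeq v (m + 2) * t (m + 2))) := by
          rw [mul_assoc, ← mul_assoc (t (m + 1)), H.t_mul_evenSeq_succ hk]
          simp only [add_mul, sub_mul, mul_add, mul_sub, smul_mul_assoc, mul_smul_comm, mul_assoc]
        rw [e]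
        refine add_mem (sub_mem (h h') (S.smul_mem _ (h ?_))) (S.smul_mem _ hTET)
        rwa [mul_assoc]

end HeckeCliffordSeq

end Relations

section Generators

/-- The generators `t` of `G_N(q)` as a sequence, indexed from `1` and extended by zero. -/
noncomputable def tSeq (q : ℂ) (N k : ℕ) : HeckeClifford q N :=
  if h : 1 ≤ k ∧ k < N then HCt q N ⟨k - 1, by lia⟩ else 0

/-- The generators `v` of `G_N(q)` as a sequence extended by zero. -/
noncomputable def vSeq (q : ℂ) (N k : ℕ) : HeckeClifford q N :=
  if h : k < N then HCv q N ⟨k, h⟩ else 0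

variable {q : ℂ} {N : ℕ}

theorem tSeq_succ {k : ℕ} (h : k < N - 1) : tSeq q N (k + 1) = HCt q N ⟨k, h⟩ :=
  dif_pos ⟨by lia, by lia⟩

theorem vSeq_eq {k : ℕ} (h : k < N) : vSeq q N k = HCv q N ⟨k, h⟩ := dif_pos h

theorem tSeq_zero : tSeq q N 0 = 0 := by simp [tSeq]

theorem tSeq_eq_zero {k : ℕ} (h : ¬ k < N) : tSeq q N k = 0 := by simp [tSeq, h]

theorem vSeq_eq_zero {k : ℕ} (h : ¬ k < N) : vSeq q N k = 0 := by simp [vSeq, h]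

theorem evenSeq_vSeq_succ {k : ℕ} (h : k < N - 1) :
    evenSeq (vSeq q N) (k + 1) = HCe q N ⟨k, h⟩ := by
  simp only [evenSeq, HCe]
  rw [vSeq_eq (by lia), vSeq_eq (by lia)]

theorem heckeCliffordSeq_tSeq_vSeq (q : ℂ) (N : ℕ) :
    HeckeCliffordSeq (q - q⁻¹) N (tSeq q N) (vSeq q N) where
  t_zero := tSeq_zero
  braid i := by
    obtain _ | i := i
    · simp [tSeq_zero]
    by_cases h : i + 2 < N
    · rw [tSeq_succ (by lia), tSeq_succ (by lia)]
      simpa [HCt] using RingQuot.mkAlgHom_rel ℂ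
        (HCrel.braid (q := q) (⟨i, by lia⟩ : Fin (N - 1)) ⟨i + 1, by lia⟩ rfl)
    · simp [tSeq_eq_zero h]
  tcomm i j hij := by
    obtain _ | i := i
    · simp [tSeq_zero]
    obtain _ | j := j
    · simp [tSeq_zero]
    by_cases h : j + 1 < N
    · rw [tSeq_succ (by lia), tSeq_succ (by lia)]
      simpa [HCt] using RingQuot.mkAlgHom_rel ℂ
        (HCrel.tcomm (q := q) (⟨i, by lia⟩ : Fin (N - 1)) ⟨j, by lia⟩ (Or.inl (by simp; lia)))
    · simp [tSeq_eq_zero h]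
  quad i h := by
    rw [tSeq_succ (by lia)]
    simpa only [HCt, map_mul, map_add, map_one, map_smul] using RingQuot.mkAlgHom_rel ℂ
      (HCrel.quad (q := q) (⟨i, by lia⟩ : Fin (N - 1)))
  vsq j h := by
    rw [vSeq_eq h]
    simpa [HCv] using RingQuot.mkAlgHom_rel ℂ (HCrel.vsq (q := q) (⟨j, h⟩ : Fin N))
  vanti j k hjk := by
    by_cases hj : j < N
    · by_cases hk : k < N
      · rw [vSeq_eq hj, vSeq_eq hk]
        simpa [HCv] using RingQuot.mkAlgHom_rel ℂ
          (HCrel.vanti (q := q) (⟨j, hj⟩ : Fin N) ⟨k, hk⟩ (by simpa using hjk))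
      · simp [vSeq_eq_zero hk]
    · simp [vSeq_eq_zero hj]
  tv_left i := by
    by_cases h : i + 1 < N
    · rw [tSeq_succ (by lia), vSeq_eq (k := i) (by lia), vSeq_eq h]
      simpa [HCt, HCv] using RingQuot.mkAlgHom_rel ℂ
        (HCrel.tv₁ (q := q) (⟨i, by lia⟩ : Fin (N - 1)) ⟨i, by lia⟩ ⟨i + 1, h⟩ rfl rfl)
    · simp [tSeq_eq_zero h]
  tv_right i h := by
    rw [tSeq_succ (by lia), vSeq_eq (k := i) (by lia), vSeq_eq h]
    simpa only [HCt, HCv, map_mul, map_sub, map_smul] using RingQuot.mkAlgHom_rel ℂ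
      (HCrel.tv₂ (q := q) (⟨i, by lia⟩ : Fin (N - 1)) ⟨i, by lia⟩ ⟨i + 1, h⟩ rfl rfl)
  tvcomm i l hl hl' := by
    obtain _ | i := i
    · simp [tSeq_zero]
    by_cases hi : i + 1 < N
    · by_cases h : l < N
      · rw [tSeq_succ (by lia), vSeq_eq h]
        simpa [HCt, HCv] using RingQuot.mkAlgHom_rel ℂ
          (HCrel.tvcomm (q := q) (⟨i, by lia⟩ : Fin (N - 1)) ⟨l, h⟩ ⟨by simp; lia, by simp; lia⟩)
      · simp [vSeq_eq_zero h]
    · simp [tSeq_eq_zero hi]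

theorem adjoin_HCt_HCv (q : ℂ) (N : ℕ) :
    Algebra.adjoin ℂ (Set.range (HCt q N) ∪ Set.range (HCv q N)) = ⊤ := by
  have h : Set.range (HCt q N) ∪ Set.range (HCv q N) =
      RingQuot.mkAlgHom ℂ (HCrel q N) '' Set.range (FreeAlgebra.ι ℂ) := by
    rw [← Set.range_comp, ← Set.Sum.elim_range]
    congr 1
    ext (i | j) <;> rfl
  rw [h, ← AlgHom.map_adjoin, FreeAlgebra.adjoin_range_ι, Algebra.map_top,
    AlgHom.range_eq_top]
  exact RingQuot.mkAlgHom_surjective ℂ _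

theorem HCt_mem_seqSubalgebra (d : ℕ → HeckeClifford q N) (i : Fin (N - 1)) :
    HCt q N i ∈ seqSubalgebra (tSeq q N) d N := by
  rw [← tSeq_succ i.2]
  exact fst_mem_seqSubalgebra (by lia)

theorem HCv_mem_seqSubalgebra (j : Fin N) :
    HCv q N j ∈ seqSubalgebra (tSeq q N) (vSeq q N) N := by
  rw [← vSeq_eq j.2]
  exact snd_mem_seqSubalgebra j.2

theorem HCe_mem_seqSubalgebra (i : Fin (N - 1)) :
    HCe q N i ∈ seqSubalgebra (tSeq q N) (evenSeq (vSeq q N)) N := by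
  rw [← evenSeq_vSeq_succ i.2]
  exact snd_mem_seqSubalgebra (by lia)

theorem seqSubalgebra_eq_top (q : ℂ) (N : ℕ) :
    seqSubalgebra (tSeq q N) (vSeq q N) N = ⊤ := by
  rw [eq_top_iff, ← adjoin_HCt_HCv, Algebra.adjoin_le_iff]
  rintro _ (⟨i, rfl⟩ | ⟨j, rfl⟩)
  · exact HCt_mem_seqSubalgebra _ i
  · exact HCv_mem_seqSubalgebra j

theorem HCeven_le_seqSubalgebra (q : ℂ) (N : ℕ) :
    HCeven q N ≤ seqSubalgebra (tSeq q N) (evenSeq (vSeq q N)) N := by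
  rw [HCeven, Algebra.adjoin_le_iff]
  rintro _ (⟨i, rfl⟩ | ⟨i, rfl⟩)
  · exact HCt_mem_seqSubalgebra _ i
  · exact HCe_mem_seqSubalgebra i

theorem seqSubalgebra_le_HCsub (q : ℂ) (n : ℕ) :
    seqSubalgebra (tSeq q (n + 1)) (vSeq q (n + 1)) n ≤ HCsub q n := by
  rw [seqSubalgebra, Algebra.adjoin_le_iff]
  rintro _ (⟨i, hi, rfl⟩ | ⟨i, hi, rfl⟩) <;> rw [Set.mem_Iio] at hi
  · cases i with
    | zero => rw [tSeq_zero]; exact zero_mem _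
    | succ i =>
      rw [tSeq_succ (by lia)]
      exact Algebra.subset_adjoin (Or.inl ⟨_, by lia, rfl⟩)
  · rw [vSeq_eq (by lia)]
    exact Algebra.subset_adjoin (Or.inr ⟨_, hi, rfl⟩)

theorem seqSubalgebra_le_HCsub₀ (q : ℂ) (n : ℕ) :
    seqSubalgebra (tSeq q (n + 1)) (evenSeq (vSeq q (n + 1))) n ≤ HCsub₀ q n := by
  rw [seqSubalgebra, Algebra.adjoin_le_iff]
  rintro _ (⟨i, hi, rfl⟩ | ⟨i, hi, rfl⟩) <;> rw [Set.mem_Iio] at hi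
  · cases i with
    | zero => rw [tSeq_zero]; exact zero_mem _
    | succ i =>
      rw [tSeq_succ (by lia)]
      exact Algebra.subset_adjoin (Or.inl ⟨_, by lia, rfl⟩)
  · cases i with
    | zero => exact zero_mem _
    | succ i =>
      rw [evenSeq_vSeq_succ (by lia)]
      exact Algebra.subset_adjoin (Or.inr ⟨_, by lia, rfl⟩)

theorem HCsub₀_le_HCeven (q : ℂ) (n : ℕ) : HCsub₀ q n ≤ HCeven q (n + 1) := by
  refine Algebra.adjoin_mono (Set.union_subset_union ?_ ?_) <;>
  · rintro _ ⟨i, -, rfl⟩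
    exact ⟨i, rfl⟩

end Generators

/-- `G_{n+1}(q)` is spanned by the elements `a * χ * b` with `a, b` in the
copy of `G_n(q)` and `χ ∈ {1, t_n, v_{n+1}, v_{n+1} t_n}` (paper 1-indexing; here the
last generators are `HCt q (n+1) ⟨n-1,_⟩` and `HCv q (n+1) ⟨n,_⟩`), and similarly
`G_{n+1}[0]` is spanned by `a * χ * b` with `a, b` in the copy of `G_n[0]` and
`χ ∈ {1, t_n, e_n, e_n t_n}`. -/
theorem heckeClifford_spanning (q : ℂ) (hq : q ≠ 0) (n : ℕ) (hn : 2 ≤ n) :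
    (Submodule.span ℂ
        {x : HeckeClifford q (n + 1) |
          ∃ a ∈ HCsub q n, ∃ b ∈ HCsub q n,
            ∃ χ ∈ ({1, HCt q (n + 1) ⟨n - 1, by omega⟩, HCv q (n + 1) ⟨n, by omega⟩,
                HCv q (n + 1) ⟨n, by omega⟩ * HCt q (n + 1) ⟨n - 1, by omega⟩} :
                Set (HeckeClifford q (n + 1))),
              x = a * χ * b} = ⊤) ∧
    (Submodule.span ℂ
        {x : HeckeClifford q (n + 1) |
          ∃ a ∈ HCsub₀ q n, ∃ b ∈ HCsub₀ q n,
            ∃ χ ∈ ({1, HCt q (n + 1) ⟨n - 1, by omega⟩, HCe q (n + 1) ⟨n - 1, by omega⟩,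
                HCe q (n + 1) ⟨n - 1, by omega⟩ * HCt q (n + 1) ⟨n - 1, by omega⟩} :
                Set (HeckeClifford q (n + 1))),
              x = a * χ * b} =
      Subalgebra.toSubmodule (HCeven q (n + 1))) := by
  obtain ⟨m, rfl⟩ : ∃ m, n = m + 1 := ⟨n - 1, by lia⟩
  have H := heckeCliffordSeq_tSeq_vSeq q (m + 1 + 1)
  have hT : tSeq q (m + 1 + 1) (m + 1) = HCt q (m + 1 + 1) ⟨m, by lia⟩ := tSeq_succ (by lia)
  have hV : vSeq q (m + 1 + 1) (m + 1) = HCv q (m + 1 + 1) ⟨m + 1, by lia⟩ := vSeq_eq (by lia)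
  have hE : evenSeq (vSeq q (m + 1 + 1)) (m + 1) = HCe q (m + 1 + 1) ⟨m, by lia⟩ :=
    evenSeq_vSeq_succ (by lia)
  constructor
  · rw [eq_top_iff]
    intro x _
    have hx := H.seqSubalgebra_succ_le (x := x) (k := m + 1) (by lia)
      (by rw [seqSubalgebra_eq_top]; exact Algebra.mem_top)
    rw [hT, hV] at hx
    exact sandwichSpan_mono (seqSubalgebra_le_HCsub q (m + 1)) hx
  · refine le_antisymm (sandwichSpan_le (HCsub₀_le_HCeven q (m + 1))
      (Algebra.subset_adjoin (Or.inl ⟨_, rfl⟩)) (Algebra.subset_adjoin (Or.inr ⟨_, rfl⟩))) ?_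
    intro x hx
    replace hx := H.even_seqSubalgebra_succ_le (k := m + 1) (by lia)
      (HCeven_le_seqSubalgebra q _ hx)
    rw [hT, hE] at hx
    exact sandwichSpan_mono (seqSubalgebra_le_HCsub₀ q (m + 1)) hx
end

section
/- Assume q^{2j} ≠ 1 for 2 ≤ j ≤ n. Let p be a nonzero idempotent of G_n(q) lying in the subalgebra generated by t_1,…,t_{n−1}, and suppose either (i) t_j p = p t_j = q·p for all 1 ≤ j ≤ n−1, or (ii) t_j p = p t_j = −q^{−1}·p for all 1 ≤ j ≤ n−1. Then p is a minimal idempotent of G_n[0]: for every f ∈ G_n[0] there is a scalar c ∈ ℂ with p f p = c·p. -/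
namespace HeckeClifford

variable {q : ℂ} {n : ℕ}

/-- `mul_neg` and `neg_mul` restated because unfolding the negation of `RingQuot` is out of reach
for instance unification inside `rw` and `simp`. -/
theorem mul_neg' (x y : HeckeClifford q n) : x * -y = -(x * y) := mul_neg x y

theorem neg_mul' (x y : HeckeClifford q n) : -x * y = -(x * y) := neg_mul x y

theorem v_mul_self (j : Fin n) : HCv q n j * HCv q n j = 1 := by
  simpa [HCv] using RingQuot.mkAlgHom_rel ℂ (HCrel.vsq (q := q) j)

theorem v_anticomm {j k : Fin n} (h : j ≠ k) :
    HCv q n j * HCv q n k = -(HCv q n k * HCv q n j) := by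
  simpa [HCv] using RingQuot.mkAlgHom_rel ℂ (HCrel.vanti (q := q) j k h)

theorem t_mul_v_left (i : Fin (n - 1)) (j j' : Fin n) (hj : (j : ℕ) = i)
    (hj' : (j' : ℕ) = i + 1) : HCt q n i * HCv q n j = HCv q n j' * HCt q n i := by
  simpa [HCv, HCt] using RingQuot.mkAlgHom_rel ℂ (HCrel.tv₁ (q := q) i j j' hj hj')

theorem t_mul_v_right (i : Fin (n - 1)) (j j' : Fin n) (hj : (j : ℕ) = i)
    (hj' : (j' : ℕ) = i + 1) :
    HCt q n i * HCv q n j' =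
      HCv q n j * HCt q n i - (q - q⁻¹) • (HCv q n j - HCv q n j') := by
  simpa only [HCv, HCt, map_mul, map_sub, map_smul] using
    RingQuot.mkAlgHom_rel ℂ (HCrel.tv₂ (q := q) i j j' hj hj')

theorem t_mul_v_of_ne (i : Fin (n - 1)) (l : Fin n) (h : (l : ℕ) ≠ i ∧ (l : ℕ) ≠ i + 1) :
    HCt q n i * HCv q n l = HCv q n l * HCt q n i := by
  simpa [HCv, HCt] using RingQuot.mkAlgHom_rel ℂ (HCrel.tvcomm (q := q) i l h)

/-- The Clifford monomial attached to a list of indices. -/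
def vProd (q : ℂ) (n : ℕ) (L : List (Fin n)) : HeckeClifford q n :=
  (L.map (HCv q n)).prod

@[simp] theorem vProd_nil : vProd q n [] = 1 := rfl

@[simp] theorem vProd_cons (a : Fin n) (L : List (Fin n)) :
    vProd q n (a :: L) = HCv q n a * vProd q n L := by
  simp [vProd]

theorem vProd_append (L M : List (Fin n)) :
    vProd q n (L ++ M) = vProd q n L * vProd q n M := by
  simp [vProd]

/-- Reordering a Clifford monomial changes it at most by a sign. -/
theorem vProd_perm {L M : List (Fin n)} (h : L.Perm M) :
    vProd q n L = vProd q n M ∨ vProd q n L = -vProd q n M := by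
  induction h with
  | nil => exact .inl rfl
  | cons a _ ih => rcases ih with ih | ih <;> simp [ih, mul_neg']
  | swap a b L =>
    by_cases hab : b = a
    · subst hab; exact .inl rfl
    · right
      simp only [vProd_cons, ← mul_assoc, v_anticomm hab, neg_mul']
  | trans _ _ ih₁ ih₂ =>
    rcases ih₁ with h₁ | h₁ <;> rcases ih₂ with h₂ | h₂ <;> simp [h₁, h₂]

theorem t_mul_vProd_comm (i : Fin (n - 1)) (L : List (Fin n))
    (h : ∀ l ∈ L, (l : ℕ) ≠ i ∧ (l : ℕ) ≠ i + 1) :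
    HCt q n i * vProd q n L = vProd q n L * HCt q n i := by
  induction L with
  | nil => simp
  | cons a L ih =>
    rw [List.forall_mem_cons] at h
    rw [vProd_cons, ← mul_assoc, t_mul_v_of_ne i a h.1, mul_assoc, ih h.2, mul_assoc]

/-- The span of the Clifford monomials whose length has a given property. -/
def vSpan (q : ℂ) (n : ℕ) (P : ℕ → Prop) : Submodule ℂ (HeckeClifford q n) :=
  Submodule.span ℂ {x | ∃ L : List (Fin n), P L.length ∧ vProd q n L = x}

theorem vProd_mem_vSpan {P : ℕ → Prop} {L : List (Fin n)} (h : P L.length) :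
    vProd q n L ∈ vSpan q n P :=
  Submodule.subset_span ⟨L, h, rfl⟩

theorem vSpan_mono {P Q : ℕ → Prop} (h : ∀ k, P k → Q k) : vSpan q n P ≤ vSpan q n Q :=
  Submodule.span_mono fun _ ⟨L, hL, hx⟩ => ⟨L, h _ hL, hx⟩

theorem v_mul_mem_vSpan {k : ℕ} (a : Fin n) {x : HeckeClifford q n}
    (hx : x ∈ vSpan q n (· = k)) : HCv q n a * x ∈ vSpan q n (· = k + 1) := by
  induction hx using Submodule.span_induction with
  | mem x hx =>
    obtain ⟨L, rfl, rfl⟩ := hx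
    rw [← vProd_cons]
    exact vProd_mem_vSpan (by simp)
  | zero => simp
  | add x y _ _ hx hy => rw [mul_add]; exact add_mem hx hy
  | smul c x _ hx => rw [mul_smul_comm]; exact Submodule.smul_mem _ _ hx

theorem vProd_mul_t (i : Fin (n - 1)) (L : List (Fin n)) :
    ∃ y ∈ vSpan q n (· = L.length), ∃ z ∈ vSpan q n (· = L.length),
      vProd q n L * HCt q n i = HCt q n i * y + z := by
  induction L with
  | nil => exact ⟨1, vProd_mem_vSpan (L := []) rfl, 0, zero_mem _, by simp⟩
  | cons a L ih =>
    obtain ⟨y, hy, z, hz, h⟩ := ih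
    have hi := i.2
    let j : Fin n := ⟨i, by omega⟩
    let j' : Fin n := ⟨i + 1, by omega⟩
    rw [vProd_cons, mul_assoc, h, mul_add, ← mul_assoc]
    have hz' := v_mul_mem_vSpan a hz
    by_cases h₁ : a = j
    · refine ⟨HCv q n j' * y, v_mul_mem_vSpan _ hy,
        (q - q⁻¹) • (HCv q n j * y - HCv q n j' * y) + HCv q n a * z,
        add_mem (Submodule.smul_mem _ _
          (sub_mem (v_mul_mem_vSpan _ hy) (v_mul_mem_vSpan _ hy))) hz', ?_⟩
      have := t_mul_v_right (q := q) i j j' rfl rfl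
      rw [h₁, ← mul_assoc (HCt q n i), this, sub_mul, smul_mul_assoc, sub_mul]
      abel
    by_cases h₂ : a = j'
    · refine ⟨HCv q n j * y, v_mul_mem_vSpan _ hy, HCv q n a * z, hz', ?_⟩
      rw [h₂, ← mul_assoc (HCt q n i), t_mul_v_left i j j' rfl rfl]
    · refine ⟨HCv q n a * y, v_mul_mem_vSpan _ hy, HCv q n a * z, hz', ?_⟩
      rw [← mul_assoc (HCt q n i), t_mul_v_of_ne]
      exact ⟨fun e => h₁ (Fin.ext e), fun e => h₂ (Fin.ext e)⟩

theorem exists_mul_eq_of_mem_even {p : HeckeClifford q n} {μ : ℂ}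
    (hpt : ∀ i, p * HCt q n i = μ • p) {f : HeckeClifford q n} (hf : f ∈ HCeven q n) :
    ∀ w ∈ vSpan q n Even, ∃ w' ∈ vSpan q n Even, p * w * f = p * w' := by
  induction hf using Algebra.adjoin_induction with
  | mem f hf =>
    intro w hw
    induction hw using Submodule.span_induction with
    | mem w hw =>
      obtain ⟨L, hL, rfl⟩ := hw
      rcases hf with ⟨i, rfl⟩ | ⟨i, rfl⟩
      · obtain ⟨y, hy, z, hz, h⟩ := vProd_mul_t (q := q) i L
        have hle : vSpan q n (· = L.length) ≤ vSpan q n Even := vSpan_mono fun k hk => hk ▸ hL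
        refine ⟨μ • y + z, add_mem (Submodule.smul_mem _ _ (hle hy)) (hle hz), ?_⟩
        rw [mul_assoc, h, mul_add, ← mul_assoc, hpt, mul_add, smul_mul_assoc, mul_smul_comm]
      · refine ⟨vProd q n L * HCe q n i, ?_, mul_assoc _ _ _⟩
        have hi := i.2
        have : HCe q n i = vProd q n [⟨i, by omega⟩, ⟨i + 1, by omega⟩] := by simp [HCe]
        rw [this, ← vProd_append]
        exact vProd_mem_vSpan (by simpa using hL.add even_two)
    | zero => exact ⟨0, zero_mem _, by simp⟩
    | add x y _ _ hx hy =>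
      obtain ⟨x', hx', ex⟩ := hx
      obtain ⟨y', hy', ey⟩ := hy
      exact ⟨x' + y', add_mem hx' hy', by rw [mul_add, add_mul, ex, ey, mul_add]⟩
    | smul c x _ hx =>
      obtain ⟨x', hx', ex⟩ := hx
      exact ⟨c • x', Submodule.smul_mem _ _ hx', by
        rw [mul_smul_comm, smul_mul_assoc, ex, mul_smul_comm]⟩
  | algebraMap c =>
    intro w hw
    exact ⟨c • w, Submodule.smul_mem _ _ hw, by
      rw [← Algebra.commutes, ← Algebra.smul_def, mul_smul_comm]⟩
  | add x y _ _ hx hy =>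
    intro w hw
    obtain ⟨x', hx', ex⟩ := hx w hw
    obtain ⟨y', hy', ey⟩ := hy w hw
    exact ⟨x' + y', add_mem hx' hy', by rw [mul_add, ex, ey, mul_add]⟩
  | mul x y _ _ hx hy =>
    intro w hw
    obtain ⟨x', hx', ex⟩ := hx w hw
    obtain ⟨y', hy', ey⟩ := hy x' hx'
    exact ⟨y', hy', by rw [← mul_assoc, ex, ey]⟩

/-- Sandwiching between a common eigenvector of the `t_i` lets us exchange the index `i + 1`
for `i` in a Clifford monomial. -/
theorem sandwich_shift {p : HeckeClifford q n} {μ : ℂ} (hμ : μ ≠ 0)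
    (htp : ∀ i, HCt q n i * p = μ • p) (hpt : ∀ i, p * HCt q n i = μ • p)
    (i : Fin (n - 1)) (a j j' : Fin n) (R : List (Fin n)) (hj : (j : ℕ) = i)
    (hj' : (j' : ℕ) = i + 1) (ha : (a : ℕ) ≠ i ∧ (a : ℕ) ≠ i + 1)
    (hR : ∀ l ∈ R, (l : ℕ) ≠ i ∧ (l : ℕ) ≠ i + 1) :
    p * vProd q n (a :: j' :: R) * p = p * vProd q n (a :: j :: R) * p := by
  have key : HCt q n i * vProd q n (a :: j :: R) = vProd q n (a :: j' :: R) * HCt q n i := by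
    simp only [vProd_cons]
    rw [← mul_assoc, t_mul_v_of_ne i a ha, mul_assoc, ← mul_assoc (HCt q n i),
      t_mul_v_left i j j' hj hj', mul_assoc, t_mul_vProd_comm i R hR]
    simp only [mul_assoc]
  apply smul_right_injective _ hμ
  calc μ • (p * vProd q n (a :: j' :: R) * p)
      = p * (vProd q n (a :: j' :: R) * HCt q n i) * p := by
        simp only [mul_assoc, htp, mul_smul_comm]
    _ = μ • (p * vProd q n (a :: j :: R) * p) := by
        rw [← key, ← mul_assoc, hpt]
        simp only [smul_mul_assoc]

theorem eq_div_smul_of_smul_eq {M : Type*} [AddCommMonoid M] [Module ℂ M] {μ r : ℂ} {x y : M}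
    (hr : μ * r = μ ^ 2 - 1) (hμ₂ : μ ^ 2 + 1 ≠ 0) (h : μ • x + μ • x = r • (x + y)) :
    x = ((μ ^ 2 - 1) / (μ ^ 2 + 1)) • y := by
  let := Module.addCommMonoidToAddCommGroup ℂ (M := M)
  have hmul := congrArg (μ • ·) h
  simp only [smul_add, smul_smul, hr] at hmul
  apply smul_right_injective _ hμ₂
  simp only [smul_smul, mul_div_cancel₀ _ hμ₂]
  linear_combination (norm := module) hmul

/-- Sandwiching between a common eigenvector of the `t_i` removes an adjacent pair of
indices from a Clifford monomial, up to a scalar. -/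
theorem sandwich_contract {p : HeckeClifford q n} {μ : ℂ}
    (hμq : μ * (q - q⁻¹) = μ ^ 2 - 1) (hμ₂ : μ ^ 2 + 1 ≠ 0)
    (htp : ∀ i, HCt q n i * p = μ • p) (hpt : ∀ i, p * HCt q n i = μ • p)
    (i : Fin (n - 1)) (j j' : Fin n) (R : List (Fin n)) (hj : (j : ℕ) = i)
    (hj' : (j' : ℕ) = i + 1) (hR : ∀ l ∈ R, (l : ℕ) ≠ i ∧ (l : ℕ) ≠ i + 1) :
    p * vProd q n (j :: j' :: R) * p =
      ((μ ^ 2 - 1) / (μ ^ 2 + 1)) • (p * vProd q n R * p) := by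
  have hne : j' ≠ j := fun h => by have := congrArg Fin.val h; omega
  have key : HCt q n i * vProd q n (j :: j' :: R) + vProd q n (j :: j' :: R) * HCt q n i =
      (q - q⁻¹) • (vProd q n (j :: j' :: R) + vProd q n R) := by
    simp only [vProd_cons]
    rw [← mul_assoc, t_mul_v_left i j j' hj hj', mul_assoc, ← mul_assoc (HCt q n i),
      t_mul_v_right i j j' hj hj', sub_mul, mul_assoc, t_mul_vProd_comm i R hR, smul_mul_assoc,
      sub_mul, mul_sub, mul_smul_comm, mul_sub]
    simp only [← mul_assoc, v_mul_self, v_anticomm hne, neg_mul', one_mul]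
    module
  have h := congrArg (fun x => p * x * p) key
  simp only [mul_add, add_mul, mul_smul_comm, smul_mul_assoc] at h
  rw [← mul_assoc, hpt, mul_assoc p (_ * _), mul_assoc _ (HCt q n i) p, htp] at h
  simp only [mul_smul_comm, smul_mul_assoc, ← mul_assoc] at h
  exact eq_div_smul_of_smul_eq hμq hμ₂ h

theorem sandwich_even {p : HeckeClifford q n} {μ : ℂ} (hidem : p * p = p) (hμ : μ ≠ 0)
    (hμq : μ * (q - q⁻¹) = μ ^ 2 - 1) (hμ₂ : μ ^ 2 + 1 ≠ 0)
    (htp : ∀ i, HCt q n i * p = μ • p) (hpt : ∀ i, p * HCt q n i = μ • p)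
    (k : ℕ) : ∀ L : List (Fin n), L.length = 2 * k → ∃ c : ℂ, p * vProd q n L * p = c • p := by
  have perm {L M : List (Fin n)} (h : L.Perm M) :
      (∃ c : ℂ, p * vProd q n M * p = c • p) → ∃ c : ℂ, p * vProd q n L * p = c • p := by
    rintro ⟨c, hc⟩
    rcases vProd_perm (q := q) h with e | e
    · exact ⟨c, by rw [e, hc]⟩
    · exact ⟨-c, by rw [e, mul_neg', neg_mul', hc]; exact (neg_smul c p).symm⟩
  induction k with
  | zero =>
    intro L hL
    obtain rfl := List.length_eq_zero_iff.mp hL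
    exact ⟨1, by simp [hidem]⟩
  | succ k ih =>
    have nodup (d : ℕ) : ∀ (a b : Fin n) (R : List (Fin n)), R.length = 2 * k →
        (a :: b :: R).Nodup → (b : ℕ) = a + 1 + d →
        ∃ c : ℂ, p * vProd q n (a :: b :: R) * p = c • p := by
      induction d with
      | zero =>
        intro a b R hR hnd hd
        have hb := b.2
        simp only [List.nodup_cons, List.mem_cons, not_or] at hnd
        obtain ⟨c, hc⟩ := ih R hR
        refine ⟨_, (sandwich_contract hμq hμ₂ htp hpt ⟨a, by omega⟩ a b R rfl hd ?_).trans
          (by rw [hc, smul_smul])⟩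
        intro l hl
        exact ⟨fun e => hnd.1.2 (Fin.ext e ▸ hl),
          fun e => hnd.2.1 ((Fin.ext (e.trans hd.symm) : l = b) ▸ hl)⟩
      | succ d ihd =>
        intro a b R hR hnd hd
        have hb := b.2
        let j : Fin n := ⟨a + 1 + d, by omega⟩
        by_cases hj : j ∈ R
        · have hp := List.perm_cons_erase hj
          have hp' : (a :: b :: R).Perm (a :: j :: b :: R.erase j) :=
            ((hp.cons b).trans (.swap _ _ _)).cons a
          refine perm hp' (ihd a j _ ?_ (hp'.nodup_iff.mp hnd) rfl)
          rw [← hR, hp.length_eq]; rfl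
        · simp only [List.nodup_cons, List.mem_cons, not_or] at hnd
          have haj : a ≠ j := fun e => by have : (a : ℕ) = a + 1 + d := congrArg Fin.val e; omega
          rw [sandwich_shift hμ htp hpt ⟨a + 1 + d, by omega⟩ a j b R rfl hd
            (by simp only; omega) ?_]
          · exact ihd a j R hR (by
              simp only [List.nodup_cons, List.mem_cons, not_or]
              exact ⟨⟨haj, hnd.1.2⟩, hj, hnd.2.2⟩) rfl
          · intro l hl
            exact ⟨fun e => hj ((Fin.ext e : l = j) ▸ hl),
              fun e => hnd.2.1 ((Fin.ext (e.trans hd.symm) : l = b) ▸ hl)⟩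
    intro L hL
    by_cases hnd : L.Nodup
    · match L, hL, hnd with
      | a :: b :: R, hL, hnd =>
        have hR : R.length = 2 * k := by simp at hL; omega
        rcases lt_trichotomy a b with h | h | h
        · exact nodup (b - a - 1) a b R hR hnd (by omega)
        · exact absurd (h ▸ List.mem_cons_self) (List.nodup_cons.mp hnd).1
        · exact perm (.swap _ _ _) (nodup (a - b - 1) b a R hR
            ((List.Perm.swap _ _ _).nodup_iff.mp hnd) (by omega))
    · obtain ⟨a, ha⟩ := List.exists_duplicate_iff_not_nodup.mpr hnd
      obtain ⟨R, hR⟩ := (List.duplicate_iff_sublist.mp ha).exists_perm_append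
      refine perm hR ?_
      obtain ⟨c, hc⟩ := ih R (by have := hR.length_eq; simp at this; omega)
      have e : vProd q n ([a, a] ++ R) = vProd q n R := by
        rw [vProd_append]
        simp [v_mul_self]
      exact ⟨c, e ▸ hc⟩

theorem exists_sandwich_eq_smul {p : HeckeClifford q n} {μ : ℂ} (hidem : p * p = p)
    (hμ : μ ≠ 0) (hμq : μ * (q - q⁻¹) = μ ^ 2 - 1) (hμ₂ : μ ^ 2 + 1 ≠ 0)
    (htp : ∀ i, HCt q n i * p = μ • p) (hpt : ∀ i, p * HCt q n i = μ • p)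
    {f : HeckeClifford q n} (hf : f ∈ HCeven q n) : ∃ c : ℂ, p * f * p = c • p := by
  obtain ⟨w, hw, h⟩ := exists_mul_eq_of_mem_even hpt hf 1
    (vProd_mem_vSpan (L := []) Even.zero)
  rw [mul_one] at h
  rw [h]
  clear h
  induction hw using Submodule.span_induction with
  | mem w hw =>
    obtain ⟨L, ⟨k, hk⟩, rfl⟩ := hw
    exact sandwich_even hidem hμ hμq hμ₂ htp hpt k L (by omega)
  | zero => exact ⟨0, by simp⟩
  | add x y _ _ hx hy =>
    obtain ⟨c, hc⟩ := hx
    obtain ⟨d, hd⟩ := hy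
    exact ⟨c + d, by rw [mul_add, add_mul, hc, hd, add_smul]⟩
  | smul a x _ hx =>
    obtain ⟨c, hc⟩ := hx
    exact ⟨a * c, by rw [mul_smul_comm, smul_mul_assoc, hc, smul_smul]⟩

end HeckeClifford

/-- if `q^{2j} ≠ 1` for `2 ≤ j ≤ n` and `p` is a nonzero idempotent in the
Hecke subalgebra (generated by the `t_i`) on which every `t_i` acts by `q` (or by `-q⁻¹`)
on both sides, then `p` is a minimal idempotent of `G_n[0]`: `p f p` is a scalar multiple
of `p` for every `f ∈ G_n[0]`. -/
theorem heckeClifford_minimal_idempotent (q : ℂ) (hq : q ≠ 0) (n : ℕ) (hn : 2 ≤ n)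
    (hroot : ∀ j : ℕ, 2 ≤ j → j ≤ n → q ^ (2 * j) ≠ 1)
    (p : HeckeClifford q n)
    (hmem : p ∈ Algebra.adjoin ℂ (Set.range (HCt q n)))
    (hidem : p * p = p) (hne : p ≠ 0)
    (hcase :
      (∀ i : Fin (n - 1), HCt q n i * p = q • p ∧ p * HCt q n i = q • p) ∨
      (∀ i : Fin (n - 1), HCt q n i * p = (-q⁻¹) • p ∧ p * HCt q n i = (-q⁻¹) • p)) :
    ∀ f ∈ HCeven q n, ∃ c : ℂ, p * f * p = c • p := by
  have hq2 : q ^ 2 + 1 ≠ 0 := fun h => hroot 2 le_rfl hn (by linear_combination (q ^ 2 - 1) * h)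
  intro f hf
  rcases hcase with h | h
  · refine HeckeClifford.exists_sandwich_eq_smul hidem hq ?_ hq2
      (fun i => (h i).1) (fun i => (h i).2) hf
    field_simp
  · refine HeckeClifford.exists_sandwich_eq_smul hidem (neg_ne_zero.mpr (inv_ne_zero hq)) ?_ ?_
      (fun i => (h i).1) (fun i => (h i).2) hf
    · field_simp
      ring
    · intro h0
      apply hq2
      field_simp at h0
      linear_combination h0
end
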